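/- arXiv:2501.12848 — 9 statements merged into one kernel-verified Lean document; each statement's English description precedes it below -/
import Mathlib

section
/- Let S₁, S₂, S̃₁, S̃₂ be finite sets of nonnegative integers, let u ≥ 0 be a real number, and let μ ∈ (0,1). If S̃₁ approximates S₁ with factor 1−μ in [0,u] and S̃₂ approximates S₂ with factor 1−μ in [0,u], then S̃₁ ⊕ S̃₂ approximates S₁ ⊕ S₂ with factor 1−μ in [0,u]. -/
open Pointwise

/-- `A ⊕ B = (A + B) ∪ A ∪ B`. -/
def oplus (A B : Finset ℕ) : Finset ℕ := (A + B) ∪ A ∪ B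

/-- `S'` approximates `S` with factor `1-μ` in `[w,v]`. -/
def ApproxFactorOn (μ w v : ℝ) (S S' : Set ℕ) : Prop :=
  (∀ s ∈ S, w ≤ (s : ℝ) → (s : ℝ) ≤ v →
      ∃ s' ∈ S', (1 - μ) * (s : ℝ) ≤ (s' : ℝ) ∧ (s' : ℝ) ≤ (s : ℝ)) ∧
  (∀ s' ∈ S', ∃ s ∈ S, (s' : ℝ) ≤ (s : ℝ) ∧ (s : ℝ) ≤ (s' : ℝ) / (1 - μ))

theorem mem_oplus {A B : Finset ℕ} {n : ℕ} :
    n ∈ oplus A B ↔ (∃ a ∈ A, ∃ b ∈ B, a + b = n) ∨ n ∈ A ∨ n ∈ B := by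
  simp only [oplus, Finset.mem_union, Finset.mem_add, or_assoc]

theorem stmt3 (μ u : ℝ) (hμ0 : 0 < μ) (hμ1 : μ < 1) (hu : 0 ≤ u)
    (S₁ S₂ T₁ T₂ : Finset ℕ)
    (h1 : ApproxFactorOn μ 0 u ↑S₁ ↑T₁)
    (h2 : ApproxFactorOn μ 0 u ↑S₂ ↑T₂) :
    ApproxFactorOn μ 0 u ↑(oplus S₁ S₂) ↑(oplus T₁ T₂) := by
  simp only [ApproxFactorOn, Finset.mem_coe] at h1 h2 ⊢
  obtain ⟨cover₁, sound₁⟩ := h1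
  obtain ⟨cover₂, sound₂⟩ := h2
  constructor
  · intro s hs hs0 hsu
    rcases mem_oplus.1 hs with ⟨a, ha, b, hb, rfl⟩ | hs | hs
    · have ha0 : (0 : ℝ) ≤ a := a.cast_nonneg
      have hb0 : (0 : ℝ) ≤ b := b.cast_nonneg
      push_cast at hsu
      obtain ⟨a', ha', hal, hau⟩ := cover₁ a ha ha0 (by linarith)
      obtain ⟨b', hb', hbl, hbu⟩ := cover₂ b hb hb0 (by linarith)
      refine ⟨a' + b', mem_oplus.2 (.inl ⟨a', ha', b', hb', rfl⟩), ?_, ?_⟩ <;>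
        push_cast <;> linarith
    · obtain ⟨t, ht, h⟩ := cover₁ s hs hs0 hsu
      exact ⟨t, mem_oplus.2 (.inr (.inl ht)), h⟩
    · obtain ⟨t, ht, h⟩ := cover₂ s hs hs0 hsu
      exact ⟨t, mem_oplus.2 (.inr (.inr ht)), h⟩
  · intro t ht
    rcases mem_oplus.1 ht with ⟨a', ha', b', hb', rfl⟩ | ht | ht
    · obtain ⟨a, ha, hal, hau⟩ := sound₁ a' ha'
      obtain ⟨b, hb, hbl, hbu⟩ := sound₂ b' hb'
      refine ⟨a + b, mem_oplus.2 (.inl ⟨a, ha, b, hb, rfl⟩), ?_, ?_⟩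
      · push_cast
        linarith
      · push_cast
        rw [add_div]
        linarith
    · obtain ⟨s, hs, h⟩ := sound₁ t ht
      exact ⟨s, mem_oplus.2 (.inr (.inl hs)), h⟩
    · obtain ⟨s, hs, h⟩ := sound₂ t ht
      exact ⟨s, mem_oplus.2 (.inr (.inr hs)), h⟩
end

section
/- Let S₁, S₂, S̃₁, S̃₂ be finite sets of nonnegative integers, let u ≥ 0 be a real number, and let δ₁, δ₂ ≥ 0. If S̃₁ approximates S₁ with additive error δ₁ in [0,u] and S̃₂ approximates S₂ with additive error δ₂ in [0,u], then S̃₁ ⊕ S̃₂ approximates S₁ ⊕ S₂ with additive error δ₁ + δ₂ in [0,u]. -/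
open Pointwise

/-- `S'` approximates `S` with additive error `δ` in `[w,v]`. -/
def ApproxAddOn (δ w v : ℝ) (S S' : Set ℕ) : Prop :=
  (∀ s ∈ S, w ≤ (s : ℝ) → (s : ℝ) ≤ v →
      ∃ s' ∈ S', (s : ℝ) - δ ≤ (s' : ℝ) ∧ (s' : ℝ) ≤ (s : ℝ) + δ) ∧
  (∀ s' ∈ S', ∃ s ∈ S, (s' : ℝ) - δ ≤ (s : ℝ) ∧ (s : ℝ) ≤ (s' : ℝ) + δ)

theorem stmt4 (δ₁ δ₂ u : ℝ) (hδ₁ : 0 ≤ δ₁) (hδ₂ : 0 ≤ δ₂) (hu : 0 ≤ u)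
    (S₁ S₂ T₁ T₂ : Finset ℕ)
    (h1 : ApproxAddOn δ₁ 0 u ↑S₁ ↑T₁)
    (h2 : ApproxAddOn δ₂ 0 u ↑S₂ ↑T₂) :
    ApproxAddOn (δ₁ + δ₂) 0 u ↑(oplus S₁ S₂) ↑(oplus T₁ T₂) := by
  obtain ⟨f₁, g₁⟩ := h1
  obtain ⟨f₂, g₂⟩ := h2
  simp only [Finset.mem_coe] at f₁ g₁ f₂ g₂
  simp only [ApproxAddOn, oplus, Finset.mem_coe, Finset.mem_union, Finset.mem_add]
  constructor
  · rintro s ((⟨a, ha, b, hb, rfl⟩ | hs) | hs) h0 hsu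
    · push_cast at hsu ⊢
      have ha0 : (0 : ℝ) ≤ a := a.cast_nonneg
      have hb0 : (0 : ℝ) ≤ b := b.cast_nonneg
      obtain ⟨a', ha', _, _⟩ := f₁ a ha ha0 (by linarith)
      obtain ⟨b', hb', _, _⟩ := f₂ b hb hb0 (by linarith)
      refine ⟨a' + b', .inl (.inl ⟨a', ha', b', hb', rfl⟩), ?_, ?_⟩ <;> push_cast <;> linarith
    · obtain ⟨t, ht, _, _⟩ := f₁ s hs h0 hsu
      exact ⟨t, .inl (.inr ht), by linarith, by linarith⟩
    · obtain ⟨t, ht, _, _⟩ := f₂ s hs h0 hsu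
      exact ⟨t, .inr ht, by linarith, by linarith⟩
  · rintro t ((⟨a, ha, b, hb, rfl⟩ | ht) | ht)
    · obtain ⟨a', ha', _, _⟩ := g₁ a ha
      obtain ⟨b', hb', _, _⟩ := g₂ b hb
      refine ⟨a' + b', .inl (.inl ⟨a', ha', b', hb', rfl⟩), ?_, ?_⟩ <;> push_cast <;> linarith
    · obtain ⟨s, hs, _, _⟩ := g₁ t ht
      exact ⟨s, .inl (.inr hs), by linarith, by linarith⟩
    · obtain ⟨s, hs, _, _⟩ := g₂ t ht
      exact ⟨s, .inr hs, by linarith, by linarith⟩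
end

section
/- For every fixed positive integer d there exist positive real constants c₁ and c₂ (depending only on d) such that the following holds: for all positive integers u, k, ℓ and all finite sets A₁, …, A_ℓ ⊆ {1, …, u} each of size exactly k, if ℓ^d · k ≥ c₁ · u, then A₁ ⊕ ⋯ ⊕ A_ℓ contains an arithmetic progression of length at least c₂ · ℓ · k^{1/d}. -/
/-- `A₁ ⊕ ⋯ ⊕ A_ℓ`: all sums of elements taken from a nonempty subcollection of the `A i`,
one element from each chosen set. -/
def OplusFamily {ℓ : ℕ} (A : Fin ℓ → Finset ℤ) : Set ℤ :=
  {s | ∃ I : Finset (Fin ℓ), I.Nonempty ∧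
        ∃ f : Fin ℓ → ℤ, (∀ i ∈ I, f i ∈ A i) ∧ s = ∑ i ∈ I, f i}

/-- `T` contains an arithmetic progression of length `L`. -/
def HasAPLen (T : Set ℤ) (L : ℕ) : Prop :=
  ∃ a Δ : ℤ, 1 ≤ Δ ∧ ∀ j : ℕ, j < L → a + (j : ℤ) * Δ ∈ T

namespace SumsetAP
open scoped Pointwise
open Finset

/-- The `n`-fold sumset of `S`. -/
def iterSum (S : Finset ℤ) : ℕ → Finset ℤ
  | 0 => {0}
  | n + 1 => iterSum S n + S

/-- A finite set of integers that contains `0` and is closed under negation. -/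
structure IsSymm (S : Finset ℤ) : Prop where
  zero_mem : (0 : ℤ) ∈ S
  neg_mem : ∀ x ∈ S, -x ∈ S

lemma iterSum_one (S : Finset ℤ) : iterSum S 1 = S := by
  ext x
  simp [iterSum, Finset.mem_add]

lemma add_mem_iterSum {S : Finset ℤ} {a b : ℕ} {x y : ℤ} (hx : x ∈ iterSum S a)
    (hy : y ∈ iterSum S b) : x + y ∈ iterSum S (a + b) := by
  induction b generalizing y with
  | zero =>
    have : y = 0 := by simpa [iterSum] using hy
    simpa [this] using hx
  | succ b ih =>
    obtain ⟨z, hz, s, hs, rfl⟩ := Finset.mem_add.1 hy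
    rw [← add_assoc, ← add_assoc]
    exact Finset.add_mem_add (ih hz) hs

lemma exists_add_of_mem_iterSum {S : Finset ℤ} {a b : ℕ} {z : ℤ} (hz : z ∈ iterSum S (a + b)) :
    ∃ x ∈ iterSum S a, ∃ y ∈ iterSum S b, z = x + y := by
  induction b generalizing z with
  | zero => exact ⟨z, hz, 0, by simp [iterSum], by simp⟩
  | succ b ih =>
    obtain ⟨w, hw, s, hs, rfl⟩ := Finset.mem_add.1 hz
    obtain ⟨x, hx, y, hy, rfl⟩ := ih hw
    exact ⟨x, hx, y + s, Finset.add_mem_add hy hs, by ring⟩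

lemma abs_le_of_mem_iterSum {S : Finset ℤ} {u : ℕ} (hu : ∀ x ∈ S, |x| ≤ u) {n : ℕ} {x : ℤ}
    (hx : x ∈ iterSum S n) : |x| ≤ n * u := by
  induction n generalizing x with
  | zero => simp_all [iterSum]
  | succ n ih =>
    obtain ⟨y, hy, s, hs, rfl⟩ := Finset.mem_add.1 hx
    have := ih hy
    have := hu s hs
    have := abs_add_le y s
    push_cast
    linarith

lemma card_iterSum_le {S : Finset ℤ} {u : ℕ} (hu : ∀ x ∈ S, |x| ≤ u) (n : ℕ) :
    #(iterSum S n) ≤ 2 * (n * u) + 1 := by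
  have h : iterSum S n ⊆ Finset.Icc (-((n * u : ℕ) : ℤ)) ((n * u : ℕ) : ℤ) := by
    intro x hx
    have := abs_le_of_mem_iterSum hu hx
    rw [Finset.mem_Icc, ← abs_le]
    push_cast
    exact this
  refine (Finset.card_le_card h).trans ?_
  rw [Int.card_Icc]
  omega

namespace IsSymm
variable {S : Finset ℤ} (hS : IsSymm S)
include hS

lemma zero_mem_iterSum (n : ℕ) : (0 : ℤ) ∈ iterSum S n := by
  induction n with
  | zero => simp [iterSum]
  | succ n ih =>
    rw [← add_zero (0 : ℤ)]
    exact Finset.add_mem_add ih hS.zero_mem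

lemma iterSum_mono {a b : ℕ} (h : a ≤ b) : iterSum S a ⊆ iterSum S b := by
  intro x hx
  obtain ⟨c, rfl⟩ := Nat.exists_eq_add_of_le h
  simpa using add_mem_iterSum hx (hS.zero_mem_iterSum c)

lemma neg_mem_iterSum {n : ℕ} {x : ℤ} (hx : x ∈ iterSum S n) : -x ∈ iterSum S n := by
  induction n generalizing x with
  | zero => simp_all [iterSum]
  | succ n ih =>
    obtain ⟨y, hy, s, hs, rfl⟩ := Finset.mem_add.1 hx
    rw [neg_add]
    exact Finset.add_mem_add (ih hy) (hS.neg_mem s hs)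

lemma sub_mem_iterSum {a b : ℕ} {x y : ℤ} (hx : x ∈ iterSum S a)
    (hy : y ∈ iterSum S b) : x - y ∈ iterSum S (a + b) := by
  rw [sub_eq_add_neg]
  exact add_mem_iterSum hx (hS.neg_mem_iterSum hy)

omit hS in
lemma natCast_mul_mem_iterSum {n : ℕ} {x : ℤ} (hx : x ∈ iterSum S n) (j : ℕ) :
    (j : ℤ) * x ∈ iterSum S (j * n) := by
  induction j with
  | zero => simp [iterSum]
  | succ j ih =>
    rw [Nat.cast_succ, add_one_mul, add_one_mul]
    exact add_mem_iterSum ih hx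

lemma mul_mem_iterSum {n B : ℕ} {x b : ℤ} (hx : x ∈ iterSum S n) (hb : |b| ≤ B) :
    b * x ∈ iterSum S (B * n) := by
  have h1 : b.natAbs ≤ B := by
    have := Int.natCast_natAbs b
    omega
  refine hS.iterSum_mono (Nat.mul_le_mul_right n h1) ?_
  have h2 := natCast_mul_mem_iterSum hx b.natAbs
  rcases Int.natAbs_eq b with h | h
  · rw [← h] at h2; exact h2
  · have : b * x = -((b.natAbs : ℤ) * x) := by rw [h]; simp
    rw [this]; exact hS.neg_mem_iterSum h2

omit hS in
lemma sum_mem_iterSum {ι : Type*} (I : Finset ι) {f : ι → ℤ} {n : ι → ℕ}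
    (hf : ∀ i ∈ I, f i ∈ iterSum S (n i)) : ∑ i ∈ I, f i ∈ iterSum S (∑ i ∈ I, n i) := by
  classical
  induction I using Finset.induction_on with
  | empty => simp [iterSum]
  | insert a I ha ih =>
    rw [Finset.sum_insert ha, Finset.sum_insert ha]
    exact add_mem_iterSum (hf a (by simp)) (ih fun i hi => hf i (by simp [hi]))

lemma combination_mem_iterSum {R B n : ℕ} {b g : Fin R → ℤ} (hb : ∀ i, |b i| ≤ B)
    (hg : ∀ i, g i ∈ iterSum S n) : ∑ i, b i * g i ∈ iterSum S (R * (B * n)) := by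
  have := sum_mem_iterSum (S := S) (univ : Finset (Fin R)) (f := fun i => b i * g i)
    (n := fun _ => B * n) (fun i _ => hS.mul_mem_iterSum (hg i) (hb i))
  simpa using this

end IsSymm

/-- The elements `g i` generate all the multiples of `iterSum S m`, up to an error in
`iterSum S (M * m)` and with coefficients growing linearly. -/
def Spans (S : Finset ℤ) (m R M : ℕ) (g : Fin R → ℤ) : Prop :=
  (∀ i, g i ∈ iterSum S (M * m)) ∧ ∀ n : ℕ, ∀ w ∈ iterSum S (n * m),
    ∃ y ∈ iterSum S (M * m), ∃ b : Fin R → ℤ, (∀ i, |b i| ≤ M * n) ∧ w = y + ∑ i, b i * g i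

lemma exists_spans_of_card_le {S : Finset ℤ} (hS : IsSymm S) {m K : ℕ}
    (hK : #(iterSum S (4 * m)) ≤ K * #(iterSum S m)) :
    ∃ R ≤ K, ∃ g : Fin R → ℤ, Spans S m R 3 g := by
  have hne : (iterSum S m).Nonempty := ⟨0, hS.zero_mem_iterSum m⟩
  have hadd : iterSum S (3 * m) + iterSum S m ⊆ iterSum S (4 * m) := by
    intro x hx
    obtain ⟨y, hy, z, hz, rfl⟩ := Finset.mem_add.1 hx
    have := add_mem_iterSum hy hz
    convert this using 2
    ring
  obtain ⟨F, hF, hFK, hcov⟩ := Finset.ruzsa_covering_add (K := (K : ℝ)) (A := iterSum S (3 * m))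
    (B := iterSum S m) hne (by exact_mod_cast (Finset.card_le_card hadd).trans hK)
  have hFK' : #F ≤ K := by exact_mod_cast hFK
  have e := F.equivFin
  refine ⟨#F, hFK', fun i => (e.symm i : ℤ), fun i => hF (e.symm i).2, ?_⟩
  have key : ∀ n : ℕ, ∀ w ∈ iterSum S (n * m), ∃ y ∈ iterSum S (2 * m), ∃ b : Fin #F → ℤ,
      (∀ i, |b i| ≤ n) ∧ w = y + ∑ i, b i * (e.symm i : ℤ) := by
    intro n
    induction n with
    | zero => 
      intro w hw
      exact ⟨w, hS.iterSum_mono (by omega) hw, 0, by simp, by simp⟩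
    | succ n ih =>
      intro w hw
      rw [Nat.succ_mul] at hw
      obtain ⟨x, hx, s, hs, rfl⟩ := exists_add_of_mem_iterSum hw
      obtain ⟨y, hy, b, hb, rfl⟩ := ih x hx
      have h3 : y + s ∈ iterSum S (3 * m) := by
        have := add_mem_iterSum hy hs
        convert this using 2
        ring
      obtain ⟨t, ht, v, hv, hts⟩ := Finset.mem_add.1 (hcov h3)
      obtain ⟨v1, hv1, v2, hv2, rfl⟩ := Finset.mem_sub.1 hv
      refine ⟨v1 - v2, ?_, b + Pi.single (e ⟨t, ht⟩) 1, ?_, ?_⟩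
      · have := hS.sub_mem_iterSum hv1 hv2
        convert this using 2
        ring
      · intro i
        have h1 := hb i
        have h2 : |(Pi.single (e ⟨t, ht⟩) 1 : Fin #F → ℤ) i| ≤ 1 := by
          by_cases h : i = e ⟨t, ht⟩
          · subst h; simp
          · simp [Pi.single_eq_of_ne h]
        have := abs_add_le (b i) ((Pi.single (e ⟨t, ht⟩) 1 : Fin #F → ℤ) i)
        rw [Pi.add_apply]
        push_cast
        linarith
      · have : ∑ i, (b + Pi.single (e ⟨t, ht⟩) 1 : Fin #F → ℤ) i * (e.symm i : ℤ)
            = ∑ i, b i * (e.symm i : ℤ) + t := by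
          simp only [Pi.add_apply, add_mul, Finset.sum_add_distrib]
          congr 1
          rw [Finset.sum_eq_single (e ⟨t, ht⟩)]
          · simp
          · intro j _ hj
            simp [Pi.single_eq_of_ne hj]
          · simp
        rw [this]
        linarith
  intro n w hw
  obtain ⟨y, hy, b, hb, h⟩ := key n w hw
  refine ⟨y, hS.iterSum_mono (by omega) hy, b, fun i => ?_, h⟩
  have := hb i
  push_cast
  linarith

lemma Spans.reduce {S : Finset ℤ} (hS : IsSymm S) {m R M M' : ℕ} (hM : 1 ≤ M)
    {g : Fin (R + 1) → ℤ} (hg : Spans S m (R + 1) M g) {c : Fin (R + 1) → ℤ}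
    (hc : ∀ i, |c i| ≤ M') (hrel : ∑ i, c i * g i ∈ iterSum S (3 * M * m)) {i₀ : Fin (R + 1)}
    (hi₀ : 12 * (M : ℤ) ^ 2 < |c i₀|) :
    ∃ g' : Fin R → ℤ, Spans S m R (8 * (4 * M + M' * M + M')) g' := by
  wlog hmax : ∀ i, |c i| ≤ |c i₀| generalizing i₀
  · obtain ⟨i₁, -, h₁⟩ := Finset.exists_max_image univ (fun i => |c i|) ⟨i₀, by simp⟩
    exact this (i₀ := i₁) (hi₀.trans_le (h₁ i₀ (by simp))) (fun i => h₁ i (by simp))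
  wlog hpos : 0 < c i₀ generalizing c
  · have h0 : c i₀ ≠ 0 := by
      intro h
      rw [h, abs_zero] at hi₀
      nlinarith [sq_nonneg (M : ℤ)]
    refine this (c := -c) (by simpa using hc) ?_ (by simpa using hi₀) (by simpa using hmax)
      (by simp; omega)
    have := hS.neg_mem_iterSum hrel
    simpa [Finset.sum_neg_distrib] using this
  rw [abs_of_pos hpos] at hi₀ hmax
  have hcM : c i₀ ≤ M' := (le_abs_self _).trans (hc i₀)
  set L := 8 * (4 * M + M' * M + M') with hL
  refine ⟨fun i => g (i₀.succAbove i), fun i => hS.iterSum_mono ?_ (hg.1 _), ?_⟩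
  · exact Nat.mul_le_mul_right m (by rw [hL]; nlinarith [Nat.zero_le (M' * M)])
  intro n
  induction n using Nat.strong_induction_on with
  | _ n ih =>
  intro w hw
  by_cases hn : n ≤ L
  · exact ⟨w, hS.iterSum_mono (Nat.mul_le_mul_right m hn) hw, 0, fun i => by simp; positivity,
      by simp⟩
  push Not at hn
  obtain ⟨y, hy, b, hb, rfl⟩ := hg.2 n w hw
  set z := ∑ i, c i * g i with hz
  set C := c i₀ with hC
  set q := b i₀ / C with hq
  set r := b i₀ % C with hr
  have hdiv : C * q + r = b i₀ := Int.mul_ediv_add_emod _ _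
  have hr0 : 0 ≤ r := Int.emod_nonneg _ hpos.ne'
  have hrC : r < C := Int.emod_lt_of_pos _ hpos
  have hMZ : (1 : ℤ) ≤ M := by exact_mod_cast hM
  have hCq : C * |q| ≤ M * n + C := by
    have h1 : C * |q| = |C * q| := by rw [abs_mul, abs_of_pos hpos]
    have h2 : C * q = b i₀ - r := by linarith
    have h3 := abs_sub (b i₀) r
    rw [abs_of_nonneg hr0] at h3
    rw [h1, h2]
    linarith [hb i₀]
  have hq4 : 12 * M * |q| ≤ n + 12 * M := by
    by_contra hcon
    push Not at hcon
    have h1 : (0 : ℤ) ≤ |q| - 1 := by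
      by_contra h
      have h0 : |q| = 0 := by have := abs_nonneg q; omega
      rw [h0] at hcon
      nlinarith
    have h2 : 12 * (M : ℤ) ^ 2 * (|q| - 1) ≤ C * (|q| - 1) :=
      mul_le_mul_of_nonneg_right hi₀.le h1
    nlinarith
  set n₁ := M + M' * M + |q|.toNat * (3 * M) with hn₁
  have hqn : ((|q|.toNat : ℕ) : ℤ) = |q| := Int.toNat_of_nonneg (abs_nonneg q)
  have hn₁le : 2 * n₁ ≤ n := by
    have h1 : 12 * M * |q|.toNat ≤ n + 12 * M := by
      have := hq4
      rw [← hqn] at this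
      exact_mod_cast this
    have h2 : 8 * (4 * M + M' * M + M') < n := hn
    rw [hn₁]
    nlinarith
  have hw₁ : y + r * g i₀ + q * z ∈ iterSum S (n₁ * m) := by
    have e1 := hS.mul_mem_iterSum (B := M') (b := r) (hg.1 i₀)
      (by rw [abs_of_nonneg hr0]; linarith)
    have e2 := hS.mul_mem_iterSum (B := |q|.toNat) (b := q) hrel (by rw [hqn])
    have := add_mem_iterSum (add_mem_iterSum hy e1) e2
    convert this using 2
    rw [hn₁]; ring
  have hn0 : n₁ < n := by omega
  obtain ⟨y', hy', b', hb', he⟩ := ih n₁ hn0 _ hw₁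
  refine ⟨y', hy', fun i => b' i + (b (i₀.succAbove i) - q * c (i₀.succAbove i)), ?_, ?_⟩
  · intro i
    have h1 := hb' i
    have h2 := hb (i₀.succAbove i)
    have h3 : |q * c (i₀.succAbove i)| ≤ M * n + C := by
      rw [abs_mul]
      have := mul_le_mul_of_nonneg_left (hmax (i₀.succAbove i)) (abs_nonneg q)
      linarith
    have h4 := abs_add_le (b' i) (b (i₀.succAbove i) - q * c (i₀.succAbove i))
    have h5 := abs_sub (b (i₀.succAbove i)) (q * c (i₀.succAbove i))
    have h6 : (L : ℤ) * n₁ * 2 ≤ L * n := by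
      have : (2 : ℤ) * n₁ ≤ n := by exact_mod_cast hn₁le
      have h0 : (0 : ℤ) ≤ L := by positivity
      nlinarith
    have h7 : (8 * (4 * M + M' * M + M') : ℤ) = L := by rw [hL]; push_cast; ring
    have h8 : (1 : ℤ) ≤ n := by omega
    have h9 : (4 * (M : ℤ) + 2 * M') * n ≤ L * n := by
      have : 4 * (M : ℤ) + 2 * M' ≤ L := by
        have : (0 : ℤ) ≤ M' * M := by positivity
        rw [← h7]; linarith
      exact mul_le_mul_of_nonneg_right this (by positivity)
    have h10 : (M' : ℤ) * 1 ≤ M' * n := mul_le_mul_of_nonneg_left h8 (by positivity)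
    linarith
  · have h1 : z = C * g i₀ + ∑ i, c (i₀.succAbove i) * g (i₀.succAbove i) := by
      rw [hz, Fin.sum_univ_succAbove _ i₀]
    rw [Fin.sum_univ_succAbove _ i₀]
    simp only [add_mul, sub_mul, Finset.sum_add_distrib, Finset.sum_sub_distrib, mul_assoc,
      ← Finset.mul_sum]
    rw [← hdiv]
    linear_combination he - q * h1

/-- A finite spanning set of vectors contains a basis in which all its elements have coordinates
of absolute value at most one. -/
lemma exists_basis_abs_coord_le_one {R : ℕ} (F : Finset (Fin R → ℝ))
    (hF : Submodule.span ℝ (F : Set (Fin R → ℝ)) = ⊤) :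
    ∃ v : Fin R → Fin R → ℝ, (∀ i, v i ∈ F) ∧ LinearIndependent ℝ v ∧
      ∀ x ∈ F, ∃ a : Fin R → ℝ, (∀ i, |a i| ≤ 1) ∧ x = ∑ i, a i • v i := by
  classical
  obtain ⟨v₀, hv₀, hli₀⟩ : ∃ v : Fin R → Fin R → ℝ, (∀ i, v i ∈ F) ∧ LinearIndependent ℝ v := by
    obtain ⟨b, hbF, hbs, hbi⟩ := exists_linearIndependent ℝ (F : Set (Fin R → ℝ))
    rw [hF] at hbs
    have hfin : b.Finite := F.finite_toSet.subset hbF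
    have := hfin.fintype
    let B := Module.Basis.mk hbi (by rw [Subtype.range_coe, hbs])
    have hcard : Fintype.card b = R := by
      have := Module.finrank_eq_card_basis B
      simpa using this.symm
    let e : Fin R ≃ b := (Fintype.equivFinOfCardEq hcard).symm
    exact ⟨fun i => (e i : Fin R → ℝ), fun i => hbF (e i).2, hbi.comp e e.injective⟩
  obtain ⟨v, hv, hmax⟩ := Finset.exists_max_image (Fintype.piFinset fun _ : Fin R => F)
    (fun v => |(Matrix.of v).det|) ⟨v₀, by simpa using hv₀⟩
  have hdet₀ : (Matrix.of v₀).det ≠ 0 := by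
    have := (Matrix.linearIndependent_rows_iff_isUnit (A := Matrix.of v₀)).1 hli₀
    exact ((Matrix.isUnit_iff_isUnit_det _).1 this).ne_zero
  have hpos : 0 < |(Matrix.of v).det| :=
    (abs_pos.2 hdet₀).trans_le (hmax v₀ (by simpa using hv₀))
  have hdet : (Matrix.of v).det ≠ 0 := abs_pos.1 hpos
  rw [Fintype.mem_piFinset] at hv
  refine ⟨v, hv, ?_, fun x hx => ⟨fun i => ((Matrix.of v).transpose.cramer x i) / (Matrix.of v).det,
    fun i => ?_, ?_⟩⟩
  · exact (Matrix.linearIndependent_rows_iff_isUnit (A := Matrix.of v)).2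
      ((Matrix.isUnit_iff_isUnit_det _).2 hdet.isUnit)
  · rw [abs_div, div_le_one hpos, Matrix.cramer_transpose_apply]
    refine hmax (Function.update v i x) ?_
    rw [Fintype.mem_piFinset]
    intro j
    by_cases h : j = i
    · subst h; simpa using hx
    · simpa [Function.update_of_ne h] using hv j
  · have h := Matrix.mulVec_cramer (Matrix.of v).transpose x
    ext j
    have hj := congrFun h j
    simp only [Matrix.mulVec, dotProduct, Matrix.transpose_apply, Matrix.of_apply,
      Matrix.det_transpose, Pi.smul_apply, smul_eq_mul] at hj
    simp only [Finset.sum_apply, Pi.smul_apply, smul_eq_mul, div_mul_eq_mul_div,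
      ← Finset.sum_div]
    rw [eq_div_iff hdet, mul_comm, ← hj]
    exact Finset.sum_congr rfl fun i _ => mul_comm _ _

/-- An integer is the binary expansion of the digits produced by a bounded doubling recursion. -/
lemma tsum_eq_of_rec {b c : ℕ → ℤ} {B : ℝ} (hc : ∀ l, |(c l : ℝ)| ≤ B)
    (hs : Summable fun l => (b l : ℝ) / 2 ^ (l + 1)) (h : ∀ l, c (l + 1) = 2 * c l - b l) :
    ∑' l, (b l : ℝ) / 2 ^ (l + 1) = c 0 := by
  have hsum : ∀ n, ∑ l ∈ Finset.range n, (b l : ℝ) / 2 ^ (l + 1) = c 0 - c n / 2 ^ n := by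
    intro n
    induction n with
    | zero => simp
    | succ n ih =>
      rw [Finset.sum_range_succ, ih, h n]
      push_cast
      field_simp
      ring
  refine tendsto_nhds_unique hs.hasSum.tendsto_sum_nat ?_
  simp only [hsum]
  have h0 : Filter.Tendsto (fun n : ℕ => (c n : ℝ) / 2 ^ n) Filter.atTop (nhds 0) := by
    have h2 : Filter.Tendsto (fun n : ℕ => B * (1 / 2 : ℝ) ^ n) Filter.atTop (nhds 0) := by
      simpa using (tendsto_pow_atTop_nhds_zero_of_lt_one (r := (1 / 2 : ℝ)) (by norm_num)
        (by norm_num)).const_mul B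
    refine squeeze_zero_norm (fun n => ?_) h2
    rw [Real.norm_eq_abs, abs_div, abs_of_pos (by positivity : (0 : ℝ) < 2 ^ n), one_div, inv_pow,
      ← div_eq_mul_inv]
    exact div_le_div_of_nonneg_right (hc n) (by positivity)
  simpa using h0.const_sub (c 0 : ℝ)

lemma summable_div_two_pow {b : ℕ → ℝ} {B : ℝ} (hb : ∀ l, |b l| ≤ B) :
    Summable fun l => b l / 2 ^ (l + 1) := by
  refine Summable.of_norm_bounded (g := fun l => B * (1 / 2 : ℝ) ^ (l + 1)) ?_ fun l => ?_
  · exact ((summable_nat_add_iff 1).2 (summable_geometric_of_lt_one (by norm_num)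
      (by norm_num : (1 / 2 : ℝ) < 1))).mul_left B
  · rw [Real.norm_eq_abs, abs_div, abs_of_pos (by positivity : (0 : ℝ) < 2 ^ (l + 1)), one_div,
      inv_pow, ← div_eq_mul_inv]
    exact div_le_div_of_nonneg_right (hb l) (by positivity)

lemma abs_tsum_div_two_pow_le {b : ℕ → ℝ} {B : ℝ} (hb : ∀ l, |b l| ≤ B) :
    |∑' l, b l / 2 ^ (l + 1)| ≤ B := by
  have h : HasSum (fun l : ℕ => B * (1 / 2 : ℝ) ^ (l + 1)) B := by
    have := (hasSum_geometric_two).mul_left (B / 2)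
    rw [div_mul_cancel₀ B two_ne_zero] at this
    rwa [show (fun l : ℕ => B * (1 / 2 : ℝ) ^ (l + 1)) = fun l => B / 2 * (1 / 2) ^ l by
      funext l; rw [pow_succ]; ring]
  rw [← Real.norm_eq_abs]
  refine tsum_of_norm_bounded h fun l => ?_
  rw [Real.norm_eq_abs, abs_div, abs_of_pos (by positivity : (0 : ℝ) < 2 ^ (l + 1)), one_div,
      inv_pow, ← div_eq_mul_inv]
  exact div_le_div_of_nonneg_right (hb l) (by positivity)

lemma Spans.exists_halving {S : Finset ℤ} {m R M : ℕ} {g : Fin R → ℤ} (hg : Spans S m R M g) :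
    ∃ (D : ℤ → ℤ) (β : ℤ → Fin R → ℤ), ∀ y n, y ∈ iterSum S (n * m) →
      D y ∈ iterSum S (M * m) ∧ 2 * y = D y + ∑ i, β y i * g i ∧ ∀ i, |β y i| ≤ 2 * M * n := by
  have h : ∀ y : ℤ, ∃ (w : ℤ) (b : Fin R → ℤ), ∀ n, y ∈ iterSum S (n * m) →
      w ∈ iterSum S (M * m) ∧ 2 * y = w + ∑ i, b i * g i ∧ ∀ i, |b i| ≤ 2 * M * n := by
    classical
    intro y
    by_cases hy : ∃ n, y ∈ iterSum S (n * m)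
    · have h1 := Nat.find_spec hy
      have h2 : 2 * y ∈ iterSum S ((2 * Nat.find hy) * m) := by
        rw [two_mul y, two_mul, add_mul]
        exact add_mem_iterSum h1 h1
      obtain ⟨w, hw, b, hb, he⟩ := hg.2 _ _ h2
      refine ⟨w, b, fun n hn => ⟨hw, he, fun i => (hb i).trans ?_⟩⟩
      have h3 : (Nat.find hy : ℤ) ≤ n := by exact_mod_cast Nat.find_min' hy hn
      push_cast
      have h4 : (0 : ℤ) ≤ M := by positivity
      nlinarith
    · push Not at hy
      exact ⟨0, 0, fun n hn => (hy n hn).elim⟩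
  choose D β h using h
  exact ⟨D, β, h⟩

/-- If small combinations of the `g i` are far from the sumset unless their coefficients are
bounded, then there are real coordinates on the sumset, dual to the `g i`. -/
lemma Spans.exists_coord {S : Finset ℤ} (hS : IsSymm S) {m R M P B M' : ℕ} {g : Fin R → ℤ}
    (hg : Spans S m R M g) (hMP : M ≤ P) (hM' : 2 * B + 6 * M * P + 30 * M ^ 2 ≤ M')
    (hI : ∀ c : Fin R → ℤ, (∀ i, |c i| ≤ M') → ∑ i, c i * g i ∈ iterSum S (3 * M * m) →
      ∀ i, |c i| ≤ 12 * (M : ℤ) ^ 2) :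
    ∃ κ : ℤ → Fin R → ℝ, (∀ y ∈ iterSum S (M * m), ∀ i, |κ y i| ≤ 2 * (M : ℝ) ^ 2) ∧
      ∀ x ∈ iterSum S (P * m), ∀ y ∈ iterSum S (P * m), ∀ z ∈ iterSum S (P * m),
        ∀ c : Fin R → ℤ, (∀ i, |c i| ≤ B) → x + y - z = ∑ i, c i * g i →
          ∀ i, κ x i + κ y i - κ z i = c i := by
  obtain ⟨D, β, hD⟩ := hg.exists_halving
  have hmem1 : ∀ y n, y ∈ iterSum S (n * m) → ∀ l, D^[l + 1] y ∈ iterSum S (M * m) := by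
    intro y n hy l
    induction l with
    | zero => exact (hD y n hy).1
    | succ l ih =>
      rw [Function.iterate_succ_apply']
      exact (hD _ M ih).1
  have hmem : ∀ y n, M ≤ n → y ∈ iterSum S (n * m) → ∀ l, D^[l] y ∈ iterSum S (n * m) := by
    intro y n hn hy l
    cases l with
    | zero => exact hy
    | succ l => exact hS.iterSum_mono (Nat.mul_le_mul_right m hn) (hmem1 y n hy l)
  have hb : ∀ y n, M ≤ n → y ∈ iterSum S (n * m) → ∀ i l,
      |((β (D^[l] y) i : ℤ) : ℝ)| ≤ 2 * M * n := by
    intro y n hn hy i l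
    have := (hD _ n (hmem y n hn hy l)).2.2 i
    exact_mod_cast this
  refine ⟨fun y i => ∑' l, (β (D^[l] y) i : ℝ) / 2 ^ (l + 1), fun y hy i => ?_, ?_⟩
  · refine (abs_tsum_div_two_pow_le (hb y M le_rfl hy i)).trans (le_of_eq (by ring))
  intro x hx y hy z hz c hc hxyz i
  obtain ⟨C, hC0, hC⟩ : ∃ C : ℕ → Fin R → ℤ, C 0 = c ∧ ∀ l i, C (l + 1) i
      = 2 * C l i - (β (D^[l] x) i + β (D^[l] y) i - β (D^[l] z) i) :=
    ⟨fun l => Nat.rec c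
      (fun l C i => 2 * C i - (β (D^[l] x) i + β (D^[l] y) i - β (D^[l] z) i)) l, rfl,
      fun _ _ => rfl⟩
  have hrel : ∀ l, D^[l] x + D^[l] y - D^[l] z = ∑ i, C l i * g i := by
    intro l
    induction l with
    | zero => rw [hC0]; exact hxyz
    | succ l ih =>
      have h1 := (hD _ P (hmem x P hMP hx l)).2.1
      have h2 := (hD _ P (hmem y P hMP hy l)).2.1
      have h3 := (hD _ P (hmem z P hMP hz l)).2.1
      simp only [Function.iterate_succ_apply', hC, sub_mul, add_mul, Finset.sum_sub_distrib,
        Finset.sum_add_distrib, mul_assoc, ← Finset.mul_sum]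
      rw [← ih]
      linarith
  have hrel3 : ∀ l, ∑ i, C (l + 1) i * g i ∈ iterSum S (3 * M * m) := by
    intro l
    rw [← hrel, show 3 * M * m = (M * m + M * m) + M * m by ring]
    exact hS.sub_mem_iterSum (add_mem_iterSum (hmem1 x P hx l) (hmem1 y P hy l)) (hmem1 z P hz l)
  have habs : ∀ l n, M ≤ n → D^[l] x ∈ iterSum S (n * m) → D^[l] y ∈ iterSum S (n * m) →
      D^[l] z ∈ iterSum S (n * m) → ∀ T : ℤ, (∀ i, |C l i| ≤ T) →
      ∀ i, |C (l + 1) i| ≤ 2 * T + 6 * M * n := by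
    intro l n hn h1 h2 h3 T hT i
    have h1 := (hD _ n h1).2.2 i
    have h2 := (hD _ n h2).2.2 i
    have h3 := (hD _ n h3).2.2 i
    have h4 := hT i
    rw [hC]
    rw [abs_le] at *
    constructor <;> linarith
  have hM'z : 2 * (B : ℤ) + 6 * M * P + 30 * M ^ 2 ≤ M' := by exact_mod_cast hM'
  have hM0 : (0 : ℤ) ≤ M := by positivity
  have hP0 : (0 : ℤ) ≤ M * P := by positivity
  have hsmall : ∀ l i, |C (l + 1) i| ≤ 12 * (M : ℤ) ^ 2 := by
    intro l
    induction l with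
    | zero =>
      refine hI _ (fun i => ?_) (hrel3 0)
      have := habs 0 P hMP hx hy hz B (by rwa [hC0]) i
      nlinarith
    | succ l ih =>
      refine hI _ (fun i => ?_) (hrel3 (l + 1))
      have := habs (l + 1) M le_rfl (hmem1 x P hx l) (hmem1 y P hy l) (hmem1 z P hz l) _ ih i
      nlinarith
  have hsx := summable_div_two_pow (hb x P hMP hx i)
  have hsy := summable_div_two_pow (hb y P hMP hy i)
  have hsz := summable_div_two_pow (hb z P hMP hz i)
  have hs := (hsx.add hsy).sub hsz
  have key := tsum_eq_of_rec (b := fun l => β (D^[l] x) i + β (D^[l] y) i - β (D^[l] z) i)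
    (c := fun l => C l i) (B := B + 12 * (M : ℝ) ^ 2) (fun l => ?_) ?_ (fun l => hC l i)
  · beta_reduce
    rw [hC0] at key
    rw [← key, ← hsx.tsum_add hsy, ← (hsx.add hsy).tsum_sub hsz]
    refine tsum_congr fun l => ?_
    push_cast
    ring
  · cases l with
    | zero =>
      have : |((c i : ℤ) : ℝ)| ≤ B := by exact_mod_cast hc i
      rw [hC0]
      exact this.trans (le_add_of_nonneg_right (by positivity))
    | succ l =>
      have : |((C (l + 1) i : ℤ) : ℝ)| ≤ 12 * (M : ℝ) ^ 2 := by exact_mod_cast hsmall l i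
      exact this.trans (le_add_of_nonneg_left (by positivity))
  · refine hs.congr fun l => ?_
    push_cast
    ring

/-- `κ` behaves like a linear coordinate map on `iterSum S N`, with values dual to `g`. -/
structure IsCoord (S : Finset ℤ) (N B : ℕ) {R : ℕ} (g : Fin R → ℤ) (κ : ℤ → Fin R → ℝ) :
    Prop where
  rel : ∀ x ∈ iterSum S N, ∀ y ∈ iterSum S N, ∀ z ∈ iterSum S N, ∀ c : Fin R → ℤ,
    (∀ i, |c i| ≤ B) → x + y - z = ∑ i, c i * g i → ∀ i, κ x i + κ y i - κ z i = c i

namespace IsCoord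

variable {S : Finset ℤ} {N B R : ℕ} {g : Fin R → ℤ} {κ : ℤ → Fin R → ℝ}

lemma map_add (h : IsCoord S N B g κ) {x y : ℤ} (hx : x ∈ iterSum S N) (hy : y ∈ iterSum S N)
    (hxy : x + y ∈ iterSum S N) : κ (x + y) = κ x + κ y := by
  ext i
  have := h.rel x hx y hy _ hxy 0 (by simp) (by simp) i
  simp only [Pi.zero_apply, Int.cast_zero] at this
  rw [Pi.add_apply]
  linarith

lemma map_zero (h : IsCoord S N B g κ) (hS : IsSymm S) : κ 0 = 0 := by
  have h0 := hS.zero_mem_iterSum N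
  have := h.map_add h0 h0 (by simpa using h0)
  simpa using this

lemma map_single (h : IsCoord S N B g κ) (hS : IsSymm S) (hB : 1 ≤ B) {i : Fin R}
    (hg : g i ∈ iterSum S N) : κ (g i) = Pi.single i 1 := by
  classical
  ext j
  have h0 := hS.zero_mem_iterSum N
  have := h.rel _ hg 0 h0 0 h0 (Pi.single i 1) (fun k => ?_) ?_ j
  · rw [h.map_zero hS] at this
    by_cases hj : j = i
    · subst hj; simpa using this
    · simpa [Pi.single_apply, hj] using this
  · by_cases hk : k = i
    · subst hk; simpa using hB
    · simp [hk]
  · simp [Pi.single_apply]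

lemma map_sum (h : IsCoord S N B g κ) (hS : IsSymm S) {ι : Type*} (I : Finset ι) {f : ι → ℤ}
    {n : ι → ℕ} (hf : ∀ i ∈ I, f i ∈ iterSum S (n i)) (hn : ∑ i ∈ I, n i ≤ N) :
    κ (∑ i ∈ I, f i) = ∑ i ∈ I, κ (f i) := by
  classical
  induction I using Finset.induction_on with
  | empty => simpa using h.map_zero hS
  | insert a I ha ih =>
    rw [Finset.sum_insert ha] at hn ⊢
    rw [Finset.sum_insert ha, ← ih (fun i hi => hf i (Finset.mem_insert_of_mem hi)) (by omega)]
    have h1 := hf a (Finset.mem_insert_self a I)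
    have h2 := IsSymm.sum_mem_iterSum I fun i hi => hf i (Finset.mem_insert_of_mem hi)
    exact h.map_add (hS.iterSum_mono (by omega) h1) (hS.iterSum_mono (by omega) h2)
      (hS.iterSum_mono hn (add_mem_iterSum h1 h2))

lemma map_mul (h : IsCoord S N B g κ) (hS : IsSymm S) {x : ℤ} {n j : ℕ} (hx : x ∈ iterSum S n)
    (hn : j * n ≤ N) : κ (j * x) = (j : ℝ) • κ x := by
  have := h.map_sum hS (Finset.range j) (f := fun _ => x) (n := fun _ => n) (fun _ _ => hx)
    (by simpa using hn)
  simpa [Nat.cast_smul_eq_nsmul] using this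

lemma mem_span (h : IsCoord S N B g κ) (hS : IsSymm S) {n : ℕ} (hn : n ≤ N) {x : ℤ}
    (hx : x ∈ iterSum S n) : κ x ∈ Submodule.span ℝ (κ '' S) := by
  induction n generalizing x with
  | zero =>
    have : x = 0 := by simpa [iterSum] using hx
    rw [this, h.map_zero hS]
    exact zero_mem _
  | succ n ih =>
    obtain ⟨y, hy, z, hz, rfl⟩ := exists_add_of_mem_iterSum hx
    rw [h.map_add (hS.iterSum_mono (by omega) hy) (hS.iterSum_mono (by omega) hz)
      (hS.iterSum_mono hn hx)]
    refine add_mem (ih (by omega) hy) (Submodule.subset_span ⟨z, ?_, rfl⟩)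
    rwa [iterSum_one] at hz

lemma span_eq_top (h : IsCoord S N B g κ) (hS : IsSymm S) (hB : 1 ≤ B)
    (hg : ∀ i, g i ∈ iterSum S N) : Submodule.span ℝ (κ '' S) = ⊤ := by
  rw [eq_top_iff, ← (Pi.basisFun ℝ (Fin R)).span_eq, Submodule.span_le]
  rintro _ ⟨i, rfl⟩
  have := h.mem_span hS le_rfl (hg i)
  rw [h.map_single hS hB (hg i)] at this
  simpa using this

/-- The sumset contains translates of `S` by a large box. -/
lemma pow_mul_card_le (h : IsCoord S N B g κ) (hS : IsSymm S) (hB : 1 ≤ B)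
    (hg : ∀ i, g i ∈ iterSum S N) {m : ℕ} (hm : 1 ≤ m) (hN : (3 * R + 1) * m ≤ N) :
    m ^ R * #S ≤ #(iterSum S ((3 * R + 1) * m)) := by
  classical
  obtain ⟨v, hv, hli, hcoord⟩ := exists_basis_abs_coord_le_one (S.image κ)
    (by rw [Finset.coe_image]; exact h.span_eq_top hS hB hg)
  have hv' : ∀ i, ∃ s ∈ S, κ s = v i := fun i => by simpa using hv i
  choose s hs hsv using hv'
  have hs1 : ∀ i, s i ∈ iterSum S 1 := fun i => by rw [iterSum_one]; exact hs i
  have hmul : ∀ (j : Fin R → Fin m) i, (3 * (j i : ℕ)) * 1 ≤ 3 * m := fun j i => by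
    have := (j i).2; omega
  have hsum : ∀ j : Fin R → Fin m, ∑ i, 3 * (j i : ℕ) * 1 ≤ 3 * R * m - R := by
    intro j
    have : ∑ i, (3 * (j i : ℕ) * 1 + 1) ≤ ∑ _i : Fin R, 3 * m :=
      Finset.sum_le_sum fun i _ => by have := (j i).2; omega
    rw [Finset.sum_add_distrib] at this
    simp only [Finset.sum_const, Finset.card_univ, Fintype.card_fin, smul_eq_mul, mul_one] at this ⊢
    have e : R * (3 * m) = 3 * R * m := by ring
    omega
  have hboxmem : ∀ j : Fin R → Fin m,
      ∑ i, ((3 * (j i : ℕ) : ℕ) : ℤ) * s i ∈ iterSum S (∑ i, 3 * (j i : ℕ) * 1) := fun j =>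
    IsSymm.sum_mem_iterSum _ fun i _ => IsSymm.natCast_mul_mem_iterSum (hs1 i) _
  have hbox : ∀ j : Fin R → Fin m, κ (∑ i, ((3 * (j i : ℕ) : ℕ) : ℤ) * s i)
      = ∑ i, ((3 * (j i : ℕ) : ℕ) : ℝ) • v i := by
    intro j
    rw [h.map_sum hS _ (fun i _ => IsSymm.natCast_mul_mem_iterSum (hs1 i) _)
      ((hsum j).trans (by rw [add_mul] at hN; omega))]
    refine Finset.sum_congr rfl fun i _ => ?_
    rw [h.map_mul hS (hs1 i) ((hmul j i).trans ?_), hsv]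
    have hR : 1 ≤ R := by have := i.2; omega
    exact (Nat.mul_le_mul_right m (by omega : 3 ≤ 3 * R + 1)).trans hN
  have htot : ∀ x ∈ S, ∀ j : Fin R → Fin m, x + ∑ i, ((3 * (j i : ℕ) : ℕ) : ℤ) * s i ∈
      iterSum S ((3 * R + 1) * m) := by
    intro x hx j
    have hx1 : x ∈ iterSum S 1 := by rwa [iterSum_one]
    refine hS.iterSum_mono ?_ (add_mem_iterSum hx1 (hboxmem j))
    have := hsum j
    rw [add_mul]
    omega
  have hcard : #(S ×ˢ (Finset.univ : Finset (Fin R → Fin m))) = m ^ R * #S := by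
    simp [Finset.card_product, mul_comm]
  rw [← hcard]
  refine Finset.card_le_card_of_injOn
    (fun p => p.1 + ∑ i, ((3 * (p.2 i : ℕ) : ℕ) : ℤ) * s i) ?_ ?_
  · rintro ⟨x, j⟩ hp
    simp only [Finset.coe_product, Set.mem_prod, Finset.mem_coe] at hp
    exact htot x hp.1 j
  · rintro ⟨x, j⟩ hp ⟨x', j'⟩ hp' heq
    simp only [Finset.coe_product, Set.mem_prod, Finset.mem_coe] at hp hp'
    have hκ : ∀ x ∈ S, ∀ j : Fin R → Fin m, κ (x + ∑ i, ((3 * (j i : ℕ) : ℕ) : ℤ) * s i)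
        = κ x + ∑ i, ((3 * (j i : ℕ) : ℕ) : ℝ) • v i := by
      intro x hx j
      have hx1 : x ∈ iterSum S 1 := by rwa [iterSum_one]
      have hle := hsum j
      rw [add_mul] at hN
      rw [h.map_add (hS.iterSum_mono (by omega) hx1) (hS.iterSum_mono (by omega) (hboxmem j))
        (hS.iterSum_mono (by rwa [add_mul]) (htot x hx j)), hbox]
    have heq' : x + ∑ i, ((3 * (j i : ℕ) : ℕ) : ℤ) * s i
        = x' + ∑ i, ((3 * (j' i : ℕ) : ℕ) : ℤ) * s i := heq
    have hκeq := congrArg κ heq'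
    rw [hκ x hp.1, hκ x' hp'.1] at hκeq
    obtain ⟨a, ha, hxa⟩ := hcoord _ (Finset.mem_image_of_mem κ hp.1)
    obtain ⟨a', ha', hxa'⟩ := hcoord _ (Finset.mem_image_of_mem κ hp'.1)
    rw [hxa, hxa', ← Finset.sum_add_distrib, ← Finset.sum_add_distrib, ← sub_eq_zero,
      ← Finset.sum_sub_distrib] at hκeq
    have hzero := Fintype.linearIndependent_iff.1 hli
      (fun i => a i + ((3 * (j i : ℕ) : ℕ) : ℝ) - (a' i + ((3 * (j' i : ℕ) : ℕ) : ℝ))) (by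
        rw [← hκeq]
        exact Finset.sum_congr rfl fun i _ => by simp only [sub_smul, add_smul])
    have hj : j = j' := by
      ext i
      have h1 := hzero i
      have h2 := abs_le.1 (ha i)
      have h3 := abs_le.1 (ha' i)
      push_cast at h1
      have h4 : ((j i : ℕ) : ℝ) < (j' i : ℕ) + 1 := by linarith [h2.1, h2.2, h3.1, h3.2]
      have h5 : ((j' i : ℕ) : ℝ) < (j i : ℕ) + 1 := by linarith [h2.1, h2.2, h3.1, h3.2]
      have h6 : (j i : ℕ) < j' i + 1 := by exact_mod_cast h4
      have h7 : (j' i : ℕ) < j i + 1 := by exact_mod_cast h5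
      omega
    subst hj
    have hx := add_right_cancel heq'
    rw [hx]

/-- Pigeonholing the coordinates produces long homogeneous progressions in the sumset. -/
lemma exists_progression {m M Q : ℕ} (h : IsCoord S N B g κ) (hS : IsSymm S)
    (hg : Spans S m R M g) (hM : 1 ≤ M)
    (hκ : ∀ y ∈ iterSum S (M * m), ∀ i, |κ y i| ≤ 2 * (M : ℝ) ^ 2)
    (hQ : Q = M + R * ((6 * M ^ 2 + 1) * M)) (hN : (Q + 2) * m ≤ N) (hB : M * (Q + 2) ≤ B)
    {t : ℕ} (ht : 1 ≤ t) (htm : t ^ R < #(iterSum S m)) :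
    ∃ z : ℤ, z ≠ 0 ∧ ∀ j : ℕ, j ≤ t → (j : ℤ) * z ∈ iterSum S (Q * m) := by
  classical
  have ht0 : (0 : ℝ) < t := by exact_mod_cast ht
  have hden : (0 : ℝ) < 4 * (M : ℝ) ^ 2 + 1 := by positivity
  have hMm : m ≤ M * m := Nat.le_mul_of_pos_left m hM
  obtain ⟨y, hy, y', hy', hne, hcell⟩ := Finset.exists_ne_map_eq_of_card_lt_of_maps_to
    (s := iterSum S m) (t := Fintype.piFinset fun _ : Fin R => Finset.Ico (0 : ℤ) t)
    (by simpa using htm)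
    (f := fun y i => ⌊(κ y i + 2 * (M : ℝ) ^ 2) * t / (4 * (M : ℝ) ^ 2 + 1)⌋) (by
      intro y hy
      rw [Finset.mem_coe, Fintype.mem_piFinset]
      intro i
      have h1 := abs_le.1 (hκ y (hS.iterSum_mono hMm hy) i)
      rw [Finset.mem_Ico]
      refine ⟨Int.floor_nonneg.2 (div_nonneg (mul_nonneg (by linarith [h1.1]) ht0.le) hden.le),
        Int.floor_lt.2 ?_⟩
      rw [div_lt_iff₀ hden, Int.cast_natCast, mul_comm]
      exact mul_lt_mul_of_pos_left (by linarith [h1.2]) ht0)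
  have h2N : 2 * m ≤ N := (Nat.mul_le_mul_right m (by omega)).trans hN
  have hyy : y - y' ∈ iterSum S (2 * m) := by
    rw [two_mul]; exact hS.sub_mem_iterSum hy hy'
  have hκsub : κ (y - y') = κ y - κ y' := by
    have h1 := h.map_add (hS.iterSum_mono h2N hyy) (hS.iterSum_mono (by omega) hy')
      (by rw [sub_add_cancel]; exact hS.iterSum_mono (by omega) hy)
    rw [sub_add_cancel] at h1
    rw [h1, add_sub_cancel_right]
  have hsmall : ∀ i, |κ (y - y') i| * t ≤ 4 * (M : ℝ) ^ 2 + 1 := by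
    intro i
    have h1 := Int.abs_sub_lt_one_of_floor_eq_floor (congrFun hcell i)
    rw [← sub_div, abs_div, abs_of_pos hden, div_lt_one hden, ← sub_mul, abs_mul,
      abs_of_pos ht0, add_sub_add_right_eq_sub] at h1
    rw [hκsub]
    exact h1.le
  refine ⟨y - y', sub_ne_zero.2 hne, ?_⟩
  set z := y - y' with hz
  have hind : ∀ j : ℕ, j ≤ t →
      (j : ℤ) * z ∈ iterSum S (Q * m) ∧ κ ((j : ℤ) * z) = (j : ℝ) • κ z := by
    intro j
    induction j with
    | zero => exact fun _ => by simpa using ⟨hS.zero_mem_iterSum _, h.map_zero hS⟩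
    | succ j ih =>
      intro hj
      obtain ⟨ih1, ih2⟩ := ih (by omega)
      have hmem : ((j + 1 : ℕ) : ℤ) * z ∈ iterSum S ((Q + 2) * m) := by
        rw [add_mul]
        push_cast
        rw [add_mul, one_mul]
        exact add_mem_iterSum ih1 hyy
      have hmap : κ (((j + 1 : ℕ) : ℤ) * z) = ((j + 1 : ℕ) : ℝ) • κ z := by
        push_cast at hmem ⊢
        rw [add_mul (j : ℤ), one_mul] at hmem ⊢
        rw [h.map_add (hS.iterSum_mono ((Nat.mul_le_mul_right m (by omega)).trans hN) ih1)
          (hS.iterSum_mono h2N hyy) (hS.iterSum_mono hN hmem), ih2, add_smul, one_smul]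
      refine ⟨?_, hmap⟩
      obtain ⟨w, hw, b, hb, hwb⟩ := hg.2 _ _ hmem
      have hMQ : M ≤ Q := by omega
      have hrel := h.rel _ (hS.iterSum_mono hN hmem) 0 (hS.zero_mem_iterSum _) w
        (hS.iterSum_mono ((Nat.mul_le_mul_right m (by omega)).trans hN) hw) b
        (fun i => (hb i).trans (by exact_mod_cast hB)) (by rw [hwb]; ring)
      have hb' : ∀ i, |b i| ≤ ((6 * M ^ 2 + 1 : ℕ) : ℤ) := by
        intro i
        have h1 := hrel i
        rw [h.map_zero hS, hmap, Pi.smul_apply, Pi.zero_apply, add_zero, smul_eq_mul] at h1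
        have h2 := abs_le.1 (hκ w hw i)
        have h3 : |((j + 1 : ℕ) : ℝ) * κ z i| ≤ 4 * (M : ℝ) ^ 2 + 1 := by
          rw [abs_mul, Nat.abs_cast, mul_comm]
          refine le_trans (mul_le_mul_of_nonneg_left ?_ (abs_nonneg _)) (hsmall i)
          exact_mod_cast hj
        have h3' := abs_le.1 h3
        have h4 : |((b i : ℤ) : ℝ)| ≤ 6 * (M : ℝ) ^ 2 + 1 := by
          rw [abs_le]
          constructor <;> linarith [h3'.1, h3'.2, h2.1, h2.2]
        exact_mod_cast h4
      rw [hwb, show Q * m = M * m + R * ((6 * M ^ 2 + 1) * (M * m)) by rw [hQ]; ring]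
      exact add_mem_iterSum hw (hS.combination_mem_iterSum hb' hg.1)
  exact fun j hj => (hind j hj).1

end IsCoord

/-- The sumset `iterSum S m` behaves like a generalized progression of rank `R`. -/
def HasRank (S : Finset ℤ) (m Q R : ℕ) : Prop :=
  m ^ R * #S ≤ #(iterSum S (Q * m)) ∧ ∀ t : ℕ, 1 ≤ t → t ^ R < #(iterSum S m) →
    ∃ z : ℤ, z ≠ 0 ∧ ∀ j : ℕ, j ≤ t → (j : ℤ) * z ∈ iterSum S (Q * m)

lemma HasRank.mono {S : Finset ℤ} (hS : IsSymm S) {m Q Q' R : ℕ} (h : HasRank S m Q R)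
    (hQ : Q ≤ Q') : HasRank S m Q' R := by
  have hsub := hS.iterSum_mono (Nat.mul_le_mul_right m hQ)
  refine ⟨h.1.trans (Finset.card_le_card hsub), fun t ht htm => ?_⟩
  obtain ⟨z, hz, hj⟩ := h.2 t ht htm
  exact ⟨z, hz, fun j hjt => hsub (hj j hjt)⟩

lemma Spans.exists_hasRank (R M : ℕ) (hM : 1 ≤ M) :
    ∃ Q, ∀ (S : Finset ℤ) (m : ℕ), IsSymm S → 1 ≤ m → (∃ g : Fin R → ℤ, Spans S m R M g) →
      ∃ R', R' ≤ R ∧ HasRank S m Q R' := by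
  induction R generalizing M with
  | zero =>
    refine ⟨M + 1, fun S m hS hm ⟨g, hg⟩ => ⟨0, le_rfl, ?_, fun t ht htm => ?_⟩⟩
    · rw [pow_zero, one_mul]
      conv_lhs => rw [← iterSum_one S]
      exact Finset.card_le_card (hS.iterSum_mono (Nat.mul_pos (Nat.succ_pos M) hm))
    · obtain ⟨z, hz, hz0⟩ := Finset.exists_mem_ne (by simpa using htm) (0 : ℤ)
      refine ⟨z, hz0, fun j hj => ?_⟩
      have h1 := IsSymm.natCast_mul_mem_iterSum hz j
      obtain ⟨y, hy, b, hb, he⟩ := hg.2 _ _ h1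
      rw [he]
      simpa using hS.iterSum_mono (Nat.mul_le_mul_right m (Nat.le_succ M)) hy
  | succ R ih =>
    obtain ⟨Q₀, hQ₀⟩ : ∃ Q₀, Q₀ = M + (R + 1) * ((6 * M ^ 2 + 1) * M) := ⟨_, rfl⟩
    obtain ⟨P, hP⟩ : ∃ P, P = Q₀ + 2 + (3 * (R + 1) + 1) := ⟨_, rfl⟩
    obtain ⟨B, hB⟩ : ∃ B, B = M * (Q₀ + 2) := ⟨_, rfl⟩
    obtain ⟨M', hM'⟩ : ∃ M', M' = 2 * B + 6 * M * P + 30 * M ^ 2 := ⟨_, rfl⟩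
    obtain ⟨Q₁, hQ₁⟩ := ih (8 * (4 * M + M' * M + M')) (by nlinarith)
    refine ⟨Q₁ + P, fun S m hS hm ⟨g, hg⟩ => ?_⟩
    by_cases hI : ∀ c : Fin (R + 1) → ℤ, (∀ i, |c i| ≤ M') →
        ∑ i, c i * g i ∈ iterSum S (3 * M * m) → ∀ i, |c i| ≤ 12 * (M : ℤ) ^ 2
    · obtain ⟨κ, hκ, hrel⟩ := hg.exists_coord hS (P := P) (by omega) hM'.ge hI
      have hc : IsCoord S (P * m) B g κ := ⟨hrel⟩
      refine ⟨R + 1, le_rfl, ?_, fun t ht htm => ?_⟩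
      · have h1 := hc.pow_mul_card_le hS (by rw [hB]; exact Nat.mul_pos hM (by omega))
          (fun i => hS.iterSum_mono (Nat.mul_le_mul_right m (by omega)) (hg.1 i)) hm
          (Nat.mul_le_mul_right m (by omega))
        exact h1.trans (Finset.card_le_card (hS.iterSum_mono (Nat.mul_le_mul_right m (by omega))))
      · obtain ⟨z, hz, hj⟩ := hc.exists_progression hS hg hM hκ hQ₀
          (Nat.mul_le_mul_right m (by omega)) hB.ge ht htm
        exact ⟨z, hz, fun j hjt => hS.iterSum_mono (Nat.mul_le_mul_right m (by omega)) (hj j hjt)⟩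
    · push Not at hI
      obtain ⟨c, hc, hcrel, i₀, hi₀⟩ := hI
      obtain ⟨g', hg'⟩ := hg.reduce hS hM hc hcrel hi₀
      obtain ⟨R', hR', hr⟩ := hQ₁ S m hS hm ⟨g', hg'⟩
      exact ⟨R', by omega, hr.mono hS (by omega)⟩

lemma Spans.card_le {S : Finset ℤ} {m R M : ℕ} {g : Fin R → ℤ} (hg : Spans S m R M g) (n : ℕ) :
    #(iterSum S (n * m)) ≤ (2 * (M * n) + 1) ^ R * #(iterSum S (M * m)) := by
  classical
  have hsub : iterSum S (n * m) ⊆ ((Fintype.piFinset fun _ : Fin R =>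
      Finset.Icc (-((M * n : ℕ) : ℤ)) ((M * n : ℕ) : ℤ)) ×ˢ iterSum S (M * m)).image
        (fun p => p.2 + ∑ i, p.1 i * g i) := by
    intro w hw
    obtain ⟨y, hy, b, hb, he⟩ := hg.2 n w hw
    rw [Finset.mem_image]
    refine ⟨(b, y), ?_, he.symm⟩
    rw [Finset.mem_product, Fintype.mem_piFinset]
    refine ⟨fun i => ?_, hy⟩
    rw [Finset.mem_Icc, ← abs_le]
    exact_mod_cast hb i
  refine (Finset.card_le_card hsub).trans (Finset.card_image_le.trans (le_of_eq ?_))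
  rw [Finset.card_product, Fintype.card_piFinset]
  simp only [Int.card_Icc, Finset.prod_const, Finset.card_univ, Fintype.card_fin]
  congr 2
  omega

/-- A symmetric set of small growth at scale `m` has a rank. -/
lemma exists_hasRank_of_card_le (K : ℕ) :
    ∃ Q C, 1 ≤ Q ∧ 1 ≤ C ∧ ∀ (S : Finset ℤ) (m : ℕ), IsSymm S → 1 ≤ m →
      #(iterSum S (4 * m)) ≤ K * #(iterSum S m) →
      ∃ R, HasRank S m Q R ∧ m ^ R * #S ≤ C * #(iterSum S m) := by
  choose q hq using fun R => Spans.exists_hasRank R 3 (by norm_num)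
  obtain ⟨Q, hQ⟩ : ∃ Q, Q = ∑ R ∈ Finset.range (K + 1), q R + 1 := ⟨_, rfl⟩
  refine ⟨Q, (6 * Q + 1) ^ K * K + 1, by omega, by omega, fun S m hS hm hK => ?_⟩
  obtain ⟨R, hRK, g, hg⟩ := exists_spans_of_card_le hS hK
  obtain ⟨R', hR', hr⟩ := hq R S m hS hm ⟨g, hg⟩
  have hqQ : q R ≤ Q := by
    have := Finset.single_le_sum (f := q) (s := Finset.range (K + 1)) (fun _ _ => Nat.zero_le _)
      (Finset.mem_range.2 (Nat.lt_succ_of_le hRK))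
    omega
  have hr' := hr.mono hS hqQ
  refine ⟨R', hr', hr'.1.trans ((hg.card_le Q).trans ?_)⟩
  have h1 : #(iterSum S (3 * m)) ≤ K * #(iterSum S m) :=
    (Finset.card_le_card (hS.iterSum_mono (by omega))).trans hK
  have h2 : (2 * (3 * Q) + 1) ^ R ≤ (6 * Q + 1) ^ K := by
    rw [show 2 * (3 * Q) + 1 = 6 * Q + 1 by ring]
    exact Nat.pow_le_pow_right (by omega) hRK
  calc _ ≤ (6 * Q + 1) ^ K * (K * #(iterSum S m)) := Nat.mul_le_mul h2 h1
    _ ≤ _ := by rw [← mul_assoc]; exact Nat.mul_le_mul_right _ (Nat.le_succ _)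

lemma exists_slow_growth {f : ℕ → ℕ} (hf : Monotone f) (K n : ℕ) :
    (∃ i < n, f (i + 1) ≤ K * f i ∧ K ^ (n - 1 - i) * f i ≤ f n) ∨ K ^ n * f 0 ≤ f n := by
  induction n with
  | zero => right; simp
  | succ n ih =>
    by_cases h : f (n + 1) ≤ K * f n
    · exact Or.inl ⟨n, n.lt_succ_self, h, by simpa using hf n.le_succ⟩
    · push Not at h
      rcases ih with ⟨i, hi, h1, h2⟩ | h2
      · refine Or.inl ⟨i, hi.trans n.lt_succ_self, h1, ?_⟩
        rw [show n + 1 - 1 - i = n - 1 - i + 1 by omega, pow_succ', mul_assoc]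
        exact (Nat.mul_le_mul_left K h2).trans h.le
      · right
        rw [pow_succ', mul_assoc]
        exact (Nat.mul_le_mul_left K h2).trans h.le

lemma IsSymm.mul_mem_iterSum_of_forall_le {S : Finset ℤ} (hS : IsSymm S) {n t : ℕ} {z : ℤ}
    (h : ∀ j : ℕ, j ≤ t → (j : ℤ) * z ∈ iterSum S n) (N : ℕ) :
    ∀ j : ℕ, j ≤ N * t → (j : ℤ) * z ∈ iterSum S (N * n) := by
  induction N with
  | zero =>
    intro j hj
    have : j = 0 := by simpa using hj
    subst this
    simpa using hS.zero_mem_iterSum 0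
  | succ N ih =>
    intro j hj
    by_cases hjt : j ≤ N * t
    · exact hS.iterSum_mono (Nat.mul_le_mul_right n N.le_succ) (ih j hjt)
    · rw [show (j : ℤ) * z = ((N * t : ℕ) : ℤ) * z + ((j - N * t : ℕ) : ℤ) * z by
        rw [← add_mul, ← Nat.cast_add, Nat.add_sub_cancel' (by omega)], add_mul, one_mul]
      refine add_mem_iterSum (ih _ le_rfl) (h _ ?_)
      rw [add_mul] at hj
      omega

/-- Long homogeneous progressions in iterated sumsets of a dense symmetric set. -/
theorem exists_progression_iterSum {d : ℕ} (hd : 0 < d) :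
    ∃ c₁ c₂ : ℝ, 0 < c₁ ∧ 0 < c₂ ∧ ∀ (S : Finset ℤ) (u ℓ : ℕ), IsSymm S → 2 ≤ #S →
      (∀ x ∈ S, |x| ≤ u) → c₁ * u ≤ (ℓ : ℝ) ^ d * #S →
      ∃ (L : ℕ) (z : ℤ), c₂ * ℓ * (#S : ℝ) ^ ((1 : ℝ) / d) ≤ L ∧ z ≠ 0 ∧
        ∀ j : ℕ, j ≤ L → (j : ℤ) * z ∈ iterSum S ℓ := by
  obtain ⟨Q, C, hQ, hC, H⟩ := exists_hasRank_of_card_le (4 ^ (d + 2))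
  refine ⟨((12 * C * (4 * Q) ^ d + 1 : ℕ) : ℝ), 1 / (8 * Q * C), by positivity, by positivity,
    fun S u ℓ hS hcard hu hdens => ?_⟩
  have hdens' : (12 * C * (4 * Q) ^ d + 1) * u ≤ ℓ ^ d * #S := by exact_mod_cast hdens
  have hu1 : 1 ≤ u := by
    obtain ⟨x, hx, hx0⟩ := Finset.exists_mem_ne (by omega : 1 < #S) (0 : ℤ)
    have h1 := hu x hx
    have h2 := abs_pos.2 hx0
    omega
  have hSu : #S ≤ 3 * u := by
    have := card_iterSum_le hu 1
    rw [iterSum_one] at this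
    omega
  have hQℓ : Q ≤ ℓ := by
    by_contra! hlt
    have h1 : ℓ ^ d ≤ (4 * Q) ^ d := Nat.pow_le_pow_left (by omega) d
    have h2 : ℓ ^ d * #S ≤ (4 * Q) ^ d * (3 * u) := Nat.mul_le_mul h1 hSu
    have h3 : (4 * Q) ^ d * u ≤ C * ((4 * Q) ^ d * u) := Nat.le_mul_of_pos_left _ hC
    have h4 : (12 * C * (4 * Q) ^ d + 1) * u = 12 * (C * ((4 * Q) ^ d * u)) + u := by ring
    have h5 : (4 * Q) ^ d * (3 * u) = 3 * ((4 * Q) ^ d * u) := by ring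
    omega
  obtain ⟨e, he⟩ : ∃ e, e = Nat.log 4 (ℓ / Q) := ⟨_, rfl⟩
  have he1 : Q * 4 ^ e ≤ ℓ := by
    have := Nat.pow_log_le_self 4 (Nat.div_pos hQℓ hQ).ne'
    rw [← he] at this
    exact (Nat.mul_le_mul_left Q this).trans (Nat.mul_div_le ℓ Q)
  have he2 : ℓ ≤ 4 * Q * 4 ^ e := by
    have := Nat.lt_pow_succ_log_self (by norm_num : 1 < 4) (ℓ / Q)
    rw [← he, Nat.div_lt_iff_lt_mul hQ] at this
    rw [Nat.succ_eq_add_one, pow_succ] at this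
    linarith
  have hmono : Monotone fun i : ℕ => #(iterSum S (4 ^ i)) := fun i j hij =>
    Finset.card_le_card (hS.iterSum_mono (Nat.pow_le_pow_right (by norm_num) hij))
  have hupper : (12 * C * (4 * Q) ^ d + 1) * #(iterSum S (4 ^ (e + 1)))
      ≤ 12 * (4 * Q) ^ d * ((4 ^ e) ^ (d + 1) * #S) := by
    have h1 := card_iterSum_le hu (4 ^ (e + 1))
    have h0 : 1 ≤ 4 ^ (e + 1) * u := Nat.mul_pos (by positivity) hu1
    have h2 : #(iterSum S (4 ^ (e + 1))) ≤ 3 * (4 ^ (e + 1) * u) := by omega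
    calc _ ≤ (12 * C * (4 * Q) ^ d + 1) * (3 * (4 ^ (e + 1) * u)) := Nat.mul_le_mul_left _ h2
      _ = 12 * 4 ^ e * ((12 * C * (4 * Q) ^ d + 1) * u) := by ring
      _ ≤ 12 * 4 ^ e * (ℓ ^ d * #S) := Nat.mul_le_mul_left _ hdens'
      _ ≤ 12 * 4 ^ e * ((4 * Q * 4 ^ e) ^ d * #S) :=
        Nat.mul_le_mul_left _ (Nat.mul_le_mul_right _ (Nat.pow_le_pow_left he2 d))
      _ = _ := by rw [mul_pow]; ring
  have hcontra : ¬ (4 ^ e) ^ (d + 1) * #S ≤ C * #(iterSum S (4 ^ (e + 1))) := by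
    intro h
    have h1 : 12 * (4 * Q) ^ d * ((4 ^ e) ^ (d + 1) * #S)
        ≤ 12 * (4 * Q) ^ d * (C * #(iterSum S (4 ^ (e + 1)))) := Nat.mul_le_mul_left _ h
    have h2 : 0 < #(iterSum S (4 ^ (e + 1))) :=
      Finset.card_pos.2 ⟨0, hS.zero_mem_iterSum _⟩
    nlinarith
  have hKpow : ∀ j, (4 ^ j) ^ (d + 1) ≤ (4 ^ (d + 2)) ^ j := fun j => by
    rw [← pow_mul, ← pow_mul]
    exact Nat.pow_le_pow_right (by norm_num) (by nlinarith)
  rcases exists_slow_growth hmono (4 ^ (d + 2)) (e + 1) with ⟨i, hi, hslow, hgrow⟩ | hgrow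
  swap
  · exfalso
    apply hcontra
    have h0 : #(iterSum S (4 ^ 0)) = #S := by rw [pow_zero, iterSum_one]
    rw [h0] at hgrow
    have h1 : (4 ^ e) ^ (d + 1) ≤ (4 ^ (d + 2)) ^ (e + 1) :=
      (hKpow e).trans (Nat.pow_le_pow_right (by positivity) e.le_succ)
    exact ((Nat.mul_le_mul_right _ h1).trans hgrow).trans (Nat.le_mul_of_pos_left _ hC)
  rw [pow_succ, mul_comm (4 ^ i) 4] at hslow
  obtain ⟨R, hR, hRC⟩ := H S (4 ^ i) hS (Nat.one_le_pow i 4 (by norm_num)) hslow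
  have hRd : R ≤ d := by
    by_contra! hlt
    apply hcontra
    have h1 : (4 ^ i) ^ (d + 1) * #S ≤ C * #(iterSum S (4 ^ i)) :=
      (Nat.mul_le_mul_right _ (Nat.pow_le_pow_right (by positivity) hlt)).trans hRC
    have h2 : (4 ^ (e - i)) ^ (d + 1) ≤ (4 ^ (d + 2)) ^ (e + 1 - 1 - i) := by
      rw [Nat.add_sub_cancel]; exact hKpow _
    calc (4 ^ e) ^ (d + 1) * #S = (4 ^ (e - i)) ^ (d + 1) * ((4 ^ i) ^ (d + 1) * #S) := by
          rw [← mul_assoc, ← mul_pow, ← pow_add, Nat.sub_add_cancel (by omega)]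
      _ ≤ (4 ^ (d + 2)) ^ (e + 1 - 1 - i) * (C * #(iterSum S (4 ^ i))) := Nat.mul_le_mul h2 h1
      _ = C * ((4 ^ (d + 2)) ^ (e + 1 - 1 - i) * #(iterSum S (4 ^ i))) := by ring
      _ ≤ _ := Nat.mul_le_mul_left C hgrow
  obtain ⟨k, hk⟩ : ∃ k : ℝ, k = (#S : ℝ) ^ ((1 : ℝ) / d) := ⟨_, rfl⟩
  have hS1 : (1 : ℝ) ≤ #S := by exact_mod_cast (by omega : 1 ≤ #S)
  have hk1 : 1 ≤ k := hk ▸ Real.one_le_rpow hS1 (by positivity)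
  have hkd : k ^ d = #S := by
    rw [hk, one_div, Real.rpow_inv_natCast_pow (by positivity) hd.ne']
  have hC' : (1 : ℝ) ≤ C := by exact_mod_cast hC
  have hQ' : (1 : ℝ) ≤ Q := by exact_mod_cast hQ
  obtain ⟨x, hx⟩ : ∃ x : ℝ, x = (4 ^ i : ℕ) * k / (2 * C) := ⟨_, rfl⟩
  have hx0 : 0 ≤ x := by rw [hx]; positivity
  obtain ⟨t, ht1, htx, htm⟩ : ∃ t : ℕ, 1 ≤ t ∧ x / 2 ≤ t ∧ t ^ R < #(iterSum S (4 ^ i)) := by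
    have hbig : 1 < #(iterSum S (4 ^ i)) := by
      have h := Finset.card_le_card (hS.iterSum_mono (Nat.one_le_pow i 4 (by norm_num)))
      rw [iterSum_one] at h
      omega
    rcases lt_or_ge x 1 with hx1 | hx1
    · exact ⟨1, le_rfl, by push_cast; linarith, by simpa using hbig⟩
    · refine ⟨⌊x⌋₊, Nat.one_le_floor_iff x |>.2 hx1, ?_, ?_⟩
      · have h1 := Nat.lt_floor_add_one x
        have h2 : (1 : ℝ) ≤ ⌊x⌋₊ := by exact_mod_cast Nat.one_le_floor_iff x |>.2 hx1
        linarith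
      · rcases Nat.eq_zero_or_pos R with rfl | hR0
        · simpa using hbig
        · have h1 : ((⌊x⌋₊ : ℕ) : ℝ) ^ R ≤ x ^ R :=
            pow_le_pow_left₀ (by positivity) (Nat.floor_le hx0) R
          have h2 : x ^ R * (2 * C) ≤ C * #(iterSum S (4 ^ i)) := by
            have h3 : (((4 ^ i) ^ R * #S : ℕ) : ℝ) ≤ (C * #(iterSum S (4 ^ i)) : ℕ) := by
              exact_mod_cast hRC
            push_cast at h3
            refine le_trans ?_ h3
            rw [hx, div_pow, mul_pow, div_mul_eq_mul_div, div_le_iff₀ (by positivity)]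
            have h4 : k ^ R ≤ #S := hkd ▸ pow_le_pow_right₀ hk1 hRd
            have h5 : 2 * (C : ℝ) ≤ (2 * C) ^ R := le_self_pow₀ (by linarith) hR0.ne'
            push_cast
            gcongr
          have h6 : 0 < (#(iterSum S (4 ^ i)) : ℝ) := by
            exact_mod_cast (by omega : 0 < #(iterSum S (4 ^ i)))
          have h7 : ((⌊x⌋₊ : ℕ) : ℝ) ^ R < #(iterSum S (4 ^ i)) := by
            have h8 : x ^ R * 2 ≤ #(iterSum S (4 ^ i)) := by
              have : C * (x ^ R * 2) ≤ C * (#(iterSum S (4 ^ i)) : ℝ) := by linarith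
              exact le_of_mul_le_mul_left this (by linarith)
            linarith
          exact_mod_cast h7
  obtain ⟨z, hz, hj⟩ := hR.2 t ht1 htm
  obtain ⟨N, hN⟩ : ∃ N, N = ℓ / (Q * 4 ^ i) := ⟨_, rfl⟩
  have hQm : 0 < Q * 4 ^ i := Nat.mul_pos hQ (by positivity)
  have hQmℓ : Q * 4 ^ i ≤ ℓ :=
    (Nat.mul_le_mul_left Q (Nat.pow_le_pow_right (by norm_num) (by omega))).trans he1
  have hN1 : 1 ≤ N := hN ▸ Nat.div_pos hQmℓ hQm
  have hNℓ : N * (Q * 4 ^ i) ≤ ℓ := hN ▸ Nat.div_mul_le_self _ _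
  have hN2 : ℓ ≤ 2 * N * (Q * 4 ^ i) := by
    have h1 := Nat.lt_div_mul_add (a := ℓ) hQm
    rw [← hN] at h1
    have h2 : Q * 4 ^ i ≤ N * (Q * 4 ^ i) := Nat.le_mul_of_pos_left _ hN1
    linarith
  refine ⟨N * t, z, ?_, hz, fun j hjN => hS.iterSum_mono hNℓ
    (hS.mul_mem_iterSum_of_forall_le hj N j hjN)⟩
  rw [← hk]
  have hN2' : (ℓ : ℝ) ≤ 2 * N * (Q * (4 ^ i : ℕ)) := by exact_mod_cast hN2
  calc 1 / (8 * Q * C) * ℓ * k ≤ 1 / (8 * Q * C) * (2 * N * (Q * (4 ^ i : ℕ))) * k := by gcongr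
    _ = N * (x / 2) := by rw [hx]; field_simp; norm_num
    _ ≤ ((N * t : ℕ) : ℝ) := by push_cast; gcongr

/-- The set of all sums of one element from each `X i`. -/
def familySum {ι : Type*} [Fintype ι] (X : ι → Finset ℤ) : Set ℤ :=
  {x | ∃ f : ι → ℤ, (∀ i, f i ∈ X i) ∧ ∑ i, f i = x}

lemma _root_.HasAPLen.of_add {T T' : Set ℤ} {L : ℕ} (h : HasAPLen T L) (τ : ℤ)
    (hT : ∀ x ∈ T, x + τ ∈ T') : HasAPLen T' L := by
  obtain ⟨a, Δ, hΔ, ha⟩ := h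
  exact ⟨a + τ, Δ, hΔ, fun j hj => by simpa [add_right_comm] using hT _ (ha j hj)⟩

lemma exists_add_mem_familySum {ι κ : Type*} [Fintype ι] [Fintype κ] {X : ι → Finset ℤ}
    (hX : ∀ i, (X i).Nonempty) {e : κ → ι} (he : Function.Injective e) :
    ∃ τ, ∀ x ∈ familySum (X ∘ e), x + τ ∈ familySum X := by
  classical
  choose w hw using hX
  refine ⟨∑ i ∈ (Finset.univ.image e)ᶜ, w i, ?_⟩
  rintro _ ⟨f, hf, rfl⟩
  refine ⟨Function.extend e f w, fun i => ?_, ?_⟩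
  · by_cases hi : ∃ k, e k = i
    · obtain ⟨k, rfl⟩ := hi
      rw [he.extend_apply]
      exact hf k
    · rw [Function.extend_apply' _ _ _ hi]
      exact hw i
  · rw [← Finset.sum_add_sum_compl (Finset.univ.image e),
      Finset.sum_image fun _ _ _ _ h => he h]
    congr 1
    · exact Finset.sum_congr rfl fun k _ => he.extend_apply _ _ _
    · refine Finset.sum_congr rfl fun i hi => Function.extend_apply' _ _ _ ?_
      simpa using hi

lemma exists_add_mem_familySum_of_pairs {ι : Type*} [Fintype ι] {X : ι → Finset ℤ}
    (hX : ∀ i, (X i).Nonempty) {p : ℕ} {a b : Fin p → ι}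
    (hab : Function.Injective (Sum.elim a b)) :
    ∃ τ, ∀ x ∈ familySum (fun q => X (a q) + X (b q)), x + τ ∈ familySum X := by
  obtain ⟨τ, hτ⟩ := exists_add_mem_familySum hX hab
  refine ⟨τ, ?_⟩
  rintro _ ⟨f, hf, rfl⟩
  choose y hy z hz hyz using fun q => Finset.mem_add.1 (hf q)
  refine hτ _ ⟨Sum.elim y z, ?_, ?_⟩
  · rintro (q | q)
    · exact hy q
    · exact hz q
  · rw [Fintype.sum_sum_type, ← Finset.sum_add_distrib]
    exact Finset.sum_congr rfl fun q _ => hyz q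

lemma exists_popular_sum {A B : Finset ℤ} (hA : A.Nonempty) (hB : B.Nonempty) :
    ∃ c, #A * #B ≤ #(A + B) * #{w ∈ A | c - w ∈ B} := by
  obtain ⟨c, hc, hmax⟩ := Finset.exists_max_image (A + B) (fun c => #{w ∈ A | c - w ∈ B})
    (hA.add hB)
  refine ⟨c, ?_⟩
  rw [← Finset.card_product, ← smul_eq_mul]
  rw [Finset.card_eq_sum_card_fiberwise (f := fun p : ℤ × ℤ => p.1 + p.2) (t := A + B)]
  · refine Finset.sum_le_card_nsmul _ _ _ fun c' hc' => le_trans ?_ (hmax c' hc')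
    refine Finset.card_le_card_of_injOn Prod.fst ?_ ?_
    · rintro ⟨x, y⟩ h
      simp only [Finset.coe_filter, Finset.mem_product, Set.mem_ofPred_eq] at h
      simp only [Finset.coe_filter, Set.mem_ofPred_eq]
      exact ⟨h.1.1, by rw [← h.2, add_sub_cancel_left]; exact h.1.2⟩
    · rintro ⟨x, y⟩ h ⟨x', y'⟩ h' heq
      simp only [Finset.coe_filter, Set.mem_ofPred_eq] at h h'
      have heq' : x = x' := heq
      have h1 := h.2
      have h2 := h'.2
      ext
      · exact heq'
      · change y = y'
        omega
  · rintro ⟨x, y⟩ h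
    simp only [Finset.coe_product, Set.mem_prod, Finset.mem_coe] at h
    exact Finset.add_mem_add h.1 h.2

/-- Elements lying in many of the sets `U q` may be summed from distinct sets. -/
lemma mem_familySum_of_mem_iterSum {p θ : ℕ} {U : Fin p → Finset ℤ} (hU : ∀ q, 0 ∈ U q)
    {S : Finset ℤ} (hS : ∀ z ∈ S, θ ≤ #{q | z ∈ U q}) {x : ℤ} (hx : x ∈ iterSum S θ) :
    x ∈ familySum U := by
  classical
  have key : ∀ n ≤ θ, ∀ x ∈ iterSum S n, ∃ I : Finset (Fin p), #I ≤ n ∧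
      ∃ f : Fin p → ℤ, (∀ q, f q ∈ U q) ∧ (∀ q ∉ I, f q = 0) ∧ ∑ q, f q = x := by
    intro n
    induction n with
    | zero =>
      intro _ x hx
      have : x = 0 := by simpa [iterSum] using hx
      exact ⟨∅, le_rfl, 0, hU, fun _ _ => rfl, by simp [this]⟩
    | succ n ih =>
      intro hn x hx
      obtain ⟨y, hy, z, hz, rfl⟩ := exists_add_of_mem_iterSum hx
      rw [iterSum_one] at hz
      obtain ⟨I, hI, f, hf, hf0, hsum⟩ := ih (by omega) y hy
      obtain ⟨q, hq, hqI⟩ := Finset.exists_mem_notMem_of_card_lt_card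
        (lt_of_le_of_lt hI (lt_of_lt_of_le hn (hS z hz)))
      rw [Finset.mem_filter] at hq
      refine ⟨insert q I, (Finset.card_insert_le q I).trans (by omega), Function.update f q z,
        fun r => ?_, fun r hr => ?_, ?_⟩
      · by_cases h : r = q
        · subst h; simpa using hq.2
        · simpa [Function.update_of_ne h] using hf r
      · rw [Finset.mem_insert, not_or] at hr
        rw [Function.update_of_ne hr.1, hf0 r hr.2]
      · rw [Finset.sum_update_of_mem (Finset.mem_univ q), ← hsum,
          ← Finset.sum_sdiff (Finset.singleton_subset_iff.2 (Finset.mem_univ q)),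
          Finset.sum_singleton, hf0 q hqI]
        ring
  obtain ⟨I, -, f, hf, -, hsum⟩ := key θ le_rfl x hx
  exact ⟨f, hf, hsum⟩

/-- Popular differences: a family of translates into the sums `X + Y` which all live in a common
difference set. -/
lemma exists_sub_subset {A X Y : Finset ℤ} {K s : ℕ} (hs : 0 < s) (hA : s ≤ #A) (hX : s ≤ #X)
    (hY : s ≤ #Y) (hXY : #(X + Y) ≤ K * s) (hXA : #(X + A) ≤ K * s) :
    ∃ (U : Finset ℤ) (c : ℤ), IsSymm U ∧ s ≤ K ^ 2 * #U ∧ U ⊆ A - A ∧ ∀ z ∈ U, z + c ∈ X + Y := by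
  have hne : ∀ {B : Finset ℤ}, s ≤ #B → B.Nonempty := fun h => Finset.card_pos.1 (by omega)
  obtain ⟨c, hc⟩ := exists_popular_sum (hne hX) (hne hY)
  set W := {w ∈ X | c - w ∈ Y} with hW
  have hW1 : s ≤ K * #W := by
    refine Nat.le_of_mul_le_mul_left ?_ hs
    calc s * s ≤ #X * #Y := Nat.mul_le_mul hX hY
      _ ≤ K * s * #W := hc.trans (Nat.mul_le_mul_right _ hXY)
      _ = s * (K * #W) := by ring
  have hWne : W.Nonempty := by
    rw [← Finset.card_pos]
    by_contra! h0
    rw [Nat.le_zero.1 h0, mul_zero] at hW1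
    omega
  obtain ⟨t, ht⟩ := exists_popular_sum hWne (hne hA)
  set W' := {w ∈ W | t - w ∈ A} with hW'
  have hW2 : s ≤ K ^ 2 * #W' := by
    refine Nat.le_of_mul_le_mul_left ?_ hs
    have h1 : #(W + A) ≤ K * s :=
      (Finset.card_le_card (Finset.add_subset_add_right (Finset.filter_subset _ _))).trans hXA
    calc s * s ≤ K * #W * #A := Nat.mul_le_mul hW1 hA
      _ = K * (#W * #A) := by ring
      _ ≤ K * (K * s * #W') := Nat.mul_le_mul_left _ (ht.trans (Nat.mul_le_mul_right _ h1))
      _ = s * (K ^ 2 * #W') := by ring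
  have hWne' : W'.Nonempty := by
    rw [← Finset.card_pos]
    by_contra! h0
    rw [Nat.le_zero.1 h0, mul_zero] at hW2
    omega
  refine ⟨W' - W', c, ⟨?_, ?_⟩, ?_, ?_, ?_⟩
  · obtain ⟨w, hw⟩ := hWne'
    exact Finset.mem_sub.2 ⟨w, hw, w, hw, sub_self w⟩
  · intro x hx
    obtain ⟨w, hw, w', hw', rfl⟩ := Finset.mem_sub.1 hx
    exact Finset.mem_sub.2 ⟨w', hw', w, hw, by ring⟩
  · refine hW2.trans (Nat.mul_le_mul_left _ ?_)
    obtain ⟨w, hw⟩ := hWne'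
    refine Finset.card_le_card_of_injOn (fun x => x - w) (fun x hx => ?_) (fun x _ y _ h => ?_)
    · exact Finset.mem_coe.2 (Finset.sub_mem_sub hx hw)
    · exact sub_left_injective h
  · intro x hx
    obtain ⟨w, hw, w', hw', rfl⟩ := Finset.mem_sub.1 hx
    exact Finset.mem_sub.2 ⟨t - w', (Finset.mem_filter.1 hw').2, t - w,
      (Finset.mem_filter.1 hw).2, by ring⟩
  · intro x hx
    obtain ⟨w, hw, w', hw', rfl⟩ := Finset.mem_sub.1 hx
    have h1 := Finset.mem_filter.1 (Finset.mem_filter.1 hw).1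
    have h2 := Finset.mem_filter.1 (Finset.mem_filter.1 hw').1
    exact Finset.mem_add.2 ⟨w, h1.1, c - w', h2.2, by ring⟩

lemma card_popular_ge {D : Finset ℤ} {p θ K s : ℕ} {U : Fin p → Finset ℤ} (hp : 0 < p)
    (hUD : ∀ q, U q ⊆ D) (hU : ∀ q, s ≤ K ^ 2 * #(U q)) (hD : #D ≤ K ^ 2 * s)
    (hθ : 2 * K ^ 4 * θ ≤ p) :
    s ≤ 2 * K ^ 2 * #{z ∈ D | θ ≤ #{q | z ∈ U q}} := by
  classical
  set S := {z ∈ D | θ ≤ #{q | z ∈ U q}} with hS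
  have hcount : ∑ q, #(U q) = ∑ z ∈ D, #{q | z ∈ U q} := by
    have h := Finset.sum_card_bipartiteAbove_eq_sum_card_bipartiteBelow
      (s := D) (t := (Finset.univ : Finset (Fin p))) (fun z q => z ∈ U q)
    rw [Finset.sum_congr rfl fun z _ => rfl] at h
    refine Eq.trans (Finset.sum_congr rfl fun q _ => ?_) h.symm
    congr 1
    ext z
    simp only [Finset.mem_bipartiteBelow]
    exact ⟨fun hz => ⟨hUD q hz, hz⟩, fun hz => hz.2⟩
  have hle : ∑ z ∈ D, #{q | z ∈ U q} ≤ #S * p + #D * θ := by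
    rw [← Finset.sum_filter_add_sum_filter_not D (fun z => θ ≤ #{q | z ∈ U q})]
    refine add_le_add ?_ ?_
    · rw [← smul_eq_mul]
      refine Finset.sum_le_card_nsmul _ _ _ fun z _ => ?_
      exact (Finset.card_le_univ _).trans (Fintype.card_fin p).le
    · refine (Finset.sum_le_card_nsmul _ _ θ fun z hz => ?_).trans ?_
      · exact (not_le.1 (Finset.mem_filter.1 hz).2).le
      · exact Nat.mul_le_mul_right θ (Finset.card_le_card (Finset.filter_subset _ _))
  have hsum : p * s ≤ K ^ 2 * ∑ q, #(U q) := by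
    rw [Finset.mul_sum]
    simpa using Finset.card_nsmul_le_sum Finset.univ (fun q => K ^ 2 * #(U q)) s fun q _ => hU q
  rw [hcount] at hsum
  have h1 : K ^ 2 * (#D * θ) ≤ K ^ 4 * θ * s := by
    calc K ^ 2 * (#D * θ) ≤ K ^ 2 * (K ^ 2 * s * θ) := by gcongr
      _ = K ^ 4 * θ * s := by ring
  have h2 : K ^ 2 * ∑ z ∈ D, #{q | z ∈ U q} ≤ K ^ 2 * (#S * p) + K ^ 2 * (#D * θ) := by
    rw [← mul_add]
    exact Nat.mul_le_mul_left _ hle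
  have h3 : 2 * K ^ 4 * θ * s ≤ p * s := Nat.mul_le_mul_right s hθ
  refine Nat.le_of_mul_le_mul_left ?_ hp
  nlinarith

/-- A long progression in the sums of a family all of whose pairwise sumsets are small. -/
lemma exists_hasAPLen_of_pairwise {d : ℕ} (hd : 0 < d) {K : ℕ} (hK : 0 < K) :
    ∃ (C : ℕ) (c₁ c₂ : ℝ), 0 < c₁ ∧ 0 < c₂ ∧ ∀ (n u s : ℕ) (X : Fin n → Finset ℤ), 0 < u →
      (∀ i, X i ⊆ Finset.Icc (0 : ℤ) u) → (∀ i, s ≤ #(X i)) → C ≤ s →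
      (∀ i j, i ≠ j → #(X i + X j) ≤ K * s) → c₁ * u ≤ (n : ℝ) ^ d * s →
      ∃ L : ℕ, c₂ * n * (s : ℝ) ^ ((1 : ℝ) / d) ≤ L ∧ HasAPLen (familySum X) L := by
  classical
  obtain ⟨e₁, e₂, he₁, he₂, H⟩ := exists_progression_iterSum hd
  have hK' : (1 : ℝ) ≤ K := by exact_mod_cast hK
  refine ⟨4 * K ^ 2, e₁ * (8 * K ^ 4) ^ d * (2 * K ^ 2) + 2 * (8 * K ^ 4) ^ d,
    e₂ / (8 * K ^ 4 * (2 * K ^ 2)), by positivity, by positivity,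
    fun n u s X hu hXu hXs hs hXX hdens => ?_⟩
  have hK2 : 0 < K ^ 2 := by positivity
  have hK4 : 0 < K ^ 4 := by positivity
  have hs0 : 0 < s := by omega
  have hu' : (1 : ℝ) ≤ u := by exact_mod_cast hu
  have hn : 8 * K ^ 4 ≤ n := by
    by_contra! hlt
    have h0 : 0 < e₁ * (8 * (K : ℝ) ^ 4) ^ d * (2 * K ^ 2) := by positivity
    rcases Nat.eq_zero_or_pos n with rfl | hn0
    · rw [Nat.cast_zero, zero_pow hd.ne', zero_mul] at hdens
      have : 0 < (e₁ * (8 * (K : ℝ) ^ 4) ^ d * (2 * K ^ 2) + 2 * (8 * K ^ 4) ^ d) * u := by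
        positivity
      linarith
    · have h1 := (hXs ⟨0, hn0⟩).trans (Finset.card_le_card (hXu ⟨0, hn0⟩))
      rw [Int.card_Icc] at h1
      have h2 : s ≤ 2 * u := by omega
      have h3 : (s : ℝ) ≤ 2 * u := by exact_mod_cast h2
      have h4 : (n : ℝ) ^ d ≤ (8 * (K : ℝ) ^ 4) ^ d :=
        pow_le_pow_left₀ (by positivity) (by exact_mod_cast hlt.le) d
      have h5 : (n : ℝ) ^ d * s ≤ (8 * (K : ℝ) ^ 4) ^ d * (2 * u) := by gcongr
      nlinarith [mul_pos h0 (by linarith : (0 : ℝ) < u)]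
  obtain ⟨p, hp⟩ : ∃ p, p = (n - 1) / 2 := ⟨_, rfl⟩
  obtain ⟨θ, hθ⟩ : ∃ θ, θ = p / (2 * K ^ 4) := ⟨_, rfl⟩
  have hθp : 2 * K ^ 4 * θ ≤ p := hθ ▸ Nat.mul_div_le _ _
  have hnθ : n ≤ 8 * K ^ 4 * θ := by
    have h1 := Nat.lt_mul_div_succ p (by positivity : 0 < 2 * K ^ 4)
    rw [← hθ, mul_add] at h1
    have h2 : n ≤ 2 * p + 2 := by omega
    have h3 : 8 * K ^ 4 * θ = 4 * (2 * K ^ 4 * θ) := by ring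
    omega
  have hp0 : 0 < p := by omega
  let i₀ : Fin n := ⟨0, by omega⟩
  let a : Fin p → Fin n := fun j => ⟨1 + 2 * j, by omega⟩
  let b : Fin p → Fin n := fun j => ⟨2 + 2 * j, by omega⟩
  have hab : Function.Injective (Sum.elim a b) := by
    refine Function.Injective.sumElim (fun i j h => ?_) (fun i j h => ?_) fun i j h => ?_
    all_goals
      have h' := congrArg Fin.val h
      simp only [a, b] at h'
      omega
  have hne : ∀ i, (X i).Nonempty := fun i => Finset.card_pos.1 (hs0.trans_le (hXs i))
  set A := X i₀ with hA
  choose U c hUsymm hUcard hUsub hUadd using fun q : Fin p =>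
    exists_sub_subset (A := A) hs0 (hXs i₀) (hXs (a q)) (hXs (b q))
      (hXX _ _ fun h => by
        have h' := congrArg Fin.val h
        simp only [a, b] at h'
        omega)
      (hXX _ _ fun h => by
        have h' := congrArg Fin.val h
        simp only [a, i₀] at h'
        omega)
  have hAA : #(A - A) ≤ K ^ 2 * s := by
    have h1 : i₀ ≠ a ⟨0, hp0⟩ := fun h => by
      have h' := congrArg Fin.val h
      simp only [a, i₀] at h'
      omega
    have h2 := Finset.ruzsa_triangle_inequality_sub_add_add A (X (a ⟨0, hp0⟩)) A
    have h3 := hXX _ _ h1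
    refine Nat.le_of_mul_le_mul_right ?_ hs0
    calc #(A - A) * s ≤ #(A - A) * #(X (a ⟨0, hp0⟩)) := Nat.mul_le_mul_left _ (hXs _)
      _ ≤ K * s * (K * s) := h2.trans (Nat.mul_le_mul h3 h3)
      _ = K ^ 2 * s * s := by ring
  have hScard := card_popular_ge hp0 hUsub hUcard hAA hθp
  set S := {z ∈ A - A | θ ≤ #{q | z ∈ U q}} with hS
  have hSsymm : IsSymm S := by
    refine ⟨?_, fun x hx => ?_⟩
    · rw [hS, Finset.mem_filter]
      refine ⟨hUsub ⟨0, hp0⟩ (hUsymm _).zero_mem, ?_⟩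
      rw [Finset.filter_true_of_mem fun q _ => (hUsymm q).zero_mem, Finset.card_univ,
        Fintype.card_fin]
      exact (Nat.le_mul_of_pos_left θ (by positivity)).trans hθp
    · rw [hS, Finset.mem_filter] at hx ⊢
      obtain ⟨w, hw, w', hw', rfl⟩ := Finset.mem_sub.1 hx.1
      refine ⟨Finset.mem_sub.2 ⟨w', hw', w, hw, by ring⟩, hx.2.trans (Finset.card_le_card ?_)⟩
      intro q hq
      rw [Finset.mem_filter] at hq ⊢
      exact ⟨hq.1, (hUsymm q).neg_mem _ hq.2⟩
  have hS2 : 2 ≤ #S := by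
    have h1 : 2 * K ^ 2 * 2 ≤ 2 * K ^ 2 * #S := by omega
    exact Nat.le_of_mul_le_mul_left h1 (by positivity)
  have hSu : ∀ x ∈ S, |x| ≤ u := by
    intro x hx
    obtain ⟨w, hw, w', hw', rfl⟩ := Finset.mem_sub.1 (Finset.mem_filter.1 hx).1
    have h1 := Finset.mem_Icc.1 (hXu i₀ hw)
    have h2 := Finset.mem_Icc.1 (hXu i₀ hw')
    rw [abs_le]
    constructor <;> omega
  have hnθ' : (n : ℝ) ≤ 8 * K ^ 4 * θ := by exact_mod_cast hnθ
  have hScard' : (s : ℝ) ≤ 2 * K ^ 2 * #S := by exact_mod_cast hScard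
  obtain ⟨L, z, hL, hz, hmem⟩ := H S u θ hSsymm hS2 hSu (by
    have h1 : (n : ℝ) ^ d * s ≤ (8 * K ^ 4 * θ) ^ d * (2 * K ^ 2 * #S) := by gcongr
    rw [mul_pow] at h1
    have h2 : (0 : ℝ) < (8 * (K : ℝ) ^ 4) ^ d * (2 * K ^ 2) := by positivity
    refine le_of_mul_le_mul_left ?_ h2
    have h3 : 0 ≤ 2 * (8 * (K : ℝ) ^ 4) ^ d * u := by positivity
    have h4 := hdens.trans h1
    linarith)
  refine ⟨L, le_trans ?_ hL, ?_⟩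
  · have hd1 : (1 : ℝ) / d ≤ 1 := by
      rw [div_le_one (by exact_mod_cast hd)]
      exact_mod_cast hd
    have h1 : (s : ℝ) ^ ((1 : ℝ) / d) ≤ 2 * K ^ 2 * (#S : ℝ) ^ ((1 : ℝ) / d) := by
      calc (s : ℝ) ^ ((1 : ℝ) / d) ≤ (2 * K ^ 2 * #S) ^ ((1 : ℝ) / d) :=
            Real.rpow_le_rpow (by positivity) hScard' (by positivity)
        _ = (2 * K ^ 2) ^ ((1 : ℝ) / d) * (#S : ℝ) ^ ((1 : ℝ) / d) :=
            Real.mul_rpow (by positivity) (by positivity)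
        _ ≤ _ := by
            gcongr
            exact Real.rpow_le_self_of_one_le (by nlinarith) hd1
    calc e₂ / (8 * K ^ 4 * (2 * K ^ 2)) * n * (s : ℝ) ^ ((1 : ℝ) / d)
        ≤ e₂ / (8 * K ^ 4 * (2 * K ^ 2)) * (8 * K ^ 4 * θ)
          * (2 * K ^ 2 * (#S : ℝ) ^ ((1 : ℝ) / d)) := by gcongr
      _ = e₂ * θ * (#S : ℝ) ^ ((1 : ℝ) / d) := by field_simp
  · obtain ⟨τ, hτ⟩ := exists_add_mem_familySum_of_pairs hne hab
    have hU : HasAPLen (familySum U) L := by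
      refine ⟨0, |z|, Int.one_le_abs hz, fun j hj => ?_⟩
      rw [zero_add]
      have hSθ : ∀ z ∈ S, θ ≤ #{q | z ∈ U q} := fun z hz => (Finset.mem_filter.1 hz).2
      refine mem_familySum_of_mem_iterSum (S := S) (θ := θ) (fun q => (hUsymm q).zero_mem) hSθ ?_
      rcases abs_choice z with h | h <;> rw [h]
      · exact hmem j hj.le
      · rw [mul_neg]
        exact hSsymm.neg_mem_iterSum (hmem j hj.le)
    refine hU.of_add (∑ q, c q + τ) ?_
    rintro _ ⟨f, hf, rfl⟩
    rw [← add_assoc, ← Finset.sum_add_distrib]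
    exact hτ _ ⟨_, fun q => hUadd q _ (hf q), rfl⟩

/-- A maximal matching in a graph on `U`: the unmatched vertices are independent. -/
lemma exists_matching {ι : Type*} [DecidableEq ι] (G : ι → ι → Prop) (U : Finset ι) :
    ∃ (p : ℕ) (a b : Fin p → ι) (J : Finset ι), Function.Injective a ∧ Function.Injective b ∧
      (∀ i j, a i ≠ b j) ∧ (∀ q, a q ∈ U) ∧ (∀ q, b q ∈ U) ∧ (∀ q, G (a q) (b q)) ∧
      (∀ x ∈ J, ∀ y ∈ J, x ≠ y → ¬ G x y) ∧ 2 * p + #J = #U := by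
  induction U using Finset.strongInduction with
  | H U ih =>
    by_cases h : ∃ x ∈ U, ∃ y ∈ U, x ≠ y ∧ G x y
    · obtain ⟨x, hx, y, hy, hxy, hG⟩ := h
      have hy' : y ∈ U.erase x := Finset.mem_erase.2 ⟨hxy.symm, hy⟩
      obtain ⟨p, a, b, J, ha, hb, hab, haU, hbU, hGab, hJ, hcard⟩ :=
        ih ((U.erase x).erase y)
          ((Finset.erase_subset _ _).trans_ssubset (Finset.erase_ssubset hx))
      have hmem : ∀ {z}, z ∈ (U.erase x).erase y → z ≠ y ∧ z ≠ x ∧ z ∈ U := fun hz => by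
        rwa [Finset.mem_erase, Finset.mem_erase] at hz
      refine ⟨p + 1, Fin.cons x a, Fin.cons y b, J, ?_, ?_, ?_, ?_, ?_, ?_, hJ, ?_⟩
      · refine Fin.cons_injective_iff.2 ⟨?_, ha⟩
        rintro ⟨q, hq⟩
        exact (hmem (haU q)).2.1 hq
      · refine Fin.cons_injective_iff.2 ⟨?_, hb⟩
        rintro ⟨q, hq⟩
        exact (hmem (hbU q)).1 hq
      · refine Fin.cases (Fin.cases hxy fun j => ?_) fun i => Fin.cases ?_ fun j => ?_
        · exact (hmem (hbU j)).2.1.symm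
        · exact (hmem (haU i)).1
        · exact hab i j
      · exact Fin.cases hx fun q => (hmem (haU q)).2.2
      · exact Fin.cases hy fun q => (hmem (hbU q)).2.2
      · exact Fin.cases hG hGab
      · have h1 := Finset.card_erase_add_one hy'
        have h2 := Finset.card_erase_add_one hx
        omega
    · push Not at h
      exact ⟨0, Fin.elim0, Fin.elim0, U, fun i => i.elim0, fun i => i.elim0, fun i => i.elim0,
        fun i => i.elim0, fun i => i.elim0, fun i => i.elim0, h, by simp⟩

/-- Sums of one element from each of `n` sets of size at least `s` in `[0, u]` contain long
progressions as soon as `n ^ d * s` is large compared to `u`. -/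
theorem exists_hasAPLen_familySum {d : ℕ} (hd : 0 < d) :
    ∃ (C : ℕ) (c₁ c₂ : ℝ), 0 < C ∧ 0 < c₁ ∧ 0 < c₂ ∧
      ∀ (n u s : ℕ) (X : Fin n → Finset ℤ), 0 < u → (∀ i, X i ⊆ Finset.Icc (0 : ℤ) u) →
        (∀ i, s ≤ #(X i)) → C ≤ s → c₁ * u ≤ (n : ℝ) ^ d * s →
        ∃ L : ℕ, c₂ * n * (s : ℝ) ^ ((1 : ℝ) / d) ≤ L ∧ HasAPLen (familySum X) L := by
  obtain ⟨C, e₁, e₂, he₁, he₂, H⟩ :=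
    exists_hasAPLen_of_pairwise hd (K := 2 * 4 ^ d) (by positivity)
  refine ⟨C + 1, e₁ * 2 ^ d, e₂ / 2, by positivity, by positivity, by positivity, ?_⟩
  intro n
  induction n using Nat.strong_induction_on with
  | _ n ih =>
    intro u s X hu hXu hXs hC hdens
    have hs : 0 < s := by omega
    have hne : ∀ i, (X i).Nonempty := fun i => Finset.card_pos.1 (hs.trans_le (hXs i))
    have hn : 0 < n := by
      rw [Nat.pos_iff_ne_zero]
      rintro rfl
      have h1 : 0 < e₁ * 2 ^ d * u := by positivity
      simp [hd.ne'] at hdens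
      linarith
    obtain ⟨p, a, b, J, ha, hb, hab, -, -, hG, hJ, hcard⟩ :=
      exists_matching (fun i j => 2 * 4 ^ d * s < #(X i + X j)) (Finset.univ : Finset (Fin n))
    rw [Finset.card_univ, Fintype.card_fin] at hcard
    rcases le_or_gt n (4 * p) with hp | hp
    · have hp' : (n : ℝ) ≤ 4 * p := by exact_mod_cast hp
      obtain ⟨L, hL, hAP⟩ := ih p (by omega) (2 * u) (2 * 4 ^ d * s)
        (fun q => X (a q) + X (b q)) (by omega) (fun q x hx => by
          obtain ⟨y, hy, z, hz, rfl⟩ := Finset.mem_add.1 hx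
          have h1 := Finset.mem_Icc.1 (hXu _ hy)
          have h2 := Finset.mem_Icc.1 (hXu _ hz)
          rw [Finset.mem_Icc]
          push_cast
          constructor <;> omega)
        (fun q => (hG q).le) (hC.trans (Nat.le_mul_of_pos_left s (by positivity))) (by
          have h1 : (n : ℝ) ^ d * s ≤ (4 * p) ^ d * s := by gcongr
          rw [mul_pow] at h1
          push_cast
          nlinarith)
      obtain ⟨τ, hτ⟩ := exists_add_mem_familySum_of_pairs hne (ha.sumElim hb hab)
      refine ⟨L, le_trans ?_ hL, hAP.of_add τ hτ⟩
      have h4 : (4 : ℝ) * (s : ℝ) ^ ((1 : ℝ) / d)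
          ≤ ((2 * 4 ^ d * s : ℕ) : ℝ) ^ ((1 : ℝ) / d) := by
        calc (4 : ℝ) * (s : ℝ) ^ ((1 : ℝ) / d)
            = ((4 : ℝ) ^ d) ^ ((1 : ℝ) / d) * (s : ℝ) ^ ((1 : ℝ) / d) := by
              rw [one_div, Real.pow_rpow_inv_natCast (by norm_num) hd.ne']
          _ = (4 ^ d * s) ^ ((1 : ℝ) / d) :=
              (Real.mul_rpow (by positivity) (by positivity)).symm
          _ ≤ _ := by
              refine Real.rpow_le_rpow (by positivity) ?_ (by positivity)
              push_cast
              have : (0 : ℝ) ≤ 4 ^ d * s := by positivity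
              linarith
      calc e₂ / 2 * n * (s : ℝ) ^ ((1 : ℝ) / d)
          ≤ e₂ / 2 * (4 * p) * (s : ℝ) ^ ((1 : ℝ) / d) := by gcongr
        _ = e₂ / 2 * p * (4 * (s : ℝ) ^ ((1 : ℝ) / d)) := by ring
        _ ≤ _ := by gcongr
    · have hJn : (n : ℝ) ≤ 2 * (#J : ℝ) := by
        have : n ≤ 2 * #J := by omega
        exact_mod_cast this
      set e := J.orderEmbOfFin rfl with he
      obtain ⟨L, hL, hAP⟩ := H #J u s (X ∘ e) hu (fun i => hXu _) (fun i => hXs _) (by omega)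
        (fun i j hij => not_lt.1 (hJ _ (J.orderEmbOfFin_mem rfl i) _ (J.orderEmbOfFin_mem rfl j)
          fun h => hij (e.injective h))) (by
          have h1 : (n : ℝ) ^ d * s ≤ (2 * (#J : ℝ)) ^ d * s := by gcongr
          rw [mul_pow] at h1
          refine le_of_mul_le_mul_left ?_ (show (0 : ℝ) < 2 ^ d by positivity)
          linarith)
      obtain ⟨τ, hτ⟩ := exists_add_mem_familySum hne e.injective
      refine ⟨L, le_trans ?_ hL, hAP.of_add τ hτ⟩
      calc e₂ / 2 * n * (s : ℝ) ^ ((1 : ℝ) / d)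
          ≤ e₂ / 2 * (2 * #J) * (s : ℝ) ^ ((1 : ℝ) / d) := by gcongr
        _ = _ := by ring

/-- The finite set of all sums of one element from each `X i`. -/
def sumFinset {b : ℕ} (X : Fin b → Finset ℤ) : Finset ℤ :=
  (Fintype.piFinset X).image fun f => ∑ i, f i

lemma mem_sumFinset {b : ℕ} {X : Fin b → Finset ℤ} {x : ℤ} :
    x ∈ sumFinset X ↔ ∃ f : Fin b → ℤ, (∀ i, f i ∈ X i) ∧ ∑ i, f i = x := by
  simp [sumFinset]

lemma sumFinset_subset_Icc {b u : ℕ} {X : Fin b → Finset ℤ}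
    (hX : ∀ i, X i ⊆ Finset.Icc (0 : ℤ) u) : sumFinset X ⊆ Finset.Icc (0 : ℤ) (b * u : ℕ) := by
  intro x hx
  obtain ⟨f, hf, rfl⟩ := mem_sumFinset.1 hx
  have h := fun i => Finset.mem_Icc.1 (hX i (hf i))
  refine Finset.mem_Icc.2 ⟨Finset.sum_nonneg fun i _ => (h i).1, ?_⟩
  calc ∑ i, f i ≤ ∑ _i : Fin b, (u : ℤ) := Finset.sum_le_sum fun i _ => (h i).2
    _ = (b * u : ℕ) := by simp

lemma card_le_card_sumFinset {b : ℕ} {X : Fin b → Finset ℤ} (h0 : ∀ i, 0 ∈ X i) (i : Fin b) :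
    #(X i) ≤ #(sumFinset X) := by
  refine Finset.card_le_card fun x hx => mem_sumFinset.2 ⟨Pi.single i x, fun j => ?_, by simp⟩
  by_cases h : j = i
  · subst h
    simpa using hx
  · simpa [h] using h0 j

lemma le_card_sumFinset {b : ℕ} {X : Fin b → Finset ℤ} (h0 : ∀ i, 0 ∈ X i)
    (hpos : ∀ i, ∃ x ∈ X i, 0 < x) : b ≤ #(sumFinset X) := by
  choose w hw hw0 using hpos
  set g : ℕ → ℤ := fun j => ∑ i : Fin b, if i.val < j then w i else 0 with hg
  have hlt : ∀ j j', j < j' → j < b → g j < g j' := by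
    intro j j' hjj' hj
    refine Finset.sum_lt_sum (fun i _ => ?_) ⟨⟨j, hj⟩, Finset.mem_univ _, ?_⟩
    · have := hw0 i
      split_ifs <;> omega
    · simpa [hjj'] using hw0 ⟨j, hj⟩
  refine (Finset.card_range b).ge.trans ?_
  refine Finset.card_le_card_of_injOn g (fun j _ => ?_) fun j hj j' hj' h => ?_
  · refine Finset.mem_coe.2 (mem_sumFinset.2 ⟨_, fun i => ?_, rfl⟩)
    split_ifs
    · exact hw i
    · exact h0 i
  · rw [Finset.mem_coe, Finset.mem_range] at hj hj'
    rcases lt_trichotomy j j' with h1 | h1 | h1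
    · exact absurd h (hlt _ _ h1 hj).ne
    · exact h1
    · exact absurd h (hlt _ _ h1 hj').ne'

lemma familySum_sumFinset_subset {n b : ℕ} {X : Fin n × Fin b → Finset ℤ} :
    familySum (fun q => sumFinset fun r => X (q, r)) ⊆ familySum X := by
  rintro _ ⟨f, hf, rfl⟩
  choose g hg hgf using fun q => mem_sumFinset.1 (hf q)
  refine ⟨fun x => g x.1 x.2, fun x => hg x.1 x.2, ?_⟩
  rw [Fintype.sum_prod_type]
  exact Finset.sum_congr rfl fun q _ => hgf q

lemma mem_oplusFamily_of_pos {ℓ : ℕ} {A : Fin ℓ → Finset ℤ} {x : ℤ}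
    (hx : x ∈ familySum fun i => insert 0 (A i)) (hx0 : 0 < x) : x ∈ OplusFamily A := by
  obtain ⟨f, hf, rfl⟩ := hx
  refine ⟨({i | f i ≠ 0} : Finset (Fin ℓ)), ?_, f, fun i hi => ?_, ?_⟩
  · obtain ⟨i, hi, h⟩ := Finset.exists_ne_zero_of_sum_ne_zero hx0.ne'
    exact ⟨i, by simpa using h⟩
  · exact (Finset.mem_insert.1 (hf i)).resolve_left (Finset.mem_filter.1 hi).2
  · rw [Finset.sum_filter_ne_zero]

lemma hasAPLen_oplusFamily {ℓ u L : ℕ} {A : Fin ℓ → Finset ℤ}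
    (hA : ∀ i, A i ⊆ Finset.Icc (1 : ℤ) u)
    (h : HasAPLen (familySum fun i => insert 0 (A i)) L) : HasAPLen (OplusFamily A) (L - 1) := by
  obtain ⟨a, Δ, hΔ, ha⟩ := h
  rcases Nat.eq_zero_or_pos L with rfl | hL
  · exact ⟨a, Δ, hΔ, fun j hj => by omega⟩
  have ha0 : 0 ≤ a := by
    obtain ⟨f, hf, hfa⟩ := ha 0 hL
    rw [Nat.cast_zero, zero_mul, add_zero] at hfa
    rw [← hfa]
    refine Finset.sum_nonneg fun i _ => ?_
    rcases Finset.mem_insert.1 (hf i) with h | h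
    · exact h.ge
    · have := (Finset.mem_Icc.1 (hA i h)).1
      omega
  refine ⟨a + Δ, Δ, hΔ, fun j hj => mem_oplusFamily_of_pos ?_ ?_⟩
  · convert ha (j + 1) (by omega) using 1
    push_cast
    ring
  · have : 0 ≤ (j : ℤ) * Δ := by positivity
    omega

lemma hasAPLen_one_oplusFamily {ℓ : ℕ} {A : Fin ℓ → Finset ℤ} (i : Fin ℓ)
    (hA : (A i).Nonempty) : HasAPLen (OplusFamily A) 1 := by
  obtain ⟨x, hx⟩ := hA
  refine ⟨x, 1, le_rfl, fun j hj => ?_⟩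
  obtain rfl : j = 0 := by omega
  exact ⟨{i}, Finset.singleton_nonempty i, fun _ => x, by simpa using hx, by simp⟩

theorem exists_hasAPLen_oplusFamily {d : ℕ} (hd : 0 < d) :
    ∃ c₁ c₂ : ℝ, 0 < c₁ ∧ 0 < c₂ ∧
      ∀ (u k ℓ : ℕ), 0 < u → 0 < k → 0 < ℓ →
        ∀ A : Fin ℓ → Finset ℤ, (∀ i, A i ⊆ Finset.Icc (1 : ℤ) u) → (∀ i, #(A i) = k) →
          (ℓ : ℝ) ^ d * k ≥ c₁ * u →
          ∃ L : ℕ, (L : ℝ) ≥ c₂ * ℓ * (k : ℝ) ^ ((1 : ℝ) / d) ∧ HasAPLen (OplusFamily A) L := by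
  obtain ⟨b, e₁, e₂, hb, he₁, he₂, H⟩ := exists_hasAPLen_familySum hd
  refine ⟨e₁ * b * (2 * b) ^ d + b ^ d, e₂ / (4 * b), by positivity, by positivity, ?_⟩
  intro u k ℓ hu hk hℓ A hA hAk hdens
  have hku : k ≤ u := by
    have h1 := Finset.card_le_card (hA ⟨0, hℓ⟩)
    rw [hAk, Int.card_Icc] at h1
    omega
  have hku' : (k : ℝ) ≤ u := by exact_mod_cast hku
  have hbℓ : b ≤ ℓ := by
    by_contra! hlt
    have h1 : (ℓ : ℝ) ^ d < b ^ d :=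
      pow_lt_pow_left₀ (by exact_mod_cast hlt) (by positivity) hd.ne'
    have h2 : (ℓ : ℝ) ^ d * k < b ^ d * k := mul_lt_mul_of_pos_right h1 (by exact_mod_cast hk)
    have h3 : (b : ℝ) ^ d * k ≤ b ^ d * u := by gcongr
    have h4 : 0 ≤ e₁ * b * (2 * b) ^ d * u := by positivity
    linarith
  set n := ℓ / b with hn
  have hnb : n * b ≤ ℓ := Nat.div_mul_le_self ℓ b
  have hℓn : (ℓ : ℝ) ≤ 2 * b * n := by
    have h1 : 1 ≤ n := Nat.div_pos hbℓ hb
    have h2 : ℓ < b * (n + 1) := Nat.lt_mul_div_succ ℓ hb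
    have h3 : ℓ ≤ 2 * b * n := by nlinarith
    exact_mod_cast h3
  set X : Fin ℓ → Finset ℤ := fun i => insert 0 (A i) with hX
  have hX0 : ∀ i, 0 ∈ X i := fun i => Finset.mem_insert_self _ _
  have hXu : ∀ i, X i ⊆ Finset.Icc (0 : ℤ) u := fun i => Finset.insert_subset
    (by simp) ((hA i).trans (Finset.Icc_subset_Icc_left (by norm_num)))
  have hXpos : ∀ i, ∃ x ∈ X i, 0 < x := fun i => by
    obtain ⟨x, hx⟩ := Finset.card_pos.1 ((hAk i).symm ▸ hk)
    have := (Finset.mem_Icc.1 (hA i hx)).1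
    exact ⟨x, Finset.mem_insert_of_mem hx, by omega⟩
  have hXk : ∀ i, k ≤ #(X i) := fun i =>
    (hAk i).symm.le.trans (Finset.card_le_card (Finset.subset_insert _ _))
  set e : Fin n × Fin b → Fin ℓ := Fin.castLE hnb ∘ finProdFinEquiv with he
  have hinj : Function.Injective e :=
    (Fin.castLE_injective hnb).comp finProdFinEquiv.injective
  obtain ⟨L, hL, hAP⟩ := H n (b * u) (max k b) (fun q => sumFinset fun r => X (e (q, r)))
    (by positivity) (fun q => sumFinset_subset_Icc fun r => hXu _)
    (fun q => max_le ((hXk _).trans (card_le_card_sumFinset (X := fun r => X (e (q, r)))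
      (fun r => hX0 _) ⟨0, hb⟩)) (le_card_sumFinset (fun r => hX0 _) fun r => hXpos _))
    (le_max_right _ _) (by
      have h1 : (ℓ : ℝ) ^ d * k ≤ (2 * b * n) ^ d * (max k b : ℕ) := by
        have : (k : ℝ) ≤ (max k b : ℕ) := by exact_mod_cast le_max_left k b
        gcongr
      rw [mul_pow] at h1
      refine le_of_mul_le_mul_left ?_ (show (0 : ℝ) < (2 * b) ^ d by positivity)
      have h4 : (0 : ℝ) ≤ b ^ d * u := by positivity
      push_cast at h1 ⊢
      linarith)
  obtain ⟨τ, hτ⟩ := exists_add_mem_familySum (fun i => ⟨0, hX0 i⟩) hinj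
  have hAP' : HasAPLen (OplusFamily A) (L - 1) :=
    hasAPLen_oplusFamily hA (hAP.of_add τ fun x hx =>
      hτ x (familySum_sumFinset_subset (X := X ∘ e) hx))
  have hbound : e₂ / (4 * b) * ℓ * (k : ℝ) ^ ((1 : ℝ) / d) ≤ L / 2 := by
    have h1 : (k : ℝ) ≤ (max k b : ℕ) := by exact_mod_cast le_max_left k b
    calc e₂ / (4 * b) * ℓ * (k : ℝ) ^ ((1 : ℝ) / d)
        ≤ e₂ / (4 * b) * (2 * b * n) * ((max k b : ℕ) : ℝ) ^ ((1 : ℝ) / d) := by gcongr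
      _ = e₂ * n * ((max k b : ℕ) : ℝ) ^ ((1 : ℝ) / d) / 2 := by field_simp; norm_num
      _ ≤ L / 2 := by gcongr
  rcases le_or_gt L 1 with h | h
  · refine ⟨1, hbound.trans ?_, hasAPLen_one_oplusFamily ⟨0, hℓ⟩ ?_⟩
    · have : (L : ℝ) ≤ 1 := by exact_mod_cast h
      push_cast
      linarith
    · exact Finset.card_pos.1 ((hAk _).symm ▸ hk)
  · refine ⟨L - 1, hbound.trans ?_, hAP'⟩
    have : (2 : ℝ) ≤ L := by exact_mod_cast h
    rw [Nat.cast_sub h.le]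
    push_cast
    linarith

end SumsetAP

theorem stmt6 (d : ℕ) (hd : 0 < d) :
    ∃ c₁ c₂ : ℝ, 0 < c₁ ∧ 0 < c₂ ∧
      ∀ (u k ℓ : ℕ), 0 < u → 0 < k → 0 < ℓ →
        ∀ A : Fin ℓ → Finset ℤ,
          (∀ i, A i ⊆ Finset.Icc (1 : ℤ) (u : ℤ)) →
          (∀ i, (A i).card = k) →
          (ℓ : ℝ) ^ d * (k : ℝ) ≥ c₁ * (u : ℝ) →
          ∃ L : ℕ, (L : ℝ) ≥ c₂ * (ℓ : ℝ) * (k : ℝ) ^ ((1 : ℝ) / d) ∧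
            HasAPLen (OplusFamily A) L := by
  exact SumsetAP.exists_hasAPLen_oplusFamily hd
end

section
/- There exists a constant c > 0 such that the following holds: for all positive integers u, k, ℓ, every real number u' ≥ u, and all finite nonempty sets A₁, …, A_ℓ ⊆ {1, …, u−1} each of size at least k, if ℓ · k ≥ c · u', then A₁ ⊕ ⋯ ⊕ A_ℓ contains an arithmetic progression of length at least u'. -/
open scoped Pointwise in
theorem two_mul_card_add_le_of_closure_not_subset {G : Type*} [AddCommGroup G] [DecidableEq G]
    {B H X : Finset G} (hB : (0 : G) ∈ B) (hH : ∀ x, x ∈ H ↔ x ∈ AddSubgroup.closure (B : Set G))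
    (hX : X.Nonempty) (hXH : X ⊆ H) (hXB : ¬ H ⊆ X + B) :
    2 * X.card + B.card ≤ 2 * (X + B).card := by
  have hBH : B ⊆ H := fun b hb => (hH b).2 (AddSubgroup.subset_closure hb)
  have hHadd : ∀ x ∈ H, ∀ y ∈ H, x + y ∈ H := fun x hx y hy =>
    (hH _).2 (add_mem ((hH x).1 hx) ((hH y).1 hy))
  have hHneg : ∀ x ∈ H, -x ∈ H := fun x hx => (hH _).2 (neg_mem ((hH x).1 hx))
  have hsub : ∀ Y ⊆ H, Y + B ⊆ H := fun Y hY z hz => by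
    obtain ⟨y, hy, b, hb, rfl⟩ := Finset.mem_add.1 hz
    exact hHadd _ (hY hy) _ (hBH hb)
  have hself : ∀ Y : Finset G, Y ⊆ Y + B := fun Y y hy =>
    Finset.mem_add.2 ⟨y, hy, 0, hB, add_zero y⟩
  set P : Finset G → Prop := fun Y => Y.Nonempty ∧ Y ⊆ H ∧ ¬ H ⊆ Y + B with hP
  classical
  -- an atom: a set minimising the boundary, and of least size among those
  obtain ⟨F, hF, hmin, hatom⟩ : ∃ F, P F ∧
      (∀ Y, P Y → (F + B).card + Y.card ≤ (Y + B).card + F.card) ∧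
      (∀ Y, P Y → (Y + B).card + F.card = (F + B).card + Y.card → F.card ≤ Y.card) := by
    obtain ⟨F₀, hF₀, h₀⟩ := Finset.exists_min_image (H.powerset.filter P)
      (fun Y => (Y + B).card - Y.card) ⟨X, by simp [hP, hX, hXH, hXB]⟩
    obtain ⟨F, hF, h₁⟩ := Finset.exists_min_image
      ((H.powerset.filter P).filter
        fun Y => (Y + B).card - Y.card = (F₀ + B).card - F₀.card)
      (fun Y => Y.card) ⟨F₀, by simpa using hF₀⟩
    simp only [Finset.mem_filter, Finset.mem_powerset] at hF₀ hF h₀ h₁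
    have hF' := Finset.card_le_card (hself F)
    refine ⟨F, hF.1.2, fun Y hY => ?_, fun Y hY h => ?_⟩
    · have := h₀ Y ⟨hY.2.1, hY⟩
      have := Finset.card_le_card (hself Y)
      omega
    · have := Finset.card_le_card (hself Y)
      exact h₁ Y ⟨⟨hY.2.1, hY⟩, by omega⟩
  obtain ⟨hFne, hFH, hFB⟩ := hF
  have hFBH := Finset.card_le_card (hsub F hFH)
  have hdual : F.card + (F + B).card ≤ H.card := by
    set Y := -(H \ (F + B)) with hY
    have hYc : Y.card + (F + B).card = H.card := by
      rw [hY, Finset.card_neg, Finset.card_sdiff_add_card_eq_card (hsub F hFH)]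
    have hYsub : Y + B ⊆ H \ (-F) := by
      intro z hz
      obtain ⟨y, hy, b, hb, rfl⟩ := Finset.mem_add.1 hz
      rw [hY, Finset.mem_neg'] at hy
      rw [Finset.mem_sdiff] at hy ⊢
      refine ⟨hHadd _ (by simpa using hHneg _ hy.1) _ (hBH hb), fun h => hy.2 ?_⟩
      rw [Finset.mem_neg'] at h
      exact Finset.mem_add.2 ⟨_, h, b, hb, by abel⟩
    have hnegF : -F ⊆ H := fun z hz => by
      rw [Finset.mem_neg'] at hz
      simpa using hHneg _ (hFH hz)
    have hYB : (Y + B).card + F.card ≤ H.card := by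
      have := Finset.card_le_card hYsub
      have h2 := Finset.card_sdiff_add_card_eq_card hnegF
      rw [Finset.card_neg] at h2
      omega
    have hPY : P Y := by
      refine ⟨?_, ?_, fun h => ?_⟩
      · rw [hY, Finset.neg_nonempty_iff]
        obtain ⟨z, hz, hz'⟩ := Finset.not_subset.1 hFB
        exact ⟨z, Finset.mem_sdiff.2 ⟨hz, hz'⟩⟩
      · intro z hz
        rw [hY, Finset.mem_neg'] at hz
        simpa using hHneg _ (Finset.mem_sdiff.1 hz).1
      · obtain ⟨f, hf⟩ := hFne
        have := hYsub (h (hHneg f (hFH hf)))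
        simp [hf] at this
    have h1 := hmin Y hPY
    have h2 := hatom Y hPY (by omega)
    omega
  have htrans : ∀ g ∈ H, (F ∩ ({g} + F)).Nonempty → {g} + F = F := by
    intro g hg hne
    by_contra hcon
    set F' := {g} + F with hF'
    have hF'c : F'.card = F.card := Finset.card_singleton_add ..
    have hF'B : (F' + B).card = (F + B).card := by
      rw [hF', add_assoc]; exact Finset.card_singleton_add ..
    have hF'H : F' ⊆ H := fun z hz => by
      obtain ⟨y, hy, b, hb, rfl⟩ := Finset.mem_add.1 hz
      rw [Finset.mem_singleton] at hy
      exact hHadd _ (hy ▸ hg) _ (hFH hb)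
    have hlt : (F ∩ F').card < F.card := by
      refine Finset.card_lt_card ⟨Finset.inter_subset_left, fun h => hcon ?_⟩
      exact (Finset.eq_of_subset_of_card_le (h.trans Finset.inter_subset_right) hF'c.le).symm
    have hPi : P (F ∩ F') := ⟨hne, Finset.inter_subset_left.trans hFH, fun h =>
      hFB (h.trans (Finset.add_subset_add_right Finset.inter_subset_left))⟩
    have h1 := hmin _ hPi
    have h2 := mt (hatom _ hPi) (by omega)
    have h3 : ((F ∪ F') + B).card + ((F ∩ F') + B).card ≤ (F + B).card + (F' + B).card := by
      rw [← Finset.card_union_add_card_inter (F + B) (F' + B), Finset.union_add]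
      exact Nat.add_le_add_left (Finset.card_le_card Finset.inter_add_subset) _
    have h4 := Finset.card_union_add_card_inter F F'
    have hPu : P (F ∪ F') := by
      refine ⟨hFne.mono Finset.subset_union_left, Finset.union_subset hFH hF'H, fun h => ?_⟩
      have := Finset.card_le_card h
      have := hne.card_pos
      omega
    have h5 := hmin _ hPu
    omega
  have hdouble : 2 * F.card ≤ (F + B).card := by
    by_cases h : ∀ b ∈ B, {b} + F = F
    · exfalso
      have hstab : ∀ g ∈ AddSubgroup.closure (B : Set G), {g} + F = F := by
        intro g hg
        induction hg using AddSubgroup.closure_induction with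
        | mem x hx => exact h x hx
        | zero => rw [Finset.singleton_zero, zero_add]
        | add x y _ _ hx hy => rw [← Finset.singleton_add_singleton, add_assoc, hy, hx]
        | neg x _ hx =>
          nth_rw 1 [← hx]
          rw [← add_assoc, Finset.singleton_add_singleton, neg_add_cancel, Finset.singleton_zero,
            zero_add]
      obtain ⟨f, hf⟩ := hFne
      refine hFB fun z hz => hself F ?_
      rw [← hstab (z - f) ((hH _).1 (by rw [sub_eq_add_neg]; exact hHadd _ hz _ (hHneg _ (hFH hf))))]
      exact Finset.mem_add.2 ⟨z - f, by simp, f, hf, by abel⟩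
    · push Not at h
      obtain ⟨b, hb, hbF⟩ := h
      have hd : Disjoint F ({b} + F) := by
        rw [Finset.disjoint_iff_inter_eq_empty, ← Finset.not_nonempty_iff_eq_empty]
        exact fun h => hbF (htrans b (hBH hb) h)
      have hs : F ∪ ({b} + F) ⊆ F + B := by
        refine Finset.union_subset (hself F) ?_
        rw [add_comm]
        exact Finset.add_subset_add_left (Finset.singleton_subset_iff.2 hb)
      have := Finset.card_le_card hs
      rw [Finset.card_union_of_disjoint hd, Finset.card_singleton_add] at this
      omega
  have h1 := hmin X ⟨hX, hXH, hXB⟩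
  have h2 : B.card ≤ (F + B).card := by
    obtain ⟨f, hf⟩ := hFne
    rw [← Finset.card_singleton_add (t := B) f]
    exact Finset.card_le_card (Finset.add_subset_add_right (Finset.singleton_subset_iff.2 hf))
  omega

open scoped Pointwise in
/-- **Olson's theorem** for finite abelian groups: if `X` and `B` contain `0`, then `X + B` contains
the subgroup generated by `B` unless `X + B` exceeds `X` by at least half the size of `B`. -/
theorem closure_subset_add_or_two_mul_card_add_le {G : Type*} [AddCommGroup G] [Finite G]
    [DecidableEq G] {X B : Finset G} (hX : (0 : G) ∈ X) (hB : (0 : G) ∈ B) :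
    (∀ h ∈ AddSubgroup.closure (B : Set G), h ∈ X + B) ∨
      2 * X.card + B.card ≤ 2 * (X + B).card := by
  classical
  have := Fintype.ofFinite G
  set K := AddSubgroup.closure (B : Set G) with hK
  by_cases hc : ∀ h ∈ K, h ∈ X + B
  · exact Or.inl hc
  refine Or.inr ?_
  have hBK : ∀ b ∈ B, b ∈ K := fun b hb => AddSubgroup.subset_closure hb
  set X₀ := X.filter (· ∈ K) with hX₀
  set X₁ := X.filter (· ∉ K) with hX₁
  have h0 : 2 * X₀.card + B.card ≤ 2 * (X₀ + B).card := by
    refine two_mul_card_add_le_of_closure_not_subset (H := Finset.univ.filter (· ∈ K)) hB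
      (by simp [hK]) ⟨0, by simp [hX₀, hX, zero_mem]⟩ ?_ fun h => hc fun x hx => ?_
    · intro x hx
      simp only [hX₀, Finset.mem_filter] at hx
      simpa using hx.2
    · exact Finset.add_subset_add_right (Finset.filter_subset _ _) (h (by simpa using hx))
  have h1 : X₁.card ≤ (X₁ + B).card := Finset.card_le_card fun y hy =>
    Finset.mem_add.2 ⟨y, hy, 0, hB, add_zero y⟩
  have h2 : X₀.card + X₁.card = X.card := Finset.card_filter_add_card_filter_not ..
  have h3 : Disjoint (X₀ + B) (X₁ + B) := by
    rw [Finset.disjoint_left]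
    intro z hz hz'
    obtain ⟨x, hx, b, hb, rfl⟩ := Finset.mem_add.1 hz
    obtain ⟨y, hy, b', hb', h⟩ := Finset.mem_add.1 hz'
    simp only [hX₀, hX₁, Finset.mem_filter] at hx hy
    refine hy.2 ?_
    rw [show y = x + b - b' by rw [← h]; abel]
    exact sub_mem (add_mem hx.2 (hBK b hb)) (hBK b' hb')
  have h4 : (X₀ + B) ∪ (X₁ + B) ⊆ X + B := Finset.union_subset
    (Finset.add_subset_add_right (Finset.filter_subset _ _))
    (Finset.add_subset_add_right (Finset.filter_subset _ _))
  have h5 := Finset.card_le_card h4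
  rw [Finset.card_union_of_disjoint h3] at h5
  omega

theorem sum_range_min_sub_mul (q w t : ℕ) :
    ∑ i ∈ Finset.range t, min q (w - q * i) = min (q * t) w := by
  induction t with
  | zero => simp
  | succ t ih =>
    rw [Finset.sum_range_succ, ih, Nat.mul_succ]
    omega

theorem card_le_two_mul_card_image_intCast {m : ℕ} {S : Finset ℤ}
    (hS : ∀ x ∈ S, 0 ≤ x ∧ x < 2 * m) :
    S.card ≤ 2 * (S.image (Int.cast : ℤ → ZMod m)).card := by
  have key : ∀ T ⊆ S, (∀ x ∈ T, ∀ y ∈ T, |x - y| < m) →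
      T.card ≤ (S.image (Int.cast : ℤ → ZMod m)).card := fun T hT h =>
    Finset.card_le_card_of_injOn _ (fun x hx => Finset.mem_image_of_mem _ (hT hx))
      fun x hx y hy hxy => by
        have h1 := (ZMod.intCast_eq_intCast_iff_dvd_sub _ _ _).1 hxy
        have h2 := Int.eq_zero_of_abs_lt_dvd h1 (by rw [← abs_neg, neg_sub]; exact h x hx y hy)
        omega
  have h1 := key (S.filter (· < (m : ℤ))) (Finset.filter_subset _ _) fun x hx y hy => by
    rw [Finset.mem_filter] at hx hy
    have := hS x hx.1
    have := hS y hy.1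
    rw [abs_lt]; omega
  have h2 := key (S.filter (¬ · < (m : ℤ))) (Finset.filter_subset _ _) fun x hx y hy => by
    rw [Finset.mem_filter] at hx hy
    have := hS x hx.1
    have := hS y hy.1
    rw [abs_lt]; omega
  have h3 := Finset.card_filter_add_card_filter_not (s := S) (· < (m : ℤ))
  omega

/-- The integers of the form `∑ s < n, (x s + v s * m)`, with `x s ∈ B s ∪ {0}`, `v s ≤ 6`, and
`v s = 0` unless `m ∈ B s`. -/
def BlockSums (B : ℕ → Finset ℤ) (n : ℕ) (m : ℤ) : Set ℤ :=
  {z | ∃ (x : ℕ → ℤ) (v : ℕ → ℕ), (∀ s, x s ∈ insert 0 (B s)) ∧ (∀ s, v s ≤ 6) ∧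
    (∀ s, v s ≠ 0 → m ∈ B s) ∧ z = ∑ s ∈ Finset.range n, (x s + v s * m)}

open scoped Pointwise in
theorem exists_lift_of_mem_sum_image {m : ℕ} {B : ℕ → Finset ℤ} {a t : ℕ} {h : ZMod m}
    (hh : h ∈ ∑ i ∈ Finset.range t, (insert 0 (B (a + i))).image (Int.cast : ℤ → ZMod m)) :
    ∃ x : ℕ → ℤ, (∀ s, x s ∈ insert 0 (B s)) ∧
      ((∑ i ∈ Finset.range t, x (a + i) : ℤ) : ZMod m) = h := by
  induction t generalizing h with
  | zero => exact ⟨0, by simp, by simpa [eq_comm] using hh⟩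
  | succ t ih =>
    rw [Finset.sum_range_succ] at hh
    obtain ⟨y, hy, b, hb, rfl⟩ := Finset.mem_add.1 hh
    obtain ⟨x, hx, rfl⟩ := ih hy
    obtain ⟨c, hc, rfl⟩ := Finset.mem_image.1 hb
    refine ⟨Function.update x (a + t) c, fun s => ?_, ?_⟩
    · rcases eq_or_ne s (a + t) with rfl | hs
      · simpa using hc
      · simpa [hs] using hx s
    · rw [Finset.sum_range_succ, Function.update_self, Int.cast_add]
      congr 2
      refine Finset.sum_congr rfl fun i hi => Function.update_of_ne ?_ _ _
      rw [Finset.mem_range] at hi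
      omega

open scoped Pointwise in
theorem sum_card_le_or_closure_subset {m : ℕ} [NeZero m] {B : ℕ → Finset ℤ} {a t : ℕ}
    (hB : ∀ i < t, ∀ x ∈ B (a + i), 0 ≤ x ∧ x < 2 * m) :
    ∑ i ∈ Finset.range t, (B (a + i)).card ≤ 4 * m ∨
    ∃ i < t, ∑ i ∈ Finset.range i, (B (a + i)).card ≤ 4 * m ∧
      ∀ h ∈ AddSubgroup.closure
          (((insert 0 (B (a + i))).image (Int.cast : ℤ → ZMod m) : Finset (ZMod m)) : Set (ZMod m)),
        h ∈ ∑ i ∈ Finset.range (i + 1), (insert 0 (B (a + i))).image (Int.cast : ℤ → ZMod m) := by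
  set C : ℕ → Finset (ZMod m) := fun i => (insert 0 (B (a + i))).image Int.cast with hC
  have hC0 : ∀ i, (0 : ZMod m) ∈ C i := fun i =>
    Finset.mem_image.2 ⟨0, Finset.mem_insert_self _ _, by simp⟩
  have hX0 : ∀ t, (0 : ZMod m) ∈ ∑ i ∈ Finset.range t, C i := by
    intro t
    induction t with
    | zero => simp
    | succ t ih =>
      rw [Finset.sum_range_succ]
      exact Finset.mem_add.2 ⟨0, ih, 0, hC0 t, add_zero 0⟩
  have hXm : ∀ t, (∑ i ∈ Finset.range t, C i).card ≤ m := fun t =>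
    (Finset.card_le_univ _).trans (ZMod.card m).le
  suffices h : ∑ i ∈ Finset.range t, (B (a + i)).card ≤ 4 * (∑ i ∈ Finset.range t, C i).card ∨
      ∃ i < t, ∑ i ∈ Finset.range i, (B (a + i)).card ≤ 4 * m ∧
        ∀ h ∈ AddSubgroup.closure (C i : Set (ZMod m)), h ∈ ∑ i ∈ Finset.range (i + 1), C i by
    refine h.imp_left fun h => h.trans ?_
    have := hXm t
    omega
  induction t with
  | zero => left; simp
  | succ t ih =>
    rcases ih fun i hi => hB i (by omega) with h | ⟨i, hi, h⟩
    · rcases closure_subset_add_or_two_mul_card_add_le (hX0 t) (hC0 t) with h' | h'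
      · refine Or.inr ⟨t, by omega, ?_, by rwa [Finset.sum_range_succ]⟩
        have := hXm t
        omega
      · left
        rw [Finset.sum_range_succ, Finset.sum_range_succ]
        have h1 := card_le_two_mul_card_image_intCast (hB t (by omega))
        have h2 : ((B (a + t)).image (Int.cast : ℤ → ZMod m)).card ≤ (C t).card :=
          Finset.card_le_card (Finset.image_subset_image (Finset.subset_insert _ _))
        omega
    · exact Or.inr ⟨i, by omega, h⟩

theorem exists_dvd_iff_mem_intCast {m : ℕ} [NeZero m] (K : AddSubgroup (ZMod m)) :
    ∃ d : ℤ, 1 ≤ d ∧ ∀ z : ℤ, (z : ZMod m) ∈ K ↔ d ∣ z := by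
  obtain ⟨g, hg⟩ := Int.subgroup_cyclic (K.comap (Int.castAddHom (ZMod m)))
  have h : ∀ z : ℤ, (z : ZMod m) ∈ K ↔ g ∣ z := fun z => by
    rw [← Int.mem_zmultiples_iff, AddSubgroup.zmultiples_eq_closure, ← hg]
    rfl
  have hg0 : g ≠ 0 := by
    rintro rfl
    have := (h m).1 (by simp [zero_mem])
    simp [NeZero.ne m] at this
  exact ⟨|g|, Int.one_le_abs hg0, fun z => by rw [h, abs_dvd]⟩

theorem sum_card_le_or_mem_blockSums {B : ℕ → Finset ℤ} {a t n m : ℕ} (hn : a + t ≤ n)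
    (hm : 0 < m) (hmB : ∀ i < t, (m : ℤ) ∈ B (a + i))
    (hB : ∀ i < t, ∀ x ∈ B (a + i), 0 ≤ x ∧ x < 2 * m) :
    ∑ i ∈ Finset.range t, (B (a + i)).card ≤ 4 * m ∨
    ∃ i < t, ∑ i ∈ Finset.range i, (B (a + i)).card ≤ 4 * m ∧
      ∃ d α : ℤ, 1 ≤ d ∧ (∀ x ∈ B (a + i), d ∣ x) ∧ 0 < α ∧ d ∣ α ∧
        ∀ z, d ∣ z → α ≤ z → z ≤ α + 2 * m → z ∈ BlockSums B n m := by
  have : NeZero m := ⟨hm.ne'⟩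
  refine (sum_card_le_or_closure_subset hB).imp_right ?_
  rintro ⟨i, hi, hsum, hcl⟩
  refine ⟨i, hi, hsum, ?_⟩
  obtain ⟨d, hd, hdK⟩ := exists_dvd_iff_mem_intCast (AddSubgroup.closure
    (((insert 0 (B (a + i))).image (Int.cast : ℤ → ZMod m) : Finset (ZMod m)) : Set (ZMod m)))
  have hdB : ∀ x ∈ B (a + i), d ∣ x := fun x hx =>
    (hdK x).1 (AddSubgroup.subset_closure (Finset.mem_image_of_mem _ (Finset.mem_insert_of_mem hx)))
  have ht0 : 0 < t := (Nat.zero_le i).trans_lt hi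
  refine ⟨d, 2 * t * m, hd, hdB, by positivity, (hdB _ (hmB i hi)).mul_left _, ?_⟩
  intro z hdz hz1 hz2
  obtain ⟨x, hx, hxz⟩ := exists_lift_of_mem_sum_image (hcl _ ((hdK z).2 hdz))
  set r := ∑ j ∈ Finset.range (i + 1), x (a + j) with hr
  have hxb : ∀ j < t, 0 ≤ x (a + j) ∧ x (a + j) ≤ 2 * m := fun j hj => by
    rcases Finset.mem_insert.1 (hx (a + j)) with h | h
    · rw [h]; omega
    · exact ⟨(hB j hj _ h).1, (hB j hj _ h).2.le⟩
  have hr0 : 0 ≤ r := Finset.sum_nonneg fun j hj => (hxb j (by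
    rw [Finset.mem_range] at hj; omega)).1
  have hr1 : r ≤ 2 * t * m := by
    calc r ≤ ∑ j ∈ Finset.range (i + 1), (2 * m : ℤ) := Finset.sum_le_sum fun j hj => (hxb j (by
          rw [Finset.mem_range] at hj; omega)).2
      _ = (i + 1 : ℕ) * (2 * m : ℤ) := by simp
      _ ≤ t * (2 * m : ℤ) := by gcongr; omega
      _ = 2 * t * m := by ring
  obtain ⟨w, hw⟩ := (ZMod.intCast_eq_intCast_iff_dvd_sub r z m).1 hxz
  have hm' : (0 : ℤ) < m := by exact_mod_cast hm
  have ht : (1 : ℤ) ≤ t := by omega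
  have hw0 : 0 ≤ w := by
    by_contra! h
    nlinarith
  have hw1 : w ≤ 6 * t := by
    by_contra! h
    nlinarith
  lift w to ℕ using hw0
  have hw2 : w ≤ 6 * t := by exact_mod_cast hw1
  have hsplit : ∀ (c : ℕ) (f : ℕ → ℤ), a + c ≤ n →
      ∑ s ∈ Finset.range n, (if a ≤ s ∧ s < a + c then f s else 0) =
        ∑ j ∈ Finset.range c, f (a + j) := fun c f hc => by
    rw [← Finset.sum_filter]
    refine (Finset.sum_nbij' (a + ·) (· - a) ?_ ?_ ?_ ?_ ?_).symm
    all_goals simp only [Finset.mem_filter, Finset.mem_range, implies_true]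
    all_goals intros; omega
  refine ⟨fun s => if a ≤ s ∧ s < a + (i + 1) then x s else 0,
    fun s => if a ≤ s ∧ s < a + t then min 6 (w - 6 * (s - a)) else 0, fun s => ?_, fun s => ?_,
    fun s hs => ?_, ?_⟩
  · dsimp only
    split_ifs
    exacts [hx s, Finset.mem_insert_self _ _]
  · dsimp only
    split_ifs <;> omega
  · have h : a ≤ s ∧ s < a + t := by
      by_contra h
      exact hs (if_neg h)
    have := hmB (s - a) (by omega)
    rwa [Nat.add_sub_cancel' h.1] at this
  · rw [Finset.sum_add_distrib, hsplit _ _ (by omega), ← hr, ← Finset.sum_mul]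
    have h1 := hsplit t (fun s => ((min 6 (w - 6 * (s - a)) : ℕ) : ℤ)) hn
    simp only [Nat.add_sub_cancel_left] at h1
    rw [← Nat.cast_sum, sum_range_min_sub_mul, min_eq_right hw2] at h1
    have h2 : ∑ s ∈ Finset.range n,
        (((if a ≤ s ∧ s < a + t then min 6 (w - 6 * (s - a)) else 0 : ℕ)) : ℤ) = w := by
      rw [← h1]
      refine Finset.sum_congr rfl fun s _ => ?_
      split_ifs <;> simp
    rw [h2]
    linarith

theorem sum_card_le_or_exists_blockSums {B : ℕ → Finset ℤ} (hanti : Antitone B) (n U a : ℕ)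
    (hB : ∀ s, a ≤ s → s < n → ∀ x ∈ B s, 1 ≤ x ∧ x ≤ U) :
    ∑ s ∈ Finset.Ico a n, (B s).card ≤ 8 * U ∨
    ∃ i, a ≤ i ∧ i < n ∧ ∑ s ∈ Finset.Ico a i, (B s).card ≤ 8 * U ∧
      ∃ d α L m : ℤ, 1 ≤ d ∧ (∀ x ∈ B i, d ∣ x) ∧ 0 < α ∧ d ∣ α ∧ 0 ≤ L ∧ (∀ x ∈ B i, x ≤ L) ∧
        ∀ z, d ∣ z → α ≤ z → z ≤ α + L → z ∈ BlockSums B n m := by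
  induction U using Nat.strong_induction_on generalizing a with
  | _ U ih =>
  rcases Nat.eq_zero_or_pos U with rfl | hU
  · left
    refine (Finset.sum_eq_zero fun s hs => ?_).le
    rw [Finset.mem_Ico] at hs
    rw [Finset.card_eq_zero, Finset.eq_empty_iff_forall_notMem]
    intro x hx
    have := hB s hs.1 hs.2 x hx
    push_cast at this
    omega
  rcases Nat.lt_or_ge n a with hna | hna
  · left
    rw [Finset.Ico_eq_empty_of_le hna.le]
    simp
  classical
  have hex : ∃ s, a ≤ s ∧ (n ≤ s ∨ ∀ x ∈ B s, x ≤ (U / 2 : ℕ)) := ⟨n, hna, Or.inl le_rfl⟩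
  obtain ⟨b, ⟨hab, hb⟩, hbmin⟩ : ∃ b, (a ≤ b ∧ (n ≤ b ∨ ∀ x ∈ B b, x ≤ (U / 2 : ℕ))) ∧
      ∀ s < b, ¬ (a ≤ s ∧ (n ≤ s ∨ ∀ x ∈ B s, x ≤ (U / 2 : ℕ))) :=
    ⟨Nat.find hex, Nat.find_spec hex, fun s hs => Nat.find_min hex hs⟩
  have hbn : b ≤ n := by
    by_contra! h
    exact hbmin n h ⟨hna, Or.inl le_rfl⟩
  obtain ⟨t, rfl⟩ := Nat.exists_eq_add_of_le hab
  have hblock : ∑ s ∈ Finset.Ico a (a + t), (B s).card ≤ 4 * U ∨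
    ∃ i, a ≤ i ∧ i < n ∧ ∑ s ∈ Finset.Ico a i, (B s).card ≤ 8 * U ∧
      ∃ d α L m : ℤ, 1 ≤ d ∧ (∀ x ∈ B i, d ∣ x) ∧ 0 < α ∧ d ∣ α ∧ 0 ≤ L ∧ (∀ x ∈ B i, x ≤ L) ∧
        ∀ z, d ∣ z → α ≤ z → z ≤ α + L → z ∈ BlockSums B n m := by
    rcases Nat.eq_zero_or_pos t with rfl | ht
    · left; simp
    have h1 := hbmin (a + (t - 1)) (by omega)
    push Not at h1
    obtain ⟨m, hm, hmU⟩ := (h1 (by omega)).2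
    have hm1 := hB _ (by omega) (by omega) m hm
    lift m to ℕ using by omega
    have hBm : ∀ i < t, ∀ x ∈ B (a + i), 0 ≤ x ∧ x < 2 * (m : ℤ) := fun i hi x hx => by
      have := hB (a + i) (by omega) (by omega) x hx
      omega
    rcases sum_card_le_or_mem_blockSums hbn (by omega)
        (fun i hi => hanti (by omega) hm) hBm with h | ⟨i, hi, hs, d, α, hd, hdB, hα, hdα, hz⟩
    · left
      rw [Finset.sum_Ico_eq_sum_range, Nat.add_sub_cancel_left]
      omega
    · refine Or.inr ⟨a + i, by omega, by omega, ?_, d, α, 2 * m, m, hd, hdB, hα, hdα, by omega,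
        fun x hx => (hBm i hi x hx).2.le, hz⟩
      rw [Finset.sum_Ico_eq_sum_range, Nat.add_sub_cancel_left]
      omega
  rcases hblock with h | h
  swap
  · exact Or.inr h
  have hrec := ih (U / 2) (by omega) (a + t) fun s hs hsn x hx =>
    ⟨(hB s (by omega) hsn x hx).1, (hb.resolve_left (by omega)) x (hanti hs hx)⟩
  rcases hrec with h' | ⟨i, hai, hin, hs, h'⟩
  · left
    rw [← Finset.sum_Ico_consecutive _ hab hbn]
    omega
  · refine Or.inr ⟨i, by omega, hin, ?_, h'⟩
    rw [← Finset.sum_Ico_consecutive _ hab hai]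
    omega

theorem mul_card_le_of_forall_dvd {S : Finset ℤ} {d M : ℤ} (hd : 1 ≤ d) (hdS : ∀ x ∈ S, d ∣ x)
    (hS : ∀ x ∈ S, 1 ≤ x ∧ x ≤ M) (hM : 0 ≤ M) : d * S.card ≤ M := by
  have h : S.card ≤ (Finset.Icc 1 (M / d)).card := by
    refine Finset.card_le_card_of_injOn (· / d) (fun x hx => ?_) fun x hx y hy hxy => ?_
    · obtain ⟨c, rfl⟩ := hdS x hx
      have := hS _ hx
      have hd' : d ≠ 0 := by omega
      rw [Finset.coe_Icc, Set.mem_Icc]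
      dsimp only
      rw [Int.mul_ediv_cancel_left _ hd']
      refine ⟨?_, (Int.le_ediv_iff_mul_le (by omega)).2 (by linarith)⟩
      by_contra! h
      nlinarith
    · rw [← Int.ediv_mul_cancel (hdS x hx), ← Int.ediv_mul_cancel (hdS y hy)]
      exact congrArg (· * d) hxy
  have h0 : 0 ≤ M / d := Int.ediv_nonneg hM (by omega)
  rw [Int.card_Icc] at h
  have h' : (S.card : ℤ) ≤ M / d := by omega
  calc d * S.card ≤ d * (M / d) := by gcongr
    _ ≤ M := Int.mul_ediv_self_le (by omega)

theorem exists_add_sum_of_dvd {B : ℕ → Finset ℤ} (hanti : Antitone B) {n i : ℕ} (hin : i ≤ n)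
    {T : Set ℤ} {d α L : ℤ} (hd : 1 ≤ d) (hpos : ∀ x ∈ B i, 1 ≤ x) (hdB : ∀ x ∈ B i, d ∣ x)
    (hL : ∀ x ∈ B i, x ≤ L) (hT : ∀ z, d ∣ z → α ≤ z → z ≤ α + L → z ∈ T) (z : ℤ) (hdz : d ∣ z)
    (hz : α ≤ z) (hz' : z ≤ α + L + d * ∑ s ∈ Finset.Ico i n, ((B s).card : ℤ)) :
    ∃ y ∈ T, ∃ e : ℕ → ℤ, (∀ s, e s ∈ insert 0 (B s)) ∧ z = y + ∑ s ∈ Finset.range n, e s := by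
  induction n, hin using Nat.le_induction generalizing z with
  | base => exact ⟨z, hT z hdz hz (by simpa using hz'), 0, by simp, by simp⟩
  | succ n hin ih =>
    have key : ∀ c ∈ insert 0 (B n), (∃ y ∈ T, ∃ e : ℕ → ℤ, (∀ s, e s ∈ insert 0 (B s)) ∧
        z - c = y + ∑ s ∈ Finset.range n, e s) → ∃ y ∈ T, ∃ e : ℕ → ℤ,
        (∀ s, e s ∈ insert 0 (B s)) ∧ z = y + ∑ s ∈ Finset.range (n + 1), e s := by
      rintro c hc ⟨y, hy, e, he, h⟩
      refine ⟨y, hy, Function.update e n c, fun s => ?_, ?_⟩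
      · rcases eq_or_ne s n with rfl | hs
        · simpa using hc
        · simpa [hs] using he s
      · rw [Finset.sum_range_succ, Function.update_self, Finset.sum_congr rfl
          fun j hj => Function.update_of_ne (Finset.mem_range.1 hj).ne _ _]
        linarith
    by_cases hzn : z ≤ α + L + d * ∑ s ∈ Finset.Ico i n, ((B s).card : ℤ)
    · exact key 0 (Finset.mem_insert_self _ _) (ih _ (by simpa using hdz) (by simpa using hz)
        (by simpa using hzn))
    rw [Finset.sum_Ico_succ_top hin] at hz'
    have hne : (B n).Nonempty := by
      by_contra h
      rw [Finset.not_nonempty_iff_eq_empty] at h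
      rw [h] at hz'
      simp at hz'
      exact hzn hz'
    have hM := (B n).max'_mem hne
    set M := (B n).max' hne
    have hMi := hanti hin hM
    have hcard := mul_card_le_of_forall_dvd (S := B n) (M := M) hd
      (fun x hx => hdB x (hanti hin hx))
      (fun x hx => ⟨hpos x (hanti hin hx), (B n).le_max' x hx⟩) (by have := hpos _ hMi; omega)
    have h0 : 0 ≤ d * ∑ s ∈ Finset.Ico i n, ((B s).card : ℤ) := by positivity
    have hML := hL _ hMi
    refine key M (Finset.mem_insert_of_mem hM) (ih _ (dvd_sub hdz (hdB _ hMi)) ?_ ?_)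
    · linarith
    · linarith

/-- `z` is a sum of at most `p` elements taken from distinct members of the family `A`. -/
def SumOfAtMost {ℓ : ℕ} (A : Fin ℓ → Finset ℤ) (p : ℕ) (z : ℤ) : Prop :=
  ∃ I : Finset (Fin ℓ), I.card ≤ p ∧ ∃ f : Fin ℓ → ℤ, (∀ i ∈ I, f i ∈ A i) ∧ z = ∑ i ∈ I, f i

theorem SumOfAtMost.mono {ℓ : ℕ} {A : Fin ℓ → Finset ℤ} {p q : ℕ} {z : ℤ}
    (h : SumOfAtMost A p z) (hpq : p ≤ q) : SumOfAtMost A q z := by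
  obtain ⟨I, hI, h⟩ := h
  exact ⟨I, hI.trans hpq, h⟩

theorem SumOfAtMost.add {ℓ : ℕ} {A : Fin ℓ → Finset ℤ} {p : ℕ} {z x : ℤ}
    (h : SumOfAtMost A p z) (hx : p < (Finset.univ.filter fun i => x ∈ A i).card) :
    SumOfAtMost A (p + 1) (z + x) := by
  obtain ⟨I, hI, f, hf, rfl⟩ := h
  obtain ⟨i, hi, hiI⟩ := Finset.exists_mem_notMem_of_card_lt_card (hI.trans_lt hx)
  refine ⟨insert i I, (Finset.card_insert_le _ _).trans (by omega), Function.update f i x, ?_, ?_⟩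
  · intro j hj
    rcases eq_or_ne j i with rfl | hji
    · simpa using hi
    · simpa [hji] using hf j (Finset.mem_of_mem_insert_of_ne hj hji)
  · rw [Finset.sum_insert hiI, Function.update_self, add_comm]
    congr 1
    refine Finset.sum_congr rfl fun j hj => (Function.update_of_ne ?_ _ _).symm
    rintro rfl
    exact hiI hj

theorem SumOfAtMost.add_mul {ℓ : ℕ} {A : Fin ℓ → Finset ℤ} {p : ℕ} {z x : ℤ}
    (h : SumOfAtMost A p z) (v : ℕ)
    (hx : v ≠ 0 → p + v ≤ (Finset.univ.filter fun i => x ∈ A i).card) :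
    SumOfAtMost A (p + v) (z + v * x) := by
  induction v with
  | zero => simpa using h
  | succ v ih =>
    have hx := hx (by omega)
    have := (ih fun _ => by omega).add (x := x) (by omega)
    rwa [add_assoc, add_assoc, ← add_one_mul, ← Nat.cast_succ] at this

/-- The elements of `{1, …, N}` lying in at least `8 * (s + 1)` members of the family `A`. -/
noncomputable def popularLevel {ℓ : ℕ} (A : Fin ℓ → Finset ℤ) (N : ℤ) (s : ℕ) : Finset ℤ :=
  (Finset.Icc 1 N).filter fun x => 8 * (s + 1) ≤ (Finset.univ.filter fun i => x ∈ A i).card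

theorem popularLevel_antitone {ℓ : ℕ} (A : Fin ℓ → Finset ℤ) (N : ℤ) :
    Antitone (popularLevel A N) := fun s t hst x hx => by
  rw [popularLevel, Finset.mem_filter] at hx ⊢
  exact ⟨hx.1, by omega⟩

theorem sum_card_le_sum_card_popularLevel {ℓ N : ℕ} {A : Fin ℓ → Finset ℤ}
    (hA : ∀ i, A i ⊆ Finset.Icc (1 : ℤ) N) :
    ∑ i, (A i).card ≤ 8 * ∑ s ∈ Finset.range ℓ, (popularLevel A N s).card + 7 * N := by
  have h1 : ∑ i, (A i).card =
      ∑ x ∈ Finset.Icc (1 : ℤ) N, (Finset.univ.filter fun i => x ∈ A i).card := by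
    simp_rw [Finset.card_filter]
    rw [Finset.sum_comm]
    refine Finset.sum_congr rfl fun i _ => ?_
    rw [← Finset.card_filter, Finset.filter_mem_eq_inter, Finset.inter_eq_right.2 (hA i)]
  have h2 : ∑ s ∈ Finset.range ℓ, (popularLevel A N s).card =
      ∑ x ∈ Finset.Icc (1 : ℤ) N, ((Finset.range ℓ).filter fun s =>
        8 * (s + 1) ≤ (Finset.univ.filter fun i => x ∈ A i).card).card := by
    simp_rw [popularLevel, Finset.card_filter]
    exact Finset.sum_comm
  have h3 : 7 * N = ∑ x ∈ Finset.Icc (1 : ℤ) N, 7 := by simp [mul_comm]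
  rw [h1, h2, h3, Finset.mul_sum, ← Finset.sum_add_distrib]
  refine Finset.sum_le_sum fun x _ => ?_
  set μ := (Finset.univ.filter fun i => x ∈ A i).card with hμ
  have hμℓ : μ ≤ ℓ := (Finset.card_le_univ _).trans (Fintype.card_fin ℓ).le
  have h4 : Finset.range (μ / 8) ⊆ (Finset.range ℓ).filter fun s => 8 * (s + 1) ≤ μ := by
    intro s hs
    rw [Finset.mem_range] at hs
    rw [Finset.mem_filter, Finset.mem_range]
    omega
  have h5 := Finset.card_le_card h4
  rw [Finset.card_range] at h5
  omega

theorem sumOfAtMost_of_popularLevel {ℓ : ℕ} {A : Fin ℓ → Finset ℤ} {N m : ℤ} {x e : ℕ → ℤ}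
    {v : ℕ → ℕ} (hx : ∀ s, x s ∈ insert 0 (popularLevel A N s))
    (he : ∀ s, e s ∈ insert 0 (popularLevel A N s)) (hv : ∀ s, v s ≤ 6)
    (hm : ∀ s, v s ≠ 0 → m ∈ popularLevel A N s) (n : ℕ) :
    SumOfAtMost A (8 * n) (∑ s ∈ Finset.range n, (x s + v s * m + e s)) := by
  have hadd : ∀ {s p z c}, c ∈ insert 0 (popularLevel A N s) → p < 8 * (s + 1) →
      SumOfAtMost A p z → SumOfAtMost A (p + 1) (z + c) := by
    intro s p z c hc hp h
    rcases Finset.mem_insert.1 hc with rfl | hc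
    · simpa using h.mono (Nat.le_succ p)
    · exact h.add (hp.trans_le (Finset.mem_filter.1 hc).2)
  induction n with
  | zero => exact ⟨∅, by simp, 0, by simp, by simp⟩
  | succ n ih =>
    have h1 := hadd (hx n) (by omega) ih
    have h2 := h1.add_mul (x := m) (v n) fun h => by
      have := (Finset.mem_filter.1 (hm n h)).2
      have := hv n
      omega
    have h3 := hadd (he n) (by have := hv n; omega) h2
    rw [Finset.sum_range_succ, ← add_assoc, ← add_assoc]
    exact h3.mono (by have := hv n; omega)

theorem exists_ap_in_oplusFamily {ℓ N : ℕ} {A : Fin ℓ → Finset ℤ}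
    (hA : ∀ i, A i ⊆ Finset.Icc (1 : ℤ) N) {K : ℕ} (hK : 0 < K)
    (hsum : 71 * N + 8 * K ≤ ∑ i, (A i).card) : HasAPLen (OplusFamily A) K := by
  set B := popularLevel A N with hBdef
  have hanti : Antitone B := popularLevel_antitone A N
  have hB : ∀ s, ∀ x ∈ B s, 1 ≤ x ∧ x ≤ (N : ℤ) := fun s x hx =>
    Finset.mem_Icc.1 (Finset.mem_filter.1 hx).1
  have hcard := sum_card_le_sum_card_popularLevel hA
  rw [← hBdef] at hcard
  rcases sum_card_le_or_exists_blockSums hanti ℓ N 0 fun s _ _ => hB s with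
    h | ⟨i, -, hi, hs, d, α, L, m, hd, hdB, hα, hdα, hL0, hL, hT⟩
  · rw [Nat.Ico_zero_eq_range] at h
    omega
  · rw [Nat.Ico_zero_eq_range] at hs
    rw [← Finset.sum_range_add_sum_Ico _ hi.le] at hcard
    have hKs : K ≤ ∑ s ∈ Finset.Ico i ℓ, (B s).card := by omega
    refine ⟨α, d, hd, fun j hj => ?_⟩
    obtain ⟨y, ⟨x, v, hx, hv, hm, rfl⟩, e, he, hz⟩ := exists_add_sum_of_dvd hanti hi.le hd
      (fun x hx => (hB i x hx).1) hdB hL hT (α + j * d) (dvd_add hdα (dvd_mul_left _ _))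
      (by have : 0 ≤ (j : ℤ) * d := by positivity
          linarith)
      (by have : (j : ℤ) * d ≤ d * ∑ s ∈ Finset.Ico i ℓ, ((B s).card : ℤ) := by
            rw [mul_comm]
            gcongr
            exact_mod_cast hj.le.trans hKs
          linarith)
    rw [← Finset.sum_add_distrib] at hz
    obtain ⟨I, -, f, hf, hfI⟩ := sumOfAtMost_of_popularLevel hx he hv hm ℓ
    refine ⟨I, ?_, f, hf, hz.trans hfI⟩
    rw [Finset.nonempty_iff_ne_empty]
    rintro rfl
    rw [hfI, Finset.sum_empty] at hz
    have : 0 ≤ (j : ℤ) * d := by positivity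
    linarith

theorem stmt7 :
    ∃ c : ℝ, 0 < c ∧
      ∀ (u k ℓ : ℕ), 0 < u → 0 < k → 0 < ℓ →
        ∀ u' : ℝ, (u : ℝ) ≤ u' →
          ∀ A : Fin ℓ → Finset ℤ,
            (∀ i, (A i).Nonempty) →
            (∀ i, A i ⊆ Finset.Icc (1 : ℤ) ((u : ℤ) - 1)) →
            (∀ i, k ≤ (A i).card) →
            (ℓ : ℝ) * (k : ℝ) ≥ c * u' →
            ∃ L : ℕ, (L : ℝ) ≥ u' ∧ HasAPLen (OplusFamily A) L := by
  refine ⟨87, by norm_num, fun u k ℓ hu hk hℓ u' hu' A _ hA hcard hℓk => ?_⟩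
  have hu1 : (1 : ℝ) ≤ u := by exact_mod_cast hu
  refine ⟨⌈u'⌉₊, Nat.le_ceil u', exists_ap_in_oplusFamily (N := u)
    (fun i => (hA i).trans (Finset.Icc_subset_Icc_right (by omega)))
    (Nat.ceil_pos.2 (by linarith)) ?_⟩
  have h1 : ℓ * k ≤ ∑ i, (A i).card := by
    simpa using Finset.sum_le_sum fun i (_ : i ∈ Finset.univ) => hcard i
  have h2 := Nat.ceil_lt_add_one (a := u') (by linarith)
  have h3 : ((71 * u + 8 * ⌈u'⌉₊ : ℕ) : ℝ) ≤ ((ℓ * k : ℕ) : ℝ) := by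
    push_cast
    linarith
  exact (Nat.cast_le.1 h3).trans h1
end

section
/- Let m ≥ 2 be an integer, let n > 0 be a real number, and let x₁, …, x_ℓ be integers with 1 ≤ x_i ≤ m for every i. If Σ_{i=1}^ℓ x_i ≥ n · log₂ m, then there exists an integer k with 1 ≤ k ≤ m such that the number of indices i with x_i ≥ k is at least n/(2k). -/
/-- Layer-cake formula for a finite family of integers in `[0, m]`. -/
theorem sum_eq_sum_card_filter_succ_le {ι : Type*} [Fintype ι] (m : ℕ) (x : ι → ℤ)
    (hx : ∀ i, 0 ≤ x i ∧ x i ≤ (m : ℤ)) :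
    ∑ i, x i =
      ∑ j ∈ Finset.range m, ((Finset.univ.filter fun i => ((j : ℤ) + 1) ≤ x i).card : ℤ) := by
  simp_rw [Finset.card_filter, Nat.cast_sum]
  rw [Finset.sum_comm]
  refine Finset.sum_congr rfl fun i _ => ?_
  obtain ⟨h0, h1⟩ := hx i
  rw [← Nat.cast_sum, ← Finset.card_filter]
  have hfilter : (Finset.range m).filter (fun j : ℕ => ((j : ℤ) + 1) ≤ x i)
      = Finset.range (x i).toNat := by
    ext j
    simp only [Finset.mem_filter, Finset.mem_range]
    omega
  rw [hfilter, Finset.card_range]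
  omega

theorem harmonic_le_two_mul_logb (m : ℕ) (hm : 2 ≤ m) :
    (harmonic m : ℝ) ≤ 2 * Real.logb 2 m := by
  have hlog2 : 0 < Real.log 2 := Real.log_pos one_lt_two
  have hlog2_le : Real.log 2 ≤ 1 := by linarith [Real.log_two_lt_d9]
  have hmono : Real.log 2 ≤ Real.log m :=
    Real.log_le_log two_pos (by exact_mod_cast hm)
  have hone : 1 ≤ Real.logb 2 m := (one_le_div hlog2).2 hmono
  have hlog : Real.log m ≤ Real.logb 2 m :=
    le_div_self (hlog2.le.trans hmono) hlog2 hlog2_le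
  linarith [harmonic_le_one_add_log m]

theorem stmt8 (m : ℕ) (hm : 2 ≤ m) (n : ℝ) (hn : 0 < n)
    (ℓ : ℕ) (x : Fin ℓ → ℤ) (hx : ∀ i, 1 ≤ x i ∧ x i ≤ (m : ℤ))
    (hsum : ((∑ i, x i : ℤ) : ℝ) ≥ n * Real.logb 2 m) :
    ∃ k : ℤ, 1 ≤ k ∧ k ≤ (m : ℤ) ∧
      n / (2 * (k : ℝ)) ≤ ((Finset.univ.filter fun i => k ≤ x i).card : ℝ) := by
  by_contra! hcard
  have hlt : ((∑ i, x i : ℤ) : ℝ) < n / 2 * (harmonic m : ℝ) := by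
    rw [sum_eq_sum_card_filter_succ_le m x fun i => ⟨by linarith [hx i], (hx i).2⟩, harmonic]
    push_cast
    rw [Finset.mul_sum]
    refine Finset.sum_lt_sum_of_nonempty (Finset.nonempty_range_iff.2 (by omega)) fun j hj => ?_
    have hjm := Finset.mem_range.1 hj
    have h := hcard ((j : ℤ) + 1) (by omega) (by omega)
    push_cast at h
    rwa [← div_div, div_eq_mul_inv (n / 2)] at h
  have hle := mul_le_mul_of_nonneg_left (harmonic_le_two_mul_logb m hm) (half_pos hn).le
  linarith
end

section
/- Let A be a finite nonempty set of nonnegative integers, let Δ ≥ 1 be an integer, and let B be a set of positive integers containing elements b₁ < b₂ < ⋯ < b_k with b_i − b_{i−1} ≤ Δ for every i ∈ {2,…,k}. If b_k − b₁ ≥ max(A), then there exist elements s₁ < s₂ < ⋯ < s_{k'} of A ⊕ B such that s₁ = b₁, s_{k'} = b_k + max(A), and s_i − s_{i−1} ≤ Δ for every i ∈ {2,…,k'}. -/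
/-- `A ⊕ B = (A + B) ∪ A ∪ B` for sets of integers. -/
def oplusSet (A B : Set ℤ) : Set ℤ := {s | ∃ a ∈ A, ∃ b ∈ B, s = a + b} ∪ A ∪ B

/-- If every non-maximal element of a finite set of integers is followed by another element at
distance at most `Δ`, then consecutive elements in its increasing enumeration differ by at most
`Δ`. -/
theorem orderEmbOfFin_succ_sub_le {T : Finset ℤ} {Δ m : ℤ} (hm : ∀ x ∈ T, x ≤ m)
    (h : ∀ x ∈ T, x < m → ∃ y ∈ T, x < y ∧ y ≤ x + Δ) (i : ℕ) (hi : i + 1 < T.card) :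
    T.orderEmbOfFin rfl ⟨i + 1, hi⟩ - T.orderEmbOfFin rfl ⟨i, by omega⟩ ≤ Δ := by
  have hlt : T.orderEmbOfFin rfl ⟨i, by omega⟩ < T.orderEmbOfFin rfl ⟨i + 1, hi⟩ :=
    (T.orderEmbOfFin rfl).strictMono (Fin.mk_lt_mk.mpr (Nat.lt_succ_self i))
  obtain ⟨y, hy, hxy, hyΔ⟩ := h _ (T.orderEmbOfFin_mem rfl ⟨i, by omega⟩)
    (hlt.trans_le (hm _ (T.orderEmbOfFin_mem rfl _)))
  have hy' : y ∈ Set.range (T.orderEmbOfFin rfl) := by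
    rw [Finset.range_orderEmbOfFin]
    exact hy
  obtain ⟨j, rfl⟩ := hy'
  have hij : (⟨i + 1, hi⟩ : Fin T.card) ≤ j := by
    have := (T.orderEmbOfFin rfl).lt_iff_lt.mp hxy
    rw [Fin.lt_def] at this
    exact Fin.le_def.mpr this
  have := (T.orderEmbOfFin rfl).monotone hij
  linarith

/-- A finite sequence with steps at most `Δ` that starts at or below `c` and ends above `c` has a
term in `(c, c + Δ]`. -/
theorem exists_lt_and_le_add_of_steps_le {k : ℕ} {b : Fin k → ℤ} {Δ c : ℤ} (hk : 0 < k)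
    (hdiff : ∀ (i : ℕ) (hi : i + 1 < k), b ⟨i + 1, hi⟩ - b ⟨i, by omega⟩ ≤ Δ)
    (h0 : b ⟨0, hk⟩ ≤ c) (hlast : c < b ⟨k - 1, Nat.sub_lt hk one_pos⟩) :
    ∃ j, c < b j ∧ b j ≤ c + Δ := by
  classical
  have hex : ∃ j, ∃ hj : j < k, c < b ⟨j, hj⟩ := ⟨k - 1, _, hlast⟩
  obtain ⟨hj, hc⟩ := Nat.find_spec hex
  have hmin := fun n => Nat.find_min hex (m := n)
  generalize Nat.find hex = j at hj hc hmin
  cases j with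
  | zero => exact absurd hc h0.not_gt
  | succ n =>
    refine ⟨⟨n + 1, hj⟩, hc, ?_⟩
    have hn : b ⟨n, by omega⟩ ≤ c :=
      not_lt.mp fun h => hmin n (Nat.lt_succ_self n) ⟨by omega, h⟩
    linarith [hdiff n hj]

theorem stmt9 (A : Finset ℤ) (hA : A.Nonempty) (hAnn : ∀ a ∈ A, 0 ≤ a)
    (Δ : ℤ) (hΔ : 1 ≤ Δ)
    (B : Set ℤ) (hBpos : ∀ b ∈ B, 0 < b)
    (k : ℕ) (hk : 0 < k) (b : Fin k → ℤ)
    (hmono : StrictMono b) (hmem : ∀ i, b i ∈ B)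
    (hdiff : ∀ (i : ℕ) (hi : i + 1 < k), b ⟨i + 1, hi⟩ - b ⟨i, by omega⟩ ≤ Δ)
    (hlong : b ⟨k - 1, Nat.sub_lt hk one_pos⟩ - b ⟨0, hk⟩ ≥ A.max' hA) :
    ∃ (k' : ℕ) (hk' : 0 < k') (s : Fin k' → ℤ),
      StrictMono s ∧
      (∀ i, s i ∈ oplusSet ↑A B) ∧
      s ⟨0, hk'⟩ = b ⟨0, hk⟩ ∧
      s ⟨k' - 1, Nat.sub_lt hk' one_pos⟩ = b ⟨k - 1, Nat.sub_lt hk one_pos⟩ + A.max' hA ∧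
      ∀ (i : ℕ) (hi : i + 1 < k'), s ⟨i + 1, hi⟩ - s ⟨i, by omega⟩ ≤ Δ := by
  classical
  set M := A.max' hA
  have hMA : M ∈ A := A.max'_mem hA
  have hM0 : 0 ≤ M := hAnn M hMA
  have hfirst : ∀ i, b ⟨0, hk⟩ ≤ b i := fun i =>
    hmono.monotone (Fin.le_def.mpr (Nat.zero_le _))
  have hlast : ∀ i, b i ≤ b ⟨k - 1, Nat.sub_lt hk one_pos⟩ := fun i =>
    hmono.monotone (Fin.le_def.mpr (Nat.le_sub_one_of_lt i.isLt))
  have hnext : ∀ i, b i < b ⟨k - 1, Nat.sub_lt hk one_pos⟩ →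
      ∃ j, b i < b j ∧ b j ≤ b i + Δ := fun i hi =>
    exists_lt_and_le_add_of_steps_le hk hdiff (hfirst i) hi
  set T : Finset ℤ := Finset.univ.image b ∪ Finset.univ.image fun i => M + b i with hT
  have hmemT : ∀ x, x ∈ T ↔ (∃ i, b i = x) ∨ ∃ i, M + b i = x := by
    simp [hT]
  have hbT : ∀ i, b i ∈ T := fun i => (hmemT _).mpr (.inl ⟨i, rfl⟩)
  have hMT : ∀ i, M + b i ∈ T := fun i => (hmemT _).mpr (.inr ⟨i, rfl⟩)
  have hmin : ∀ x ∈ T, b ⟨0, hk⟩ ≤ x := by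
    intro x hx
    rcases (hmemT x).mp hx with ⟨i, rfl⟩ | ⟨i, rfl⟩ <;> linarith [hfirst i]
  have hmax : ∀ x ∈ T, x ≤ b ⟨k - 1, Nat.sub_lt hk one_pos⟩ + M := by
    intro x hx
    rcases (hmemT x).mp hx with ⟨i, rfl⟩ | ⟨i, rfl⟩ <;> linarith [hlast i]
  have hcard : 0 < T.card := Finset.card_pos.mpr ⟨_, hbT ⟨0, hk⟩⟩
  refine ⟨T.card, hcard, T.orderEmbOfFin rfl, (T.orderEmbOfFin rfl).strictMono, ?_, ?_, ?_,
    orderEmbOfFin_succ_sub_le hmax ?_⟩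
  · intro i
    rcases (hmemT _).mp (T.orderEmbOfFin_mem rfl i) with ⟨j, hj⟩ | ⟨j, hj⟩
    · exact .inr (hj ▸ hmem j)
    · exact .inl (.inl ⟨M, hMA, b j, hmem j, hj.symm⟩)
  · rw [Finset.orderEmbOfFin_zero rfl hcard]
    exact le_antisymm (Finset.min'_le _ _ (hbT _)) (Finset.le_min' _ _ _ hmin)
  · rw [Finset.orderEmbOfFin_last rfl hcard]
    refine le_antisymm (Finset.max'_le _ _ _ hmax) (Finset.le_max' _ _ ?_)
    rw [add_comm]
    exact hMT _
  · intro x hx hlt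
    rcases (hmemT x).mp hx with ⟨i, rfl⟩ | ⟨i, rfl⟩
    · rcases (hlast i).lt_or_eq with hi | hi
      · obtain ⟨j, hj⟩ := hnext i hi
        exact ⟨b j, hbT j, hj⟩
      · obtain ⟨j, hj, hjΔ⟩ := exists_lt_and_le_add_of_steps_le (c := b i - M) hk hdiff
          (by linarith) (by linarith)
        exact ⟨M + b j, hMT j, by linarith, by linarith⟩
    · obtain ⟨j, hj, hjΔ⟩ := hnext i (by linarith)
      exact ⟨M + b j, hMT j, by linarith, by linarith⟩
end

section
/- Let μ ∈ (0,1) and let S be a finite nonempty set of positive integers. Define S̃ = (S ∩ [0, 2/μ)) ∪ ⋃_{i≥1} { 2^i · ⌊s/2^i⌋ : s ∈ S, 2^i/μ ≤ s < 2^{i+1}/μ }. Then S̃ is μ-canonical and S̃ approximates S with factor 1−μ. -/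
/-- A set of naturals is `μ`-canonical if every element in `[2^i/μ, 2^{i+1}/μ)` is a
multiple of `2^i`. -/
def MuCanonical (μ : ℝ) (S : Set ℕ) : Prop :=
  ∀ (i : ℕ), ∀ s ∈ S, (2 : ℝ) ^ i / μ ≤ (s : ℝ) → (s : ℝ) < 2 ^ (i + 1) / μ → 2 ^ i ∣ s

/-- `S'` approximates `S` with factor `1-μ`. -/
def ApproxFactor (μ : ℝ) (S S' : Set ℕ) : Prop :=
  (∀ s ∈ S, ∃ s' ∈ S', (1 - μ) * (s : ℝ) ≤ (s' : ℝ) ∧ (s' : ℝ) ≤ (s : ℝ)) ∧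
  (∀ s' ∈ S', ∃ s ∈ S, (s' : ℝ) ≤ (s : ℝ) ∧ (s : ℝ) ≤ (s' : ℝ) / (1 - μ))

/-- Rounding `s` down to a multiple of `2 ^ i` loses at most a `μ` fraction if `2 ^ i ≤ μ * s`. -/
lemma one_sub_mul_le_two_pow_mul_div {μ : ℝ} (hμ0 : 0 < μ) {i s : ℕ}
    (h : (2 : ℝ) ^ i / μ ≤ s) : (1 - μ) * (s : ℝ) ≤ ((2 ^ i * (s / 2 ^ i) : ℕ) : ℝ) := by
  have h1 : s < 2 ^ i * (s / 2 ^ i) + 2 ^ i := by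
    have := Nat.div_add_mod s (2 ^ i)
    have := Nat.mod_lt s (Nat.two_pow_pos i)
    omega
  have h2 : (s : ℝ) < ((2 ^ i * (s / 2 ^ i) : ℕ) : ℝ) + 2 ^ i := by exact_mod_cast h1
  rw [div_le_iff₀ hμ0] at h
  linarith

theorem stmt11 (μ : ℝ) (hμ0 : 0 < μ) (hμ1 : μ < 1)
    (S : Finset ℕ) (hS : S.Nonempty) (hpos : ∀ s ∈ S, 0 < s)
    (S' : Set ℕ)
    (hS' : S' = {s : ℕ | s ∈ S ∧ (s : ℝ) < 2 / μ} ∪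
        ⋃ i ∈ {i : ℕ | 1 ≤ i},
          {t : ℕ | ∃ s ∈ S, (2 : ℝ) ^ i / μ ≤ (s : ℝ) ∧ (s : ℝ) < 2 ^ (i + 1) / μ ∧
            t = 2 ^ i * (s / 2 ^ i)}) :
    MuCanonical μ S' ∧ ApproxFactor μ ↑S S' := by
  have hν : 0 < 1 - μ := sub_pos.2 hμ1
  have hmem : ∀ t, t ∈ S' ↔ (t ∈ S ∧ (t : ℝ) < 2 / μ) ∨ ∃ i, 1 ≤ i ∧ ∃ s ∈ S,
      (2 : ℝ) ^ i / μ ≤ (s : ℝ) ∧ (s : ℝ) < 2 ^ (i + 1) / μ ∧ t = 2 ^ i * (s / 2 ^ i) := by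
    intro t
    simp [hS']
  have hlt : ∀ {i j : ℕ} {x : ℝ}, (2 : ℝ) ^ i / μ ≤ x → x < 2 ^ j / μ → i < j := by
    intro i j x h1 h2
    have h3 := h1.trans_lt h2
    rw [div_lt_div_iff_of_pos_right hμ0] at h3
    exact (pow_lt_pow_iff_right₀ one_lt_two).1 h3
  refine ⟨fun j t ht h1 _ => ?_, fun s hs => ?_, fun t ht => ?_⟩
  · rcases (hmem t).1 ht with ⟨_, h2⟩ | ⟨i, _, s, _, _, h2, rfl⟩
    · have : j < 1 := hlt h1 (by simpa using h2)
      simp [Nat.lt_one_iff.1 this]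
    · have hle : ((2 ^ i * (s / 2 ^ i) : ℕ) : ℝ) ≤ s := by exact_mod_cast Nat.mul_div_le s (2 ^ i)
      have : j < i + 1 := hlt h1 (hle.trans_lt h2)
      exact (pow_dvd_pow 2 (by omega)).mul_right _
  · by_cases h : (s : ℝ) < 2 / μ
    · refine ⟨s, (hmem s).2 (Or.inl ⟨hs, h⟩), ?_, le_rfl⟩
      nlinarith [(Nat.cast_nonneg s : (0 : ℝ) ≤ s)]
    · have h2 : 2 ≤ (s : ℝ) * μ := (div_le_iff₀ hμ0).1 (not_lt.1 h)
      obtain ⟨i, hi1, hi2⟩ := exists_nat_pow_near (one_le_two.trans h2) (one_lt_two (α := ℝ))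
      have hi : 1 ≤ i := by
        by_contra h0
        obtain rfl : i = 0 := by omega
        norm_num at hi2
        linarith
      have h3 : (2 : ℝ) ^ i / μ ≤ s := (div_le_iff₀ hμ0).2 hi1
      exact ⟨_, (hmem _).2 (Or.inr ⟨i, hi, s, hs, h3, (lt_div_iff₀ hμ0).2 hi2, rfl⟩),
        one_sub_mul_le_two_pow_mul_div hμ0 h3, by exact_mod_cast Nat.mul_div_le s (2 ^ i)⟩
  · rcases (hmem t).1 ht with ⟨h1, _⟩ | ⟨i, _, s, hs, h1, _, rfl⟩
    · refine ⟨t, h1, le_rfl, (le_div_iff₀ hν).2 ?_⟩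
      nlinarith [(Nat.cast_nonneg t : (0 : ℝ) ≤ t)]
    · refine ⟨s, hs, by exact_mod_cast Nat.mul_div_le s (2 ^ i), (le_div_iff₀ hν).2 ?_⟩
      rw [mul_comm]
      exact one_sub_mul_le_two_pow_mul_div hμ0 h1
end

section
/- Let X be a finite nonempty multiset of positive integers with max(X) < (3/4)·Σ(X). Then there exists a sub-multiset Y of X with Σ(X)/4 ≤ Σ(Y) ≤ Σ(X)/2. -/
theorem stmt16 (X : Multiset ℕ) (hX : X ≠ 0) (hpos : ∀ x ∈ X, 0 < x)
    (hmax : ∀ x ∈ X, (x : ℝ) < (3 / 4) * (X.sum : ℝ)) :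
    ∃ Y : Multiset ℕ, Y ≤ X ∧
      (X.sum : ℝ) / 4 ≤ (Y.sum : ℝ) ∧ (Y.sum : ℝ) ≤ (X.sum : ℝ) / 2 := by
  have hmax' : ∀ x ∈ X, 4 * x < 3 * X.sum := fun x hx => by
    have h := hmax x hx
    have : (4 * x : ℝ) < 3 * X.sum := by linarith
    exact_mod_cast this
  suffices h : ∃ Y ≤ X, X.sum ≤ 4 * Y.sum ∧ 2 * Y.sum ≤ X.sum by
    obtain ⟨Y, hY, h₁, h₂⟩ := h
    have h₁' : (X.sum : ℝ) ≤ 4 * Y.sum := by exact_mod_cast h₁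
    have h₂' : (2 * Y.sum : ℝ) ≤ X.sum := by exact_mod_cast h₂
    exact ⟨Y, hY, by linarith, by linarith⟩
  -- Take `Y` of maximal sum among the sub-multisets of sum at most half of the total.
  obtain ⟨Y, hY, hYmax⟩ := Finset.exists_max_image
    (X.powerset.toFinset.filter fun Y => 2 * Y.sum ≤ X.sum) Multiset.sum ⟨0, by simp⟩
  simp only [Finset.mem_filter, Multiset.mem_toFinset, Multiset.mem_powerset] at hY hYmax
  obtain ⟨hYX, hYhalf⟩ := hY
  by_cases hYquarter : X.sum ≤ 4 * Y.sum
  · exact ⟨Y, hYX, hYquarter, hYhalf⟩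
  obtain ⟨Z, rfl⟩ := Multiset.le_iff_exists_add.mp hYX
  obtain ⟨a, ha⟩ : ∃ a, a ∈ Z := by
    refine Multiset.exists_mem_of_ne_zero ?_
    rintro rfl
    simp at hYquarter
    omega
  obtain ⟨W, rfl⟩ := Multiset.exists_cons_of_mem ha
  have haX : a ∈ Y + a ::ₘ W := by simp
  have ha_pos := hpos a haX
  have ha_lt := hmax' a haX
  have hYa := hYmax (a ::ₘ Y)
  have hle : a ::ₘ Y ≤ Y + a ::ₘ W := by simp
  simp only [hle, true_and, Multiset.sum_cons, Multiset.sum_add] at *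
  by_cases ha_half : 2 * a ≤ Y.sum + (a + W.sum)
  · exact ⟨{a}, by simp, by simp; omega, by simpa using ha_half⟩
  · exact ⟨Y + W, by simpa using Multiset.le_cons_self _ _, by simp; omega, by simp; omega⟩
end

section
/- Let X be a finite multiset of positive integers, let T > 0 be a real number, and let Z be the sub-multiset of X consisting of the elements strictly smaller than T. Suppose Z = Z₀ ⊎ Z₁ ⊎ ⋯ ⊎ Z_k is a partition of Z with Σ(Z₀) < T and T ≤ Σ(Z_i) < 2T for every i ∈ {1,…,k}. Let X' be the multiset obtained from X by removing all elements of Z and adding the k integers Σ(Z₁), …, Σ(Z_k). Then S_{X'} approximates S_X with additive error 2T. -/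
/-- The set of all subset sums of the multiset `X`. -/
def SubsetSums (X : Multiset ℕ) : Set ℕ :=
  {s | ∃ Y : Multiset ℕ, Y ≤ X ∧ Y.sum = s}

/-- `S'` approximates `S` with additive error `δ`. -/
def ApproxAdd (δ : ℝ) (S S' : Set ℕ) : Prop :=
  (∀ s ∈ S, ∃ s' ∈ S', (s : ℝ) - δ ≤ (s' : ℝ) ∧ (s' : ℝ) ≤ (s : ℝ) + δ) ∧
  (∀ s' ∈ S', ∃ s ∈ S, (s' : ℝ) - δ ≤ (s : ℝ) ∧ (s : ℝ) ≤ (s' : ℝ) + δ)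

/-- A sub-multiset of an image is the image of a sub-multiset. -/
theorem Multiset.exists_le_of_le_map {α β : Type*} (f : α → β) {s : Multiset α} {t : Multiset β}
    (h : t ≤ s.map f) : ∃ u ≤ s, u.map f = t := by
  induction s using Quotient.inductionOn with
  | h l =>
    induction t using Quotient.inductionOn with
    | h m =>
      obtain ⟨m', hperm, hsub⟩ := h
      obtain ⟨l', hl', rfl⟩ := List.sublist_map_iff.1 hsub
      exact ⟨(l' : Multiset α), Multiset.coe_le.2 hl'.subperm, Quotient.sound hperm⟩

/-- Every `y` with `0 ≤ y ≤ ∑ f + δ` is within `δ` of a subset sum of `f`, provided all values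
of `f` are at most `δ`. -/
theorem Finset.exists_subset_sum_near {ι : Type*} (s : Finset ι) (f : ι → ℝ) {δ y : ℝ}
    (hf : ∀ i, f i ≤ δ) (hy : 0 ≤ y) (hys : y ≤ ∑ i ∈ s, f i + δ) :
    ∃ t ⊆ s, ∑ i ∈ t, f i ≤ y ∧ y ≤ ∑ i ∈ t, f i + δ := by
  classical
  induction s using Finset.induction_on with
  | empty => exact ⟨∅, Finset.Subset.refl _, by simpa using hy, hys⟩
  | insert a s ha ih =>
    by_cases h : ∑ i ∈ insert a s, f i ≤ y
    · exact ⟨_, Finset.Subset.refl _, h, hys⟩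
    · rw [Finset.sum_insert ha] at h
      obtain ⟨t, hts, ht⟩ := ih (by linarith [hf a])
      exact ⟨t, hts.trans (Finset.subset_insert a s), ht⟩

theorem stmt18 (X : Multiset ℕ) (hpos : ∀ x ∈ X, 0 < x)
    (T : ℝ) (hT : 0 < T)
    (Z : Multiset ℕ) (hZ : Z = Multiset.filter (fun x : ℕ => (x : ℝ) < T) X)
    (k : ℕ) (Zf : Fin (k + 1) → Multiset ℕ)
    (hpart : (∑ i, Zf i) = Z)
    (h0 : ((Zf 0).sum : ℝ) < T)
    (hi : ∀ i : Fin (k + 1), i ≠ 0 →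
      T ≤ ((Zf i).sum : ℝ) ∧ ((Zf i).sum : ℝ) < 2 * T)
    (X' : Multiset ℕ)
    (hX' : X' = (X - Z) + Multiset.map (fun i : Fin k => (Zf i.succ).sum)
        (Finset.univ : Finset (Fin k)).val) :
    ApproxAdd (2 * T) (SubsetSums X) (SubsetSums X') := by
  have hZX : Z ≤ X := hZ ▸ Multiset.filter_le _ _
  have hsplit : X - Z + Z = X := tsub_add_cancel_of_le hZX
  have hsum : Z = Zf 0 + ∑ i : Fin k, Zf i.succ := by rw [← hpart, Fin.sum_univ_succ]
  subst hX'
  constructor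
  · rintro _ ⟨Y, hY, rfl⟩
    set A := Y - Z
    set B := Y ∩ Z
    have hYAB : A + B = Y := Multiset.sub_add_inter Y Z
    have hBsum : B.sum ≤ (Zf 0).sum + ∑ i : Fin k, (Zf i.succ).sum := by
      have hBZ : B ≤ Z := Multiset.inter_le_right
      obtain ⟨C, hC⟩ := Multiset.le_iff_exists_add.1 hBZ
      have h := congrArg Multiset.sum (hC.symm.trans hsum)
      have hs : (∑ i : Fin k, Zf i.succ).sum = ∑ i : Fin k, (Zf i.succ).sum :=
        map_sum (Multiset.sumAddMonoidHom : Multiset ℕ →+ ℕ) _ _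
      rw [Multiset.sum_add, Multiset.sum_add, hs] at h
      omega
    obtain ⟨t, -, ht₁, ht₂⟩ := Finset.exists_subset_sum_near (Finset.univ : Finset (Fin k))
      (fun i => ((Zf i.succ).sum : ℝ)) (δ := 2 * T) (y := B.sum)
      (fun i => (hi _ i.succ_ne_zero).2.le) (Nat.cast_nonneg _) (by
        have h : (B.sum : ℝ) ≤ (Zf 0).sum + ∑ i : Fin k, ((Zf i.succ).sum : ℝ) := by
          exact_mod_cast hBsum
        linarith)
    refine ⟨A.sum + ∑ i ∈ t, (Zf i.succ).sum,
      ⟨A + t.val.map fun i => (Zf i.succ).sum, ?_, by rw [Multiset.sum_add]; rfl⟩, ?_⟩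
    · exact add_le_add (tsub_le_tsub_right hY Z)
        (Multiset.map_le_map (Finset.val_le_iff.2 t.subset_univ))
    · rw [← hYAB, Multiset.sum_add]
      simp only [Nat.cast_add, Nat.cast_sum]
      constructor <;> linarith
  · rintro _ ⟨Y, hY, rfl⟩
    obtain ⟨u, hu, huY⟩ := Multiset.exists_le_of_le_map _ (tsub_le_iff_left.2 hY)
    have hY' := Multiset.sub_add_inter Y (X - Z)
    refine ⟨Y.sum, ⟨Y ∩ (X - Z) + (u.map fun i => Zf i.succ).sum, ?_, ?_⟩,
      by linarith, by linarith⟩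
    · refine le_of_le_of_eq (add_le_add Multiset.inter_le_right ?_) hsplit
      obtain ⟨v, hv⟩ := Multiset.le_iff_exists_add.1 hu
      have h : ∑ i : Fin k, Zf i.succ
          = (u.map fun i => Zf i.succ).sum + (v.map fun i => Zf i.succ).sum := by
        rw [← Multiset.sum_add, ← Multiset.map_add, ← hv]
        rfl
      rw [hsum, h]
      exact le_add_left (Multiset.le_add_right _ _)
    · conv_rhs => rw [← hY', ← huY]
      have h := map_multiset_sum (Multiset.sumAddMonoidHom : Multiset ℕ →+ ℕ)
        (u.map fun i => Zf i.succ)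
      rw [Multiset.map_map] at h
      rw [Multiset.sum_add, Multiset.sum_add, add_comm]
      exact congrArg (· + _) h
end
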